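/- Let q be a prime power, b̃ ∈ F_q*, and h ∈ F_q[x] a polynomial of degree k with 1 ≤ k < q − 1; set ν = gcd(k, q−1). Then the number of pairs (x, y) ∈ F_q* × F_q* with x ≠ y satisfying x·y·(h(x) − h(y)) + b̃·(x − y) = 0 is at least q + 1 − k(k−1)·√q − (ν + k + 2), where √q denotes the real square root of q. -/

import Mathlib

open Polynomial in
/-- Power series that agree modulo `X ^ m` with a polynomial in `τ` with coefficients in `S`. -/
noncomputable def approxSubring {R : Type*} [CommRing R] (S : Subring R) (τ : PowerSeries R)
    (m : ℕ) : Subring (PowerSeries R) where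
  carrier := {f | ∃ P : S[X], (PowerSeries.X : PowerSeries R) ^ m ∣
    f - P.eval₂ ((PowerSeries.C (R := R)).comp S.subtype) τ}
  mul_mem' := by
    rintro f g ⟨P, hP⟩ ⟨Q, hQ⟩
    refine ⟨P * Q, ?_⟩
    rw [Polynomial.eval₂_mul]
    have := dvd_add (hQ.mul_left f)
      (hP.mul_right (Q.eval₂ ((PowerSeries.C (R := R)).comp S.subtype) τ))
    convert this using 1
    ring
  one_mem' := ⟨1, by simp⟩
  add_mem' := by
    rintro f g ⟨P, hP⟩ ⟨Q, hQ⟩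
    refine ⟨P + Q, ?_⟩
    rw [Polynomial.eval₂_add]
    convert dvd_add hP hQ using 1
    ring
  zero_mem' := ⟨0, by simp⟩
  neg_mem' := by
    rintro f ⟨P, hP⟩
    refine ⟨-P, ?_⟩
    rw [Polynomial.eval₂_neg]
    convert (dvd_neg.mpr hP) using 1
    ring

namespace approxSubring

variable {R : Type*} [CommRing R] {S : Subring R} {τ : PowerSeries R} {m : ℕ}

theorem C_mem {s : R} (hs : s ∈ S) : PowerSeries.C s ∈ approxSubring S τ m :=
  ⟨Polynomial.C ⟨s, hs⟩, by simp⟩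

theorem self_mem : τ ∈ approxSubring S τ m :=
  ⟨Polynomial.X, by simp⟩

theorem mem_of_dvd {f : PowerSeries R} (h : (PowerSeries.X : PowerSeries R) ^ m ∣ f) :
    f ∈ approxSubring S τ m :=
  ⟨0, by simpa using h⟩

theorem eval_mem (P : Polynomial S) {τ' : PowerSeries R} (hτ : τ' ∈ approxSubring S τ m) :
    P.eval₂ ((PowerSeries.C (R := R)).comp S.subtype) τ' ∈ approxSubring S τ m := by
  rw [Polynomial.eval₂_eq_sum]
  refine Subring.sum_mem _ fun i _ => Subring.mul_mem _ ?_ (Subring.pow_mem _ hτ _)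
  exact C_mem (P.coeff i).2

theorem le_of_mem {τ' : PowerSeries R} (hτ : τ' ∈ approxSubring S τ m) :
    approxSubring S τ' m ≤ approxSubring S τ m := by
  rintro f ⟨P, hP⟩
  have := Subring.add_mem _ (mem_of_dvd (S := S) (τ := τ) hP) (eval_mem P hτ)
  simpa using this

theorem mem_one {f : PowerSeries R} (hf : PowerSeries.constantCoeff f ∈ S) :
    f ∈ approxSubring S τ 1 := by
  refine ⟨Polynomial.C ⟨_, hf⟩, ?_⟩
  rw [pow_one, PowerSeries.X_dvd_iff]
  simp

theorem mul_mem_succ (hm : 1 ≤ m) {f g : PowerSeries R}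
    (hf : f ∈ approxSubring S τ m) (hg : g ∈ approxSubring S τ m)
    (hf0 : PowerSeries.constantCoeff f = 0) (hg0 : PowerSeries.constantCoeff g = 0) :
    f * g ∈ approxSubring S τ (m + 1) := by
  obtain ⟨P, hP⟩ := hf
  obtain ⟨Q, hQ⟩ := hg
  refine ⟨P * Q, ?_⟩
  rw [Polynomial.eval₂_mul]
  set p := P.eval₂ ((PowerSeries.C (R := R)).comp S.subtype) τ
  set q := Q.eval₂ ((PowerSeries.C (R := R)).comp S.subtype) τ
  have hX : (PowerSeries.X : PowerSeries R) ∣ q := by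
    have h1 := (dvd_pow_self (PowerSeries.X : PowerSeries R) (by omega : m ≠ 0)).trans hQ
    have h2 := PowerSeries.X_dvd_iff.mpr hg0
    exact (dvd_sub_right h2).mp h1
  have hXf : (PowerSeries.X : PowerSeries R) ∣ f := PowerSeries.X_dvd_iff.mpr hf0
  have e : f * g - p * q = (g - q) * f + (f - p) * q := by ring
  rw [e, pow_succ]
  exact dvd_add (mul_dvd_mul hQ hXf) (mul_dvd_mul hP hX)

theorem mem_of_one_sub_mul_mem {ω f : PowerSeries R} (hω : ω ∈ approxSubring S τ m)
    (hω0 : PowerSeries.constantCoeff ω = 0) (h : (1 - ω) * f ∈ approxSubring S τ m) :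
    f ∈ approxSubring S τ m := by
  have e : f = (∑ i ∈ Finset.range m, ω ^ i) * ((1 - ω) * f) + ω ^ m * f := by
    have := geom_sum_mul_neg ω m
    rw [← mul_assoc, this]
    ring
  rw [e]
  refine Subring.add_mem _ (Subring.mul_mem _ (Subring.sum_mem _ fun i _ => Subring.pow_mem _ hω _)
    h) (mem_of_dvd (Dvd.dvd.mul_right ?_ _))
  exact pow_dvd_pow_of_dvd (PowerSeries.X_dvd_iff.mpr hω0) m

theorem map_mem {R' : Type*} [CommRing R'] {S' : Subring R'} (σ : R →+* R')
    (hσ : ∀ s ∈ S, σ s ∈ S') {f : PowerSeries R} (hf : f ∈ approxSubring S τ m) :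
    PowerSeries.map σ f ∈ approxSubring S' (PowerSeries.map σ τ) m := by
  obtain ⟨P, hP⟩ := hf
  have h1 : PowerSeries.map σ (P.eval₂ ((PowerSeries.C (R := R)).comp S.subtype) τ) ∈
      approxSubring S' (PowerSeries.map σ τ) m := by
    rw [Polynomial.eval₂_eq_sum, Polynomial.sum, map_sum]
    refine Subring.sum_mem _ fun i _ => ?_
    rw [map_mul, map_pow]
    refine Subring.mul_mem _ ?_ (Subring.pow_mem _ self_mem _)
    simpa using C_mem (hσ _ (P.coeff i).2)
  have h2 : (PowerSeries.X : PowerSeries R') ^ m ∣ PowerSeries.map σ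
      (f - P.eval₂ ((PowerSeries.C (R := R)).comp S.subtype) τ) := by
    have := map_dvd (PowerSeries.map σ) hP
    simpa using this
  have := Subring.add_mem _ (mem_of_dvd (S := S') (τ := PowerSeries.map σ τ) h2) h1
  rw [← map_add] at this
  simpa using this

end approxSubring

/-- Second order Taylor expansion of a polynomial in two variables. -/
theorem MvPolynomial.exists_taylor_two {k : Type*} [CommRing k] (p : MvPolynomial (Fin 2) k) :
    ∃ r₁ r₂ r₃ : MvPolynomial (Fin 4) k, aeval ![X 0 + X 2, X 1 + X 3] p =
      aeval ![X 0, X 1] p + aeval ![X 0, X 1] (pderiv 0 p) * X 2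
        + aeval ![X 0, X 1] (pderiv 1 p) * X 3
        + r₁ * X 2 ^ 2 + r₂ * (X 2 * X 3) + (r₃ * X 3 ^ 2 : MvPolynomial (Fin 4) k) := by
  induction p using MvPolynomial.induction_on with
  | C a => exact ⟨0, 0, 0, by simp⟩
  | add p q hp hq =>
    obtain ⟨a, b, c, h⟩ := hp
    obtain ⟨a', b', c', h'⟩ := hq
    refine ⟨a + a', b + b', c + c', ?_⟩
    simp only [map_add, h, h']
    ring
  | mul_X p i hp =>
    obtain ⟨a, b, c, h⟩ := hp
    fin_cases i
    · refine ⟨a * (X 0 + X 2) + aeval ![X 0, X 1] (pderiv 0 p),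
        b * (X 0 + X 2) + aeval ![X 0, X 1] (pderiv 1 p), c * (X 0 + X 2), ?_⟩
      simp [h, pderiv_X, -aeval_eq_bind₁]
      ring
    · refine ⟨a * (X 1 + X 3), b * (X 1 + X 3) + aeval ![X 0, X 1] (pderiv 0 p),
        c * (X 1 + X 3) + aeval ![X 0, X 1] (pderiv 1 p), ?_⟩
      simp [h, pderiv_X, -aeval_eq_bind₁]
      ring

theorem MvPolynomial.exists_taylor_two_aeval {k : Type*} [CommRing k]
    (p : MvPolynomial (Fin 2) k) (R : Type*) [CommRing R] [Algebra k R] :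
    ∃ r₁ r₂ r₃ : MvPolynomial (Fin 4) k, ∀ x y A B : R, aeval ![x + A, y + B] p =
      aeval ![x, y] p + aeval ![x, y] (pderiv 0 p) * A + aeval ![x, y] (pderiv 1 p) * B
        + aeval ![x, y, A, B] r₁ * A ^ 2 + aeval ![x, y, A, B] r₂ * (A * B)
        + aeval ![x, y, A, B] r₃ * B ^ 2 := by
  obtain ⟨r₁, r₂, r₃, h⟩ := p.exists_taylor_two
  refine ⟨r₁, r₂, r₃, fun x y A B => ?_⟩
  have e (f g : MvPolynomial (Fin 4) k) (p : MvPolynomial (Fin 2) k) :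
      aeval ![x, y, A, B] (aeval ![f, g] p) =
        aeval ![aeval ![x, y, A, B] f, aeval ![x, y, A, B] g] p := by
    rw [← AlgHom.comp_apply, comp_aeval]
    congr 2
    funext i
    fin_cases i <;> rfl
  have := congrArg (aeval ![x, y, A, B]) h
  simpa [e, -aeval_eq_bind₁] using this

theorem MvPolynomial.map_aeval_pair {k R R' : Type*} [CommRing k] [CommRing R] [CommRing R']
    [Algebra k R] [Algebra k R'] (σ : R →+* R')
    (hσ : ∀ a, σ (algebraMap k R a) = algebraMap k R' a) (x y : R) (p : MvPolynomial (Fin 2) k) :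
    σ (aeval ![x, y] p) = aeval ![σ x, σ y] p := by
  have := comp_aeval_apply (R := k) ![x, y] ({ σ with commutes' := hσ } : R →ₐ[k] R') p
  refine this.trans ?_
  congr 2
  funext i
  fin_cases i <;> rfl

theorem MvPolynomial.aeval_mem_subring {k R ι : Type*} [CommRing k] [CommRing R] [Algebra k R]
    {S : Subring R} (hS : ∀ a, algebraMap k R a ∈ S) {f : ι → R} (hf : ∀ i, f i ∈ S)
    (p : MvPolynomial ι k) : aeval f p ∈ S := by
  induction p using MvPolynomial.induction_on with
  | C a => simpa using hS a
  | add p q hp hq => simpa using S.add_mem hp hq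
  | mul_X p i hp => simpa using S.mul_mem hp (hf i)

section Chart

open MvPolynomial

variable {k K : Type*} [Field k] [Field K] [Algebra k K]

theorem MvPolynomial.aeval_pair_constantCoeff {R : Type*} [CommRing R] [Algebra k R]
    (p : MvPolynomial (Fin 2) k) (f g : PowerSeries R) :
    PowerSeries.constantCoeff (aeval ![f, g] p) =
      aeval ![PowerSeries.constantCoeff f, PowerSeries.constantCoeff g] p :=
  map_aeval_pair _ (fun a => by simp [PowerSeries.algebraMap_apply]) _ _ _

theorem MvPolynomial.aeval_pair_C {R : Type*} [CommRing R] [Algebra k R]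
    (p : MvPolynomial (Fin 2) k) (x y : R) :
    aeval ![PowerSeries.C x, PowerSeries.C y] p =
      (PowerSeries.C (aeval ![x, y] p) : PowerSeries R) :=
  (map_aeval_pair _ (fun a => by simp [PowerSeries.algebraMap_apply]) _ _ _).symm

theorem exists_chart_of_ratio_mem {O : Subring K} (hkO : ∀ a, algebraMap k K a ∈ O)
    (p : MvPolynomial (Fin 2) k) {f g : PowerSeries K} (h : aeval ![f, g] p = 0) {x y : K}
    (hfx : PowerSeries.constantCoeff f = x) (hgy : PowerSeries.constantCoeff g = y)
    (hx : x ∈ O) (hy : y ∈ O) (hp : aeval ![x, y] (pderiv 1 p) ≠ 0)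
    (hr : aeval ![x, y] (pderiv 0 p) / aeval ![x, y] (pderiv 1 p) ∈ O) (c : K)
    (hc : PowerSeries.coeff 1 f = c * aeval ![x, y] (pderiv 1 p)) :
    ∃ τ : PowerSeries K, PowerSeries.constantCoeff τ = 0 ∧ PowerSeries.coeff 1 τ = c ∧
      ∀ m, f ∈ approxSubring O τ m ∧ g ∈ approxSubring O τ m := by
  have hpy : aeval ![x, y] (pderiv 1 p) ∈ O :=
    aeval_mem_subring hkO (fun i => by fin_cases i <;> assumption) _
  have hpxy : aeval ![x, y] p = 0 := by
    have := congrArg PowerSeries.constantCoeff h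
    rwa [MvPolynomial.aeval_pair_constantCoeff, hfx, hgy, map_zero] at this
  obtain ⟨r₁, r₂, r₃, ht⟩ := p.exists_taylor_two_aeval (PowerSeries K)
  set u := aeval ![x, y] (pderiv 1 p)
  set v := aeval ![x, y] (pderiv 0 p)
  set τ : PowerSeries K := PowerSeries.C u⁻¹ * (f - PowerSeries.C x) with hτ
  set Z : PowerSeries K := PowerSeries.C u⁻¹ * (g - PowerSeries.C y) with hZ
  have hCu : PowerSeries.C u * PowerSeries.C u⁻¹ = (1 : PowerSeries K) := by
    rw [← map_mul, mul_inv_cancel₀ hp, map_one]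
  have hf : f = PowerSeries.C x + PowerSeries.C u * τ := by
    rw [hτ, ← mul_assoc, hCu]; ring
  have hg : g = PowerSeries.C y + PowerSeries.C u * Z := by
    rw [hZ, ← mul_assoc, hCu]; ring
  have hτ0 : PowerSeries.constantCoeff τ = 0 := by simp [hτ, hfx]
  have hZ0 : PowerSeries.constantCoeff Z = 0 := by simp [hZ, hgy]
  have key := ht (PowerSeries.C x) (PowerSeries.C y) (PowerSeries.C u * τ) (PowerSeries.C u * Z)
  rw [← hf, ← hg, h, MvPolynomial.aeval_pair_C, MvPolynomial.aeval_pair_C,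
    MvPolynomial.aeval_pair_C, hpxy, map_zero] at key
  change 0 = 0 + PowerSeries.C v * _ + PowerSeries.C u * _ + _ + _ + _ at key
  set a := ![PowerSeries.C x, PowerSeries.C y, PowerSeries.C u * τ, PowerSeries.C u * Z] with ha
  have hrec : Z = -(PowerSeries.C (v / u) * τ + τ * (aeval a r₁ * τ) + τ * (aeval a r₂ * Z)
      + Z * (aeval a r₃ * Z)) := by
    rw [div_eq_mul_inv, map_mul]
    linear_combination (-(PowerSeries.C u⁻¹) ^ 2) * key - (PowerSeries.C v * PowerSeries.C u⁻¹ * τ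
      + (Z + aeval a r₁ * τ ^ 2 + aeval a r₂ * (τ * Z) + aeval a r₃ * Z ^ 2) *
        (1 + PowerSeries.C u * PowerSeries.C u⁻¹)) * hCu
  have hmem : ∀ m, Z ∈ approxSubring O τ (m + 1) := by
    intro m
    induction m with
    | zero => exact approxSubring.mem_one (by rw [hZ0]; exact O.zero_mem)
    | succ m ih =>
      have hτm : τ ∈ approxSubring O τ (m + 1) := approxSubring.self_mem
      have hmr (r : MvPolynomial (Fin 4) k) : aeval a r ∈ approxSubring O τ (m + 1) := by
        refine aeval_mem_subring (fun b => ?_) (fun i => ?_) r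
        · rw [PowerSeries.algebraMap_apply]
          exact approxSubring.C_mem (hkO b)
        · fin_cases i
          · exact approxSubring.C_mem hx
          · exact approxSubring.C_mem hy
          · exact Subring.mul_mem _ (approxSubring.C_mem hpy) hτm
          · exact Subring.mul_mem _ (approxSubring.C_mem hpy) ih
      rw [hrec]
      refine Subring.neg_mem _ (Subring.add_mem _ (Subring.add_mem _ (Subring.add_mem _ ?_ ?_) ?_)
        ?_)
      · exact Subring.mul_mem _ (approxSubring.C_mem hr) approxSubring.self_mem
      · exact approxSubring.mul_mem_succ (by omega) hτm (Subring.mul_mem _ (hmr _) hτm) hτ0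
          (by simp [hτ0])
      · exact approxSubring.mul_mem_succ (by omega) hτm (Subring.mul_mem _ (hmr _) ih) hτ0
          (by simp [hZ0])
      · exact approxSubring.mul_mem_succ (by omega) ih (Subring.mul_mem _ (hmr _) ih) hZ0
          (by simp [hZ0])
  refine ⟨τ, hτ0, ?_, fun m => ⟨?_, ?_⟩⟩
  · rw [hτ, PowerSeries.coeff_C_mul, map_sub, hc, PowerSeries.coeff_C]
    field_simp
    simp
  · rw [hf]
    exact Subring.add_mem _ (approxSubring.C_mem hx)
      (Subring.mul_mem _ (approxSubring.C_mem hpy) approxSubring.self_mem)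
  · rcases m with _ | m
    · exact approxSubring.mem_of_dvd (by simp)
    · rw [hg]
      exact Subring.add_mem _ (approxSubring.C_mem hy)
        (Subring.mul_mem _ (approxSubring.C_mem hpy) (hmem m))

theorem MvPolynomial.aeval_rename_swap {R : Type*} [CommRing R] [Algebra k R] (x y : R)
    (p : MvPolynomial (Fin 2) k) :
    aeval ![x, y] (rename (Equiv.swap 0 1) p) = aeval ![y, x] p := by
  rw [aeval_rename]
  congr 2
  funext i
  fin_cases i <;> simp

theorem MvPolynomial.pderiv_rename_swap (i : Fin 2) (p : MvPolynomial (Fin 2) k) :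
    pderiv i (rename (Equiv.swap 0 1) p) =
      rename (Equiv.swap 0 1) (pderiv (Equiv.swap 0 1 i) p) := by
  have := pderiv_rename (R := k) (f := Equiv.swap (0 : Fin 2) 1) (Equiv.injective _)
    (Equiv.swap 0 1 i) p
  rwa [Equiv.swap_apply_self] at this

theorem exists_chart_of_ratio_mem_swap {O : Subring K} (hkO : ∀ a, algebraMap k K a ∈ O)
    (p : MvPolynomial (Fin 2) k) {f g : PowerSeries K} (h : aeval ![f, g] p = 0) {x y : K}
    (hfx : PowerSeries.constantCoeff f = x) (hgy : PowerSeries.constantCoeff g = y)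
    (hx : x ∈ O) (hy : y ∈ O) (hp : aeval ![x, y] (pderiv 0 p) ≠ 0)
    (hr : aeval ![x, y] (pderiv 1 p) / aeval ![x, y] (pderiv 0 p) ∈ O) (c : K)
    (hc : PowerSeries.coeff 1 g = -c * aeval ![x, y] (pderiv 0 p)) :
    ∃ τ : PowerSeries K, PowerSeries.constantCoeff τ = 0 ∧ PowerSeries.coeff 1 τ = c ∧
      ∀ m, f ∈ approxSubring O τ m ∧ g ∈ approxSubring O τ m := by
  have e0 : aeval ![y, x] (pderiv 0 (rename (Equiv.swap 0 1) p)) = aeval ![x, y] (pderiv 1 p) := by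
    rw [pderiv_rename_swap, aeval_rename_swap, Equiv.swap_apply_left]
  have e1 : aeval ![y, x] (pderiv 1 (rename (Equiv.swap 0 1) p)) = aeval ![x, y] (pderiv 0 p) := by
    rw [pderiv_rename_swap, aeval_rename_swap, Equiv.swap_apply_right]
  obtain ⟨τ, h0, h1, h2⟩ := exists_chart_of_ratio_mem hkO (rename (Equiv.swap 0 1) p)
    (f := g) (g := f) (by rw [aeval_rename_swap, h]) hgy hfx hy hx (by rwa [e1]) (by rwa [e0, e1])
    (-c) (by rw [hc, e1])
  refine ⟨-τ, by simp [h0], by simp [h1], fun m => ?_⟩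
  have hle : approxSubring O τ m ≤ approxSubring O (-τ) m :=
    approxSubring.le_of_mem (by simpa using Subring.neg_mem _ (approxSubring.self_mem (τ := -τ)))
  exact ⟨hle (h2 m).2, hle (h2 m).1⟩

theorem exists_chart {O : ValuationSubring K} (hkO : ∀ a, algebraMap k K a ∈ O)
    (p : MvPolynomial (Fin 2) k) {f g : PowerSeries K} (h : aeval ![f, g] p = 0) {x y : K}
    (hfx : PowerSeries.constantCoeff f = x) (hgy : PowerSeries.constantCoeff g = y)
    (hx : x ∈ O) (hy : y ∈ O)
    (hp : aeval ![x, y] (pderiv 0 p) ≠ 0 ∨ aeval ![x, y] (pderiv 1 p) ≠ 0) (c : K)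
    (hf1 : PowerSeries.coeff 1 f = c * aeval ![x, y] (pderiv 1 p))
    (hg1 : PowerSeries.coeff 1 g = -c * aeval ![x, y] (pderiv 0 p)) :
    ∃ τ : PowerSeries K, PowerSeries.constantCoeff τ = 0 ∧ PowerSeries.coeff 1 τ = c ∧
      ∀ m, f ∈ approxSubring O.toSubring τ m ∧ g ∈ approxSubring O.toSubring τ m := by
  by_cases h1 : aeval ![x, y] (pderiv 1 p) = 0
  · have h0 := hp.resolve_right (not_not.mpr h1)
    exact exists_chart_of_ratio_mem_swap (O := O.toSubring) hkO p h hfx hgy hx hy h0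
      (by rw [h1, zero_div]; exact O.toSubring.zero_mem) c hg1
  · rcases O.mem_or_inv_mem (aeval ![x, y] (pderiv 0 p) / aeval ![x, y] (pderiv 1 p)) with hO | hO
    · exact exists_chart_of_ratio_mem (O := O.toSubring) hkO p h hfx hgy hx hy h1 hO c hf1
    · rw [inv_div] at hO
      by_cases h0 : aeval ![x, y] (pderiv 0 p) = 0
      · exact exists_chart_of_ratio_mem (O := O.toSubring) hkO p h hfx hgy hx hy h1
          (by rw [h0, zero_div]; exact O.toSubring.zero_mem) c hf1
      · exact exists_chart_of_ratio_mem_swap (O := O.toSubring) hkO p h hfx hgy hx hy h0 hO c hg1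

end Chart

section BlowUp

open MvPolynomial

variable {k K : Type*} [Field k] [Field K] [Algebra k K]

theorem MvPolynomial.derivation_aeval_pair {R : Type*} [CommRing R] [Algebra k R]
    (D : Derivation k R R) (x y : R) (p : MvPolynomial (Fin 2) k) :
    D (aeval ![x, y] p) =
      aeval ![x, y] (pderiv 0 p) * D x + aeval ![x, y] (pderiv 1 p) * D y := by
  induction p using MvPolynomial.induction_on with
  | C a => simp
  | add p q hp hq => simp only [map_add, hp, hq]; ring
  | mul_X p i hp =>
    fin_cases i
    · simp [hp, pderiv_X]
      ring
    · simp [hp, pderiv_X]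
      ring

theorem MvPolynomial.exists_blowup (p : MvPolynomial (Fin 2) k) (s v : k)
    (h : aeval ![s, v] p = 0) (h0 : aeval ![s, v] (pderiv 0 p) = 0)
    (h1 : aeval ![s, v] (pderiv 1 p) = 0) :
    ∃ r : MvPolynomial (Fin 2) k, aeval ![C s + X 0, C v + X 0 * X 1] p = X 0 ^ 2 * r := by
  obtain ⟨r₁, r₂, r₃, ht⟩ := p.exists_taylor_two_aeval (MvPolynomial (Fin 2) k)
  have e (q : MvPolynomial (Fin 2) k) :
      aeval ![(C s : MvPolynomial (Fin 2) k), C v] q = C (aeval ![s, v] q) :=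
    (map_aeval_pair C (fun a => by simp [algebraMap_eq]) _ _ _).symm
  have key := ht (C s) (C v) (X 0) (X 0 * X 1)
  rw [e, e, e, h, h0, h1, map_zero] at key
  refine ⟨aeval ![C s, C v, X 0, X 0 * X 1] r₁ + aeval ![C s, C v, X 0, X 0 * X 1] r₂ * X 1 +
      aeval ![C s, C v, X 0, X 0 * X 1] r₃ * X 1 ^ 2, key.trans ?_⟩
  ring

theorem exists_blowup_chart {O : ValuationSubring K} (hkO : ∀ a, algebraMap k K a ∈ O)
    (p : MvPolynomial (Fin 2) k) {f g : PowerSeries K} (h : aeval ![f, g] p = 0) {x y : K}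
    (hfx : PowerSeries.constantCoeff f = x) (hgy : PowerSeries.constantCoeff g = y) (s v : k)
    (hx : x - algebraMap k K s ∈ O) (hx0 : x - algebraMap k K s ≠ 0)
    (hy : (y - algebraMap k K v) / (x - algebraMap k K s) ∈ O)
    (hsv : aeval ![s, v] p = 0) (hsv0 : aeval ![s, v] (pderiv 0 p) = 0)
    (hsv1 : aeval ![s, v] (pderiv 1 p) = 0)
    (hp : aeval ![x, y] (pderiv 0 p) ≠ 0 ∨ aeval ![x, y] (pderiv 1 p) ≠ 0) (c : K)
    (hf1 : PowerSeries.coeff 1 f = c * aeval ![x, y] (pderiv 1 p))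
    (hg1 : PowerSeries.coeff 1 g = -c * aeval ![x, y] (pderiv 0 p)) :
    ∃ τ : PowerSeries K, PowerSeries.constantCoeff τ = 0 ∧
      PowerSeries.coeff 1 τ = c * (x - algebraMap k K s) ∧
      ∀ m, f ∈ approxSubring O.toSubring τ m ∧ g ∈ approxSubring O.toSubring τ m := by
  obtain ⟨r, hr⟩ := p.exists_blowup s v hsv hsv0 hsv1
  set X' := x - algebraMap k K s with hX'
  set Y' := (y - algebraMap k K v) / X' with hY'
  set f' := f - PowerSeries.C (algebraMap k K s) with hf'
  have hf'0 : PowerSeries.constantCoeff f' = X' := by simp [hf', hfx, hX']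
  set g' := (g - PowerSeries.C (algebraMap k K v)) * f'⁻¹ with hg'
  have hf'ne : PowerSeries.constantCoeff f' ≠ 0 := by rwa [hf'0]
  have hgf : g = PowerSeries.C (algebraMap k K v) + f' * g' := by
    have := PowerSeries.mul_inv_cancel f' hf'ne
    rw [hg']
    linear_combination (PowerSeries.C (algebraMap k K v) - g) * this
  have hff : f = PowerSeries.C (algebraMap k K s) + f' := by rw [hf']; ring
  have hg'0 : PowerSeries.constantCoeff g' = Y' := by
    simp [hg', hgy, hY', hf'0, div_eq_mul_inv]
  have ev {R : Type _} [CommRing R] [Algebra k R] (a b : R) (q : MvPolynomial (Fin 2) k) :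
      aeval ![a, b] (aeval ![C s + X 0, C v + X 0 * X 1] q) =
        aeval ![algebraMap k R s + a, algebraMap k R v + a * b] q := by
    rw [← AlgHom.coe_toRingHom, map_aeval_pair (k := k) _ (fun a => by simp)]
    simp
  have hrfg : aeval ![f', g'] r = 0 := by
    have h2 := congrArg (aeval ![f', g']) hr
    rw [ev, PowerSeries.algebraMap_apply, PowerSeries.algebraMap_apply, ← hff, ← hgf, h] at h2
    simp only [map_mul, map_pow, aeval_X, Matrix.cons_val_zero] at h2
    have hne : f' ≠ 0 := fun h => hf'ne (by simp [h])
    exact (mul_eq_zero.mp h2.symm).resolve_left (pow_ne_zero _ hne)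
  have hrXY : aeval ![X', Y'] r = 0 := by
    have := congrArg PowerSeries.constantCoeff hrfg
    rwa [aeval_pair_constantCoeff, hf'0, hg'0, map_zero] at this
  have hxX : algebraMap k K s + X' = x := by rw [hX']; ring
  have hyY : algebraMap k K v + X' * Y' = y := by rw [hY']; field_simp; ring
  have d1 : aeval ![x, y] (pderiv 1 p) = X' * aeval ![X', Y'] (pderiv 1 r) := by
    have h2 := congrArg (fun t => aeval ![X', Y'] (pderiv 1 t)) hr
    rw [derivation_aeval_pair, map_add, map_mul, map_mul, ev, ev, hxX, hyY] at h2

    simp [pderiv_X] at h2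
    apply mul_left_cancel₀ hx0
    linear_combination h2
  have d0 : aeval ![x, y] (pderiv 0 p) + Y' * aeval ![x, y] (pderiv 1 p) =
      X' ^ 2 * aeval ![X', Y'] (pderiv 0 r) := by
    have h2 := congrArg (fun t => aeval ![X', Y'] (pderiv 0 t)) hr
    rw [derivation_aeval_pair, map_add, map_mul, map_mul, ev, ev, hxX, hyY] at h2
    simp [pderiv_X, hrXY] at h2
    linear_combination h2
  have hf'1 : PowerSeries.coeff 1 f' = c * aeval ![x, y] (pderiv 1 p) := by
    rw [hf', map_sub, hf1]
    simp
  have hg'1 : PowerSeries.coeff 1 g = Y' * PowerSeries.coeff 1 f' + X' * PowerSeries.coeff 1 g' := by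
    rw [hgf, map_add, PowerSeries.coeff_one_mul]
    simp [hf'0, hg'0]
    ring
  obtain ⟨τ, hτ0, hτ1, hτ⟩ := exists_chart hkO r hrfg hf'0 hg'0 hx hy (by
    by_contra! hcon
    rw [hcon.1, mul_zero] at d0
    rw [hcon.2, mul_zero] at d1
    rw [d1, mul_zero, add_zero] at d0
    tauto) (c * X') (by rw [hf'1, d1]; ring) (by
    apply mul_left_cancel₀ hx0
    rw [hf'1, hg1] at hg'1
    linear_combination -hg'1 - c * d0)
  refine ⟨τ, hτ0, hτ1, fun m => ⟨?_, ?_⟩⟩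
  · rw [hff]
    exact Subring.add_mem _ (approxSubring.C_mem (hkO s)) (hτ m).1
  · rw [hgf]
    exact Subring.add_mem _ (approxSubring.C_mem (hkO v)) (Subring.mul_mem _ (hτ m).1 (hτ m).2)

end BlowUp

section LocalDeterminant

open PowerSeries

/-- The square matrix of the first `a` coefficients of `a` power series. -/
noncomputable def coeffMatrix {K n : Type*} [CommRing K] {a : ℕ} (e : n ≃ Fin a) (col : n → K⟦X⟧) :
    Matrix n n K :=
  Matrix.of fun i j => coeff (e i : ℕ) (col j)

theorem PowerSeries.coeff_mul_pow_of_lt {R : Type*} [CommRing R] {τ : R⟦X⟧}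
    (hτ : constantCoeff τ = 0) (h : R⟦X⟧) {i j : ℕ} (hij : i < j) : coeff i (h * τ ^ j) = 0 := by
  have : (X : R⟦X⟧) ^ j ∣ h * τ ^ j :=
    (pow_dvd_pow_of_dvd (X_dvd_iff.mpr hτ) j).mul_left _
  exact X_pow_dvd_iff.mp this i hij

theorem PowerSeries.coeff_mul_pow_self {R : Type*} [CommRing R] {τ : R⟦X⟧}
    (hτ : constantCoeff τ = 0) (h : R⟦X⟧) (i : ℕ) :
    coeff i (h * τ ^ i) = constantCoeff h * coeff 1 τ ^ i := by
  obtain ⟨s, rfl⟩ := X_dvd_iff.mpr hτ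
  have h1 : coeff 1 (X * s) = constantCoeff s := by
    simp
  have h2 : h * (X * s) ^ i = X ^ i * (h * s ^ i) := by ring
  have h3 := coeff_X_pow_mul (h * s ^ i) i 0
  rw [h1, h2]
  rw [zero_add] at h3
  rw [h3]
  simp

theorem PowerSeries.coeff_mul_eq_sum_of_dvd {R : Type*} [CommRing R] {a : ℕ} {τ f : R⟦X⟧}
    {w : ℕ → R} (hf : (X : R⟦X⟧) ^ a ∣ f - ∑ j ∈ Finset.range a, C (w j) * τ ^ j) (h : R⟦X⟧)
    {i : ℕ} (hi : i < a) :
    coeff i (h * f) = ∑ j ∈ Finset.range a, coeff i (h * τ ^ j) * w j := by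
  have h1 : coeff i (h * (f - ∑ j ∈ Finset.range a, C (w j) * τ ^ j)) = 0 :=
    X_pow_dvd_iff.mp (hf.mul_left h) i hi
  rw [mul_sub, map_sub, sub_eq_zero] at h1
  rw [h1, Finset.mul_sum, map_sum]
  refine Finset.sum_congr rfl fun j _ => ?_
  rw [mul_left_comm, coeff_C_mul, mul_comm]

theorem PowerSeries.X_pow_dvd_sub_sum {R : Type*} [CommRing R] (a : ℕ) (f : R⟦X⟧) :
    (X : R⟦X⟧) ^ a ∣ f - ∑ j ∈ Finset.range a, C (coeff j f) * X ^ j := by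
  rw [X_pow_dvd_iff]
  intro m hm
  rw [map_sub, map_sum, sub_eq_zero]
  simp_rw [coeff_C_mul, coeff_X_pow]
  simp [hm]

theorem approxSubring.exists_coeffs {R : Type*} [CommRing R] {S : Subring R} {τ : R⟦X⟧} {a : ℕ}
    (hτ : constantCoeff τ = 0) {f : R⟦X⟧} (hf : f ∈ approxSubring S τ a) :
    ∃ w : ℕ → R, (∀ j, w j ∈ S) ∧
      (X : R⟦X⟧) ^ a ∣ f - ∑ j ∈ Finset.range a, C (w j) * τ ^ j := by
  obtain ⟨P, hP⟩ := hf
  refine ⟨fun j => P.coeff j, fun j => (P.coeff j).2, ?_⟩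
  have h1 : P.eval₂ ((PowerSeries.C (R := R)).comp S.subtype) τ =
      ∑ j ∈ Finset.range (a + (P.natDegree + 1)), C ((P.coeff j : S) : R) * τ ^ j := by
    rw [Polynomial.eval₂_eq_sum_range' _ (show P.natDegree < a + (P.natDegree + 1) by omega)]
    simp
  rw [Finset.sum_range_add] at h1
  have h2 : (X : R⟦X⟧) ^ a ∣ ∑ j ∈ Finset.range (P.natDegree + 1),
      C ((P.coeff (a + j) : S) : R) * τ ^ (a + j) := by
    refine Finset.dvd_sum fun j _ => ?_
    rw [pow_add]
    exact ((pow_dvd_pow_of_dvd (X_dvd_iff.mpr hτ) a).mul_right _).mul_left _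
  convert dvd_add hP h2 using 1
  rw [h1]
  ring

variable {K : Type*} [Field K] {n : Type*} [Fintype n] [DecidableEq n] {a : ℕ} (e : n ≃ Fin a)

theorem det_coeffMatrix_mul {τ : K⟦X⟧} (hτ : constantCoeff τ = 0) (h : K⟦X⟧) {col : n → K⟦X⟧}
    {w : n → ℕ → K}
    (hw : ∀ j, (X : K⟦X⟧) ^ a ∣ col j - ∑ i ∈ Finset.range a, C (w j i) * τ ^ i) :
    (coeffMatrix e fun j => h * col j).det =
      constantCoeff h ^ a * coeff 1 τ ^ (∑ i ∈ Finset.range a, i) *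
        (Matrix.of fun i j => w j (e i)).det := by
  set T : Matrix (Fin a) (Fin a) K := Matrix.of fun i j => coeff (i : ℕ) (h * τ ^ (j : ℕ))
  have hT : T.det = constantCoeff h ^ a * coeff 1 τ ^ (∑ i ∈ Finset.range a, i) := by
    rw [Matrix.det_of_isLowerTriangular T fun i j hij => coeff_mul_pow_of_lt hτ h hij]
    simp only [T, Matrix.of_apply, coeff_mul_pow_self hτ]
    rw [Finset.prod_mul_distrib, Finset.prod_pow_eq_pow_sum,
      Finset.sum_range (fun i => i)]
    simp
  have hprod : (coeffMatrix e fun j => h * col j) =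
      T.submatrix e e * Matrix.of fun i j => w j (e i) := by
    ext i j
    rw [Matrix.mul_apply]
    simp only [coeffMatrix, Matrix.of_apply, Matrix.submatrix_apply, T]
    rw [coeff_mul_eq_sum_of_dvd (hw j) h (e i).2, Finset.sum_range]
    exact (Equiv.sum_comp e fun x : Fin a => coeff (e i : ℕ) (h * τ ^ (x : ℕ)) * w j x).symm
  rw [hprod, Matrix.det_mul, Matrix.det_submatrix_equiv_self, hT]

theorem det_coeffMatrix_mul_left (h : K⟦X⟧) (col : n → K⟦X⟧) :
    (coeffMatrix e fun j => h * col j).det =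
      constantCoeff h ^ a * (coeffMatrix e col).det := by
  rw [det_coeffMatrix_mul e (τ := X) (by simp) h (w := fun j i => coeff i (col j))
    fun j => X_pow_dvd_sub_sum a (col j)]
  simp [coeffMatrix]

theorem det_coeffMatrix_of_mem {O : Subring K} {τ : K⟦X⟧} (hτ : constantCoeff τ = 0)
    {col : n → K⟦X⟧} (hcol : ∀ j, col j ∈ approxSubring O τ a) :
    ∃ o ∈ O, (coeffMatrix e col).det = coeff 1 τ ^ (∑ i ∈ Finset.range a, i) * o := by
  choose w hwO hw using fun j => approxSubring.exists_coeffs hτ (hcol j)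
  have := det_coeffMatrix_mul e hτ 1 hw
  simp only [one_mul, map_one, one_pow] at this
  refine ⟨_, ?_, this⟩
  set N : Matrix n n O := Matrix.of fun i j => ⟨w j (e i), hwO j (e i)⟩
  have hN : (Matrix.of fun i j => w j (e i)) = O.subtype.mapMatrix N := by
    ext i j
    rfl
  rw [hN, ← RingHom.map_det]
  exact (N.det).2

theorem exists_det_coeffMatrix_eq {ι : Type*} [Fintype ι] [DecidableEq ι] {b : ℕ}
    (e : ι ⊕ Fin b ≃ Fin a) {O : Subring K} {τ₁ τ₂ : K⟦X⟧} (hτ₁ : constantCoeff τ₁ = 0)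
    (hτ₂ : constantCoeff τ₂ = 0) (f : ι → K⟦X⟧) (κ p : Fin b → K⟦X⟧) (h G : K⟦X⟧) (g : ι → K⟦X⟧)
    (hκ : ∀ l : Fin b, κ l = ∑ l' : Fin b, C (coeff (l : ℕ) (h * τ₂ ^ (l' : ℕ))) * p l' +
      ∑ i, C (coeff (l : ℕ) (g i)) * f i) (z : ι → K)
    (hf : ∀ i, C (z i) * (G * f i) ∈ approxSubring O τ₁ a)
    (hp : ∀ l, G * p l ∈ approxSubring O τ₁ a) :
    ∃ o ∈ O, constantCoeff G ^ a * (∏ i, z i) * (coeffMatrix e (Sum.elim f κ)).det =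
      coeff 1 τ₁ ^ (∑ i ∈ Finset.range a, i) *
        (constantCoeff h ^ b * coeff 1 τ₂ ^ (∑ i ∈ Finset.range b, i)) * o := by
  set D : Matrix (Fin b) (Fin b) K := Matrix.of fun l' l => coeff (l : ℕ) (h * τ₂ ^ (l' : ℕ))
  set B : Matrix ι (Fin b) K := Matrix.of fun i l => coeff (l : ℕ) (g i)
  have hD : D.det = constantCoeff h ^ b * coeff 1 τ₂ ^ (∑ i ∈ Finset.range b, i) := by
    rw [Matrix.det_of_isUpperTriangular (M := D) fun i j hij => coeff_mul_pow_of_lt hτ₂ h hij]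
    simp only [D, Matrix.of_apply, coeff_mul_pow_self hτ₂]
    rw [Finset.prod_mul_distrib, Finset.prod_pow_eq_pow_sum,
      Finset.sum_range (fun i => i)]
    simp
  have hU : coeffMatrix e (Sum.elim f κ) =
      coeffMatrix e (Sum.elim f p) * Matrix.fromBlocks 1 B 0 D := by
    ext i j
    rw [Matrix.mul_apply, Fintype.sum_sum_type]
    rcases j with j | l
    · simp [coeffMatrix, Matrix.one_apply]
    · simp only [coeffMatrix, Matrix.of_apply, Sum.elim_inr, Sum.elim_inl, hκ l,
        Matrix.fromBlocks_apply₁₂, Matrix.fromBlocks_apply₂₂, B, D, map_add, map_sum,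
        coeff_C_mul]
      rw [add_comm]
      congr 1 <;> exact Finset.sum_congr rfl fun x _ => mul_comm _ _
  set zz : ι ⊕ Fin b → K := Sum.elim z 1 with hzz
  obtain ⟨o, ho, hdet⟩ := det_coeffMatrix_of_mem e hτ₁
    (col := fun j => C (zz j) * (G * Sum.elim f p j)) (O := O) (by
      rintro (i | l)
      · exact hf i
      · simpa [hzz] using hp l)
  have hz : (coeffMatrix e fun j => C (zz j) * (G * Sum.elim f p j)).det =
      (∏ i, z i) * (coeffMatrix e fun j => G * Sum.elim f p j).det := by
    have h1 := Matrix.det_mul_row zz (coeffMatrix e fun j => G * Sum.elim f p j)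
    rw [Fintype.prod_sum_type] at h1
    simp only [hzz, Sum.elim_inl, Sum.elim_inr, Pi.one_apply, Finset.prod_const_one, mul_one] at h1
    rw [← h1]
    congr 1
    ext i j
    simp [coeffMatrix, hzz]
  refine ⟨o, ho, ?_⟩
  rw [hz, det_coeffMatrix_mul_left] at hdet
  rw [hU, Matrix.det_mul, Matrix.det_fromBlocks_zero₂₁, Matrix.det_one, one_mul, hD]
  linear_combination (constantCoeff h ^ b * coeff 1 τ₂ ^ (∑ i ∈ Finset.range b, i)) * hdet

end LocalDeterminant

section LocalDeterminant

open PowerSeries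

variable {K : Type*} [Field K] {a b : ℕ}

theorem approxSubring.mul_inv_mem {O : Subring K} {τ₁ τ₂ A : K⟦X⟧} (hτ₂ : constantCoeff τ₂ = 0)
    (hA : A ∈ approxSubring O τ₁ a) (hA0 : constantCoeff A ≠ 0) {ω : K⟦X⟧⟦X⟧}
    (hω : ω ∈ approxSubring (approxSubring O τ₁ a) (map C τ₂) b) (hω0 : constantCoeff ω = 0) :
    C A⁻¹ * ω ∈ approxSubring (approxSubring O τ₁ a) (C A⁻¹ * map C τ₂) b := by
  rcases b with _ | b
  · exact mem_of_dvd (by simp)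
  have hτ₂' : constantCoeff (map C τ₂ : K⟦X⟧⟦X⟧) = 0 := by
    rw [← coeff_zero_eq_constantCoeff_apply, coeff_map, coeff_zero_eq_constantCoeff_apply, hτ₂,
      map_zero]
  obtain ⟨w, hw, hd⟩ := exists_coeffs hτ₂' hω
  have hCA : (C A⁻¹ * C A : K⟦X⟧⟦X⟧) = 1 := by
    rw [← map_mul, PowerSeries.inv_mul_cancel _ hA0, map_one]
  have hw0 : w 0 = 0 := by
    have h1 := X_pow_dvd_iff.mp hd 0 (by omega)
    rw [Finset.sum_range_succ'] at h1
    simpa [hω0, hτ₂'] using h1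
  have hsum : C A⁻¹ * (∑ j ∈ Finset.range (b + 1), C (w j) * (map C τ₂) ^ j) ∈
      approxSubring (approxSubring O τ₁ a) (C A⁻¹ * map C τ₂) (b + 1) := by
    rw [Finset.mul_sum]
    refine Subring.sum_mem _ fun j _ => ?_
    rcases j with _ | j
    · rw [hw0, map_zero, zero_mul, mul_zero]
      exact Subring.zero_mem _
    · have : C A⁻¹ * (C (w (j + 1)) * (map C τ₂) ^ (j + 1)) =
          C (w (j + 1) * A ^ j) * (C A⁻¹ * map C τ₂ : K⟦X⟧⟦X⟧) ^ (j + 1) := by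
        have h2 : (C A⁻¹ * C A : K⟦X⟧⟦X⟧) ^ j = 1 := by rw [hCA, one_pow]
        rw [mul_pow] at h2
        rw [map_mul, map_pow, mul_pow, pow_succ (C A⁻¹ : K⟦X⟧⟦X⟧)]
        linear_combination (-(C (w (j + 1)) * C A⁻¹ * (map C τ₂) ^ (j + 1))) * h2
      rw [this]
      exact Subring.mul_mem _ (C_mem (Subring.mul_mem _ (hw _) (Subring.pow_mem _ hA _)))
        (Subring.pow_mem _ self_mem _)
  have := Subring.add_mem _ (mem_of_dvd (S := approxSubring O τ₁ a) (τ := C A⁻¹ * map C τ₂)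
    (hd.mul_left (C A⁻¹))) hsum
  rwa [mul_sub, sub_add_cancel] at this

theorem exists_divided_coeffs {O : Subring K} {τ₁ τ₂ A : K⟦X⟧} (hτ₂ : constantCoeff τ₂ = 0)
    (hA : A ∈ approxSubring O τ₁ a) (hA0 : constantCoeff A ≠ 0) {ω κ : K⟦X⟧⟦X⟧}
    (hω : ω ∈ approxSubring (approxSubring O τ₁ a) (map C τ₂) b) (hω0 : constantCoeff ω = 0)
    (hκ : (C A - ω) * κ ∈ approxSubring (approxSubring O τ₁ a) (map C τ₂) b) (h : K⟦X⟧) :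
    ∃ p : Fin b → K⟦X⟧, (∀ l, A ^ b * p l ∈ approxSubring O τ₁ a) ∧
      ∀ l : Fin b, coeff (l : ℕ) (map C h * κ) =
        ∑ l' : Fin b, C (coeff (l : ℕ) (h * τ₂ ^ (l' : ℕ))) * p l' := by
  have hCA : (C A⁻¹ * C A : K⟦X⟧⟦X⟧) = 1 := by
    rw [← map_mul, PowerSeries.inv_mul_cancel _ hA0, map_one]
  have hτ₂' : constantCoeff (map C τ₂ : K⟦X⟧⟦X⟧) = 0 := by
    rw [← coeff_zero_eq_constantCoeff_apply, coeff_map, coeff_zero_eq_constantCoeff_apply, hτ₂,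
      map_zero]
  have hle : approxSubring (approxSubring O τ₁ a) (map C τ₂) b ≤
      approxSubring (approxSubring O τ₁ a) (C A⁻¹ * map C τ₂) b := by
    refine approxSubring.le_of_mem ?_
    have := Subring.mul_mem _ (approxSubring.C_mem (m := b) (τ := C A⁻¹ * map C τ₂) hA)
      approxSubring.self_mem
    rwa [← mul_assoc, mul_comm (C A), hCA, one_mul] at this
  have h1 : C A * κ ∈ approxSubring (approxSubring O τ₁ a) (C A⁻¹ * map C τ₂) b := by
    refine approxSubring.mem_of_one_sub_mul_mem
      (approxSubring.mul_inv_mem hτ₂ hA hA0 hω hω0) (by simp [hω0]) ?_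
    convert hle hκ using 1
    linear_combination (-ω * κ) * hCA
  obtain ⟨w, hw, hd⟩ := approxSubring.exists_coeffs (by simp [hτ₂']) h1
  have hd' : (X : K⟦X⟧⟦X⟧) ^ b ∣ κ - ∑ j ∈ Finset.range b, C (A⁻¹ ^ (j + 1) * w j) *
      (map C τ₂) ^ j := by
    convert hd.mul_left (C A⁻¹) using 1
    rw [mul_sub, ← mul_assoc, hCA, one_mul, Finset.mul_sum]
    congr 1
    refine Finset.sum_congr rfl fun j _ => ?_
    rw [map_mul, map_pow, mul_pow, pow_succ]
    ring
  refine ⟨fun l => A⁻¹ ^ ((l : ℕ) + 1) * w l, fun l => ?_, fun l => ?_⟩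
  · have hAA : A ^ ((l : ℕ) + 1) * A⁻¹ ^ ((l : ℕ) + 1) = 1 := by
      rw [← mul_pow, PowerSeries.mul_inv_cancel _ hA0, one_pow]
    have hb : A ^ b = A ^ (b - 1 - (l : ℕ)) * A ^ ((l : ℕ) + 1) := by
      rw [← pow_add]
      congr 1
      omega
    have e : A ^ b * (A⁻¹ ^ ((l : ℕ) + 1) * w l) = A ^ (b - 1 - (l : ℕ)) * w l := by
      rw [hb]
      linear_combination (A ^ (b - 1 - (l : ℕ)) * w l) * hAA
    rw [e]
    exact Subring.mul_mem _ (Subring.pow_mem _ hA _) (hw _)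
  · rw [coeff_mul_eq_sum_of_dvd hd' _ l.2, Finset.sum_range]
    refine Finset.sum_congr rfl fun j _ => ?_
    rw [← map_pow, ← map_mul, coeff_map]

theorem exists_local_det_eq {ι : Type*} [Fintype ι] [DecidableEq ι]
    (e : ι ⊕ Fin b ≃ Fin a) {O : Subring K} {τ₁ τ₂ A : K⟦X⟧} (hτ₁ : constantCoeff τ₁ = 0)
    (hτ₂ : constantCoeff τ₂ = 0)
    (hA : A ∈ approxSubring O τ₁ a) (hA0 : constantCoeff A ≠ 0) {ω κ' κ : K⟦X⟧⟦X⟧}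
    (hω : ω ∈ approxSubring (approxSubring O τ₁ a) (map C τ₂) b) (hω0 : constantCoeff ω = 0)
    (hκ' : (C A - ω) * κ' ∈ approxSubring (approxSubring O τ₁ a) (map C τ₂) b)
    (f : ι → K⟦X⟧) (h : K⟦X⟧) (g : ι → K⟦X⟧)
    (hκ : κ = map C h * κ' + ∑ i, C (f i) * map C (g i)) (z : ι → K) {G : K⟦X⟧}
    (hG : G ∈ approxSubring O τ₁ a) (hf : ∀ i, C (z i) * (G * f i) ∈ approxSubring O τ₁ a) :
    ∃ o ∈ O, (constantCoeff G * constantCoeff A ^ b) ^ a * (∏ i, z i) *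
        (coeffMatrix e (Sum.elim f fun l => coeff (l : ℕ) κ)).det =
      coeff 1 τ₁ ^ (∑ i ∈ Finset.range a, i) *
        (constantCoeff h ^ b * coeff 1 τ₂ ^ (∑ i ∈ Finset.range b, i)) * o := by
  obtain ⟨p, hp, hpκ⟩ := exists_divided_coeffs hτ₂ hA hA0 hω hω0 hκ' h
  have := exists_det_coeffMatrix_eq e (O := O) hτ₁ hτ₂ f (fun l => coeff (l : ℕ) κ) p h (G * A ^ b) g
    (fun l => by
      rw [hκ, map_add, hpκ, map_sum]
      congr 1
      refine Finset.sum_congr rfl fun i _ => ?_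
      rw [coeff_C_mul, coeff_map, mul_comm])
    z (fun i => by
      rw [show C (z i) * (G * A ^ b * f i) = A ^ b * (C (z i) * (G * f i)) by ring]
      exact Subring.mul_mem _ (Subring.pow_mem _ hA _) (hf i))
    (fun l => by
      rw [mul_assoc]
      exact Subring.mul_mem _ hG (hp l))
  simpa using this

end LocalDeterminant

open PowerSeries in
theorem PowerSeries.exists_eq_of_contracting {R : Type*} [CommRing R] (Φ : R⟦X⟧ → R⟦X⟧)
    (hΦ : ∀ f g m, (X : R⟦X⟧) ^ m ∣ f - g → (X : R⟦X⟧) ^ (m + 1) ∣ Φ f - Φ g) :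
    ∃ f, Φ f = f := by
  have hstep : ∀ m, (X : R⟦X⟧) ^ m ∣ Φ^[m + 1] 0 - Φ^[m] 0 := by
    intro m
    induction m with
    | zero => simp
    | succ m ih =>
      rw [Function.iterate_succ_apply' _ (m + 1), Function.iterate_succ_apply' _ m]
      exact hΦ _ _ _ (by rwa [← Function.iterate_succ_apply' Φ m])
  have hlong : ∀ m j, (X : R⟦X⟧) ^ m ∣ Φ^[m + j] 0 - Φ^[m] 0 := by
    intro m j
    induction j with
    | zero => simp
    | succ j ih =>
      have := dvd_add ((pow_dvd_pow X (Nat.le_add_right m j)).trans (hstep (m + j))) ih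
      simpa [← add_assoc] using this
  set f : R⟦X⟧ := mk fun m => coeff m (Φ^[m + 1] 0) with hf
  have hlim : ∀ m, (X : R⟦X⟧) ^ m ∣ f - Φ^[m] 0 := by
    intro m
    rw [X_pow_dvd_iff]
    intro j hj
    obtain ⟨i, rfl⟩ := Nat.exists_eq_add_of_le (Nat.succ_le_of_lt hj)
    have := X_pow_dvd_iff.1 (hlong (j + 1) i) j (Nat.lt_succ_self j)
    rw [map_sub, sub_eq_zero] at this
    rw [map_sub, hf, coeff_mk, Nat.succ_eq_add_one, this, sub_self]
  refine ⟨f, ?_⟩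
  ext m
  have h1 := hΦ _ _ _ (hlim m)
  rw [← Function.iterate_succ_apply' Φ m] at h1
  have h2 := X_pow_dvd_iff.1 (dvd_sub h1 (hlim (m + 1))) m (Nat.lt_succ_self m)
  rw [sub_sub_sub_cancel_right, map_sub, sub_eq_zero] at h2
  exact h2

theorem MvPolynomial.dvd_aeval_sub {σ k R : Type*} [CommRing k] [CommRing R] [Algebra k R]
    (p : MvPolynomial σ k) {f g : σ → R} {t : R} (h : ∀ i, t ∣ f i - g i) :
    t ∣ aeval f p - aeval g p := by
  rw [← Ideal.mem_span_singleton, ← Ideal.Quotient.mk_eq_mk_iff_sub_mem,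
    ← Ideal.Quotient.mkₐ_eq_mk k, ← AlgHom.comp_apply, ← AlgHom.comp_apply]
  congr 1
  ext i
  simpa [Ideal.Quotient.mk_eq_mk_iff_sub_mem, Ideal.mem_span_singleton] using h i

open PowerSeries in
/-- Hensel lifting of a point of a plane curve at which `p` has nonzero second partial derivative
`u` to a formal branch with first coordinate `x + u X`. -/
theorem exists_branch {k K : Type*} [Field k] [Field K] [Algebra k K]
    (p : MvPolynomial (Fin 2) k) {x y : K} (hp : MvPolynomial.aeval ![x, y] p = 0)
    (hu : MvPolynomial.aeval ![x, y] (MvPolynomial.pderiv 1 p) ≠ 0) :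
    ∃ g : K⟦X⟧, constantCoeff g = y ∧
      MvPolynomial.aeval ![C x + C (MvPolynomial.aeval ![x, y] (MvPolynomial.pderiv 1 p)) * X, g] p = 0 ∧
      coeff 1 g = - MvPolynomial.aeval ![x, y] (MvPolynomial.pderiv 0 p) := by
  set u := MvPolynomial.aeval ![x, y] (MvPolynomial.pderiv 1 p) with hu_def
  set w := MvPolynomial.aeval ![x, y] (MvPolynomial.pderiv 0 p) with hw_def
  obtain ⟨r₁, r₂, r₃, hr⟩ := p.exists_taylor_two_aeval K⟦X⟧
  have hev : ∀ q : MvPolynomial (Fin 2) k, MvPolynomial.aeval ![(C x : K⟦X⟧), C y] q = C (MvPolynomial.aeval ![x, y] q) := by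
    intro q; rw [MvPolynomial.aeval_pair_C]
  let v : K⟦X⟧ → Fin 4 → K⟦X⟧ := fun z => ![C x, C y, C u * X, C u * (X * z)]
  obtain ⟨z, hz⟩ := exists_eq_of_contracting (R := K)
    (fun z => - C (w / u) - X * (MvPolynomial.aeval (v z) r₁ + MvPolynomial.aeval (v z) r₂ * z + MvPolynomial.aeval (v z) r₃ * z ^ 2)) (by
      intro f g m hfg
      have hv : ∀ i, (X : K⟦X⟧) ^ m ∣ v f i - v g i := by
        intro i
        fin_cases i
        · simp [v]
        · simp [v]
        · simp [v]
        · obtain ⟨t, ht⟩ := hfg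
          exact ⟨C u * X * t, by simp only [v]; simp; linear_combination (C u * X) * ht⟩
      obtain ⟨t, ht⟩ := hfg
      obtain ⟨t₁, h₁⟩ := MvPolynomial.dvd_aeval_sub r₁ hv
      obtain ⟨t₂, h₂⟩ := MvPolynomial.dvd_aeval_sub r₂ hv
      obtain ⟨t₃, h₃⟩ := MvPolynomial.dvd_aeval_sub r₃ hv
      refine ⟨-(t₁ + t₂ * f + MvPolynomial.aeval (v g) r₂ * t + t₃ * f ^ 2 + MvPolynomial.aeval (v g) r₃ * (f + g) * t), ?_⟩
      linear_combination (- X) * h₁ - X * f * h₂ - X * f ^ 2 * h₃ - X * MvPolynomial.aeval (v g) r₂ * ht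
        - X * MvPolynomial.aeval (v g) r₃ * (f + g) * ht)
  have hwu : (C w : K⟦X⟧) = C u * C (w / u) := by rw [← map_mul, mul_div_cancel₀ _ hu]
  refine ⟨C y + C u * (X * z), by simp, ?_, ?_⟩
  · rw [hr, hev, hev, hev, hp, map_zero, ← hu_def, ← hw_def, hwu]
    simp only [v] at hz
    linear_combination (-C u ^ 2 * X) * hz
  · rw [map_add, coeff_C, coeff_C_mul, show (1 : ℕ) = 0 + 1 from rfl, coeff_succ_X_mul]
    have : coeff 0 z = - (w / u) := by
      rw [← hz]; simp
    rw [this]; simp; field_simp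

section

open PowerSeries LaurentSeries

/-- The conditions on the support and coefficients of `∑ c (i, j) x ^ i * y ^ j` making it a curve
of degree `n + 1` which is smooth at its only point at infinity `(0 : 1 : 0)` and which is maximally
tangent to the line at infinity there. -/
structure IsFlexCurve {L : Type*} [Field L] (n : ℕ) (S : Finset (ℕ × ℕ)) (c : ℕ × ℕ → L) : Prop where
  pos : 1 ≤ n
  le : ∀ m ∈ S, m ≠ (n + 1, 0) → m.1 + m.2 ≤ n
  left_mem : (n + 1, 0) ∈ S
  left_ne : c (n + 1, 0) ≠ 0
  right_mem : (0, n) ∈ S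
  right_ne : c (0, n) ≠ 0

namespace IsFlexCurve

variable {L : Type*} [Field L] {n : ℕ} {S : Finset (ℕ × ℕ)} {c : ℕ × ℕ → L}

theorem sum_eq {R : Type*} [AddCommMonoid R] (h : IsFlexCurve n S c) (f : ℕ × ℕ → R) :
    ∑ m ∈ S, f m = f (n + 1, 0) + f (0, n) + ∑ m ∈ (S.erase (n + 1, 0)).erase (0, n), f m := by
  rw [← Finset.add_sum_erase S f h.left_mem, ← Finset.add_sum_erase (S.erase (n + 1, 0)) f
    (a := (0, n)) (by simp [h.right_mem]), add_assoc]

theorem snd_lt (h : IsFlexCurve n S c) {m : ℕ × ℕ} (hm : m ∈ (S.erase (n + 1, 0)).erase (0, n)) :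
    m.1 + m.2 ≤ n ∧ m.2 < n := by
  simp only [Finset.mem_erase] at hm
  have := h.le m hm.2.2 hm.2.1
  refine ⟨this, lt_of_le_of_ne (by omega) fun h' => hm.1 ?_⟩
  ext <;> simp <;> omega

theorem le_succ (h : IsFlexCurve n S c) {m : ℕ × ℕ} (hm : m ∈ S) : m.1 + m.2 ≤ n + 1 := by
  by_cases h1 : m = (n + 1, 0)
  · simp [h1]
  · exact (h.le m hm h1).trans n.le_succ

theorem map {K : Type*} [Field K] (σ : L →+* K) (h : IsFlexCurve n S c) :
    IsFlexCurve n S (fun m => σ (c m)) where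
  pos := h.pos
  le := h.le
  left_mem := h.left_mem
  left_ne := by simpa using h.left_ne
  right_mem := h.right_mem
  right_ne := by simpa using h.right_ne

theorem exists_branch_at_infinity (h : IsFlexCurve n S c) :
    ∃ w : L⟦X⟧, constantCoeff w ≠ 0 ∧
      ∑ m ∈ S, C (c m) * (X ^ (n + 1) * w) ^ (n + 1 - (m.1 + m.2)) * X ^ m.1 = 0 := by
  set S' := (S.erase (n + 1, 0)).erase (0, n) with hS'
  set γ := c (0, n)
  have hγ : (C γ * C γ⁻¹ : L⟦X⟧) = 1 := by rw [← map_mul, mul_inv_cancel₀ h.right_ne, map_one]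
  obtain ⟨z, hz⟩ := exists_eq_of_contracting (R := L)
    (fun z => - C γ⁻¹ * (C (c (n + 1, 0)) * X ^ n +
      ∑ m ∈ S', C (c m) * X ^ (n - m.2) * z ^ (n + 1 - (m.1 + m.2)))) (by
      intro f g e hfg
      rw [← mul_sub, add_sub_add_left_eq_sub, ← Finset.sum_sub_distrib]
      refine Dvd.dvd.mul_left (Finset.dvd_sum fun m hm => ?_) _
      rw [← mul_sub, mul_assoc]
      refine Dvd.dvd.mul_left ?_ _
      rw [pow_succ']
      exact mul_dvd_mul (dvd_pow_self _ (by have := (h.snd_lt hm).2; omega))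
        (hfg.trans (sub_dvd_pow_sub_pow f g _)))
  have hz' : C γ * z + C (c (n + 1, 0)) * X ^ n +
      ∑ m ∈ S', C (c m) * X ^ (n - m.2) * z ^ (n + 1 - (m.1 + m.2)) = 0 := by
    linear_combination (-C γ) * hz - (C (c (n + 1, 0)) * X ^ n +
      ∑ m ∈ S', C (c m) * X ^ (n - m.2) * z ^ (n + 1 - (m.1 + m.2))) * hγ
  set U : L⟦X⟧ := C γ + ∑ m ∈ S', C (c m) * X ^ (n - m.2) * z ^ (n - (m.1 + m.2)) with hU
  have hU0 : constantCoeff U ≠ 0 := by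
    have : constantCoeff U = γ := by
      rw [hU, map_add, map_sum, Finset.sum_eq_zero, add_zero]
      · simp
      · intro m hm
        have := (h.snd_lt hm).2
        simp [show n - m.2 ≠ 0 by omega]
    rw [this]; exact h.right_ne
  have hzU : z * U = - C (c (n + 1, 0)) * X ^ n := by
    have : z * U = C γ * z + ∑ m ∈ S', C (c m) * X ^ (n - m.2) * z ^ (n + 1 - (m.1 + m.2)) := by
      rw [hU, mul_add, Finset.mul_sum]
      congr 1
      · ring
      · refine Finset.sum_congr rfl fun m hm => ?_
        rw [show n + 1 - (m.1 + m.2) = n - (m.1 + m.2) + 1 by have := (h.snd_lt hm).1; omega]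
        ring
    rw [this]; linear_combination hz'
  have hUinv := PowerSeries.mul_inv_cancel U hU0
  refine ⟨- C (c (n + 1, 0)) * U⁻¹, by simpa [h.left_ne] using hU0, ?_⟩
  have hx : X ^ (n + 1) * (- C (c (n + 1, 0)) * U⁻¹) = X * z := by
    linear_combination (- X * U⁻¹) * hzU + X * z * hUinv
  rw [hx, h.sum_eq]
  have : ∀ m ∈ S', C (c m) * (X * z) ^ (n + 1 - (m.1 + m.2)) * X ^ m.1 =
      X * (C (c m) * X ^ (n - m.2) * z ^ (n + 1 - (m.1 + m.2))) := by
    intro m hm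
    have := (h.snd_lt hm).1
    rw [mul_pow, show n - m.2 = n - (m.1 + m.2) + m.1 by omega, show n + 1 - (m.1 + m.2) =
      n - (m.1 + m.2) + 1 by omega]
    ring
  rw [Finset.sum_congr rfl this, ← Finset.mul_sum]
  simp only [add_zero, zero_add, tsub_self, pow_zero, mul_one, add_tsub_cancel_left, pow_one]
  linear_combination X * hz'

end IsFlexCurve

/-- The plane curve `∑ c (i, j) x ^ i * y ^ j`. -/
noncomputable def planeCurve {L : Type*} [Field L] (S : Finset (ℕ × ℕ)) (c : ℕ × ℕ → L) :
    MvPolynomial (Fin 2) L :=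
  ∑ m ∈ S, MvPolynomial.C (c m) * MvPolynomial.X 0 ^ m.1 * MvPolynomial.X 1 ^ m.2

theorem aeval_planeCurve {L R : Type*} [Field L] [CommRing R] [Algebra L R] (S : Finset (ℕ × ℕ))
    (c : ℕ × ℕ → L) (x y : R) : MvPolynomial.aeval ![x, y] (planeCurve S c) =
      ∑ m ∈ S, algebraMap L R (c m) * x ^ m.1 * y ^ m.2 := by
  simp [planeCurve, MvPolynomial.algHom_C]

/-- The coordinate ring of a plane curve. -/
abbrev PlaneCoordRing {L : Type*} [Field L] (S : Finset (ℕ × ℕ)) (c : ℕ × ℕ → L) : Type _ :=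
  MvPolynomial (Fin 2) L ⧸ Ideal.span {planeCurve S c}

namespace PlaneCoordRing

variable {L : Type*} [Field L] {S : Finset (ℕ × ℕ)} {c : ℕ × ℕ → L}

/-- The coordinate functions. -/
noncomputable def x (S : Finset (ℕ × ℕ)) (c : ℕ × ℕ → L) : PlaneCoordRing S c :=
  Ideal.Quotient.mk _ (MvPolynomial.X 0)

/-- The coordinate functions. -/
noncomputable def y (S : Finset (ℕ × ℕ)) (c : ℕ × ℕ → L) : PlaneCoordRing S c :=
  Ideal.Quotient.mk _ (MvPolynomial.X 1)

theorem mk_eq_aeval (p : MvPolynomial (Fin 2) L) :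
    Ideal.Quotient.mk (Ideal.span {planeCurve S c}) p = MvPolynomial.aeval ![x S c, y S c] p := by
  rw [← Ideal.Quotient.mkₐ_eq_mk L]
  congr 1
  ext i
  fin_cases i <;> simp [x, y]

theorem aeval_eq_zero : MvPolynomial.aeval ![x S c, y S c] (planeCurve S c) = 0 := by
  rw [← mk_eq_aeval]
  exact Ideal.Quotient.eq_zero_iff_mem.2 (Ideal.mem_span_singleton_self _)

/-- The universal property of the coordinate ring. -/
noncomputable def lift {R : Type*} [CommRing R] [Algebra L R] (a b : R)
    (h : MvPolynomial.aeval ![a, b] (planeCurve S c) = 0) : PlaneCoordRing S c →ₐ[L] R :=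
  Ideal.Quotient.liftₐ _ (MvPolynomial.aeval ![a, b]) fun p hp => by
    obtain ⟨r, rfl⟩ := Ideal.mem_span_singleton'.1 hp
    rw [map_mul, h, mul_zero]

variable {R : Type*} [CommRing R] [Algebra L R] (a b : R)
  (h : MvPolynomial.aeval ![a, b] (planeCurve S c) = 0)

@[simp]
theorem lift_x : lift a b h (x S c) = a :=
  (Ideal.Quotient.lift_mk _ _ _).trans (by simp)

@[simp]
theorem lift_y : lift a b h (y S c) = b :=
  (Ideal.Quotient.lift_mk _ _ _).trans (by simp)

theorem exists_aeval (u : PlaneCoordRing S c) :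
    ∃ p : MvPolynomial (Fin 2) L, MvPolynomial.aeval ![x S c, y S c] p = u := by
  obtain ⟨p, rfl⟩ := Ideal.Quotient.mk_surjective u
  exact ⟨p, (mk_eq_aeval p).symm⟩

end PlaneCoordRing

end

section

open LaurentSeries

/-- A finite linear combination of Hahn series of pairwise distinct orders has no cancellation
of leading terms. -/
theorem HahnSeries.exists_coeff_order_sum_ne_zero {Γ K ι : Type*} [AddCommGroup Γ] [LinearOrder Γ]
    [IsOrderedAddMonoid Γ] [Field K] (v : ι → HahnSeries Γ K) (hv : ∀ i, v i ≠ 0)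
    (ho : Function.Injective fun i => (v i).order) (l : ι →₀ K) (hl : l ≠ 0) :
    ∃ i ∈ l.support, (l.sum fun i a => a • v i).coeff (v i).order ≠ 0 := by
  obtain ⟨i, hi, hmin⟩ := Finset.exists_min_image l.support (fun i => (v i).order)
    (Finsupp.support_nonempty_iff.2 hl)
  refine ⟨i, hi, ?_⟩
  rw [Finsupp.sum, HahnSeries.coeff_sum, Finset.sum_eq_single_of_mem i hi]
  · simpa [HahnSeries.coeff_order_eq_zero, hv i] using hi
  · intro j hj hji
    rw [HahnSeries.coeff_smul, HahnSeries.coeff_eq_zero_of_lt_order, smul_zero]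
    exact lt_of_le_of_ne (hmin j hj) fun h => hji (ho h).symm

theorem LaurentSeries.algebraMap_eq_C {L : Type*} [Field L] (r : L) :
    algebraMap L L⸨X⸩ r = HahnSeries.C r := by
  rw [HahnSeries.algebraMap_apply', PowerSeries.algebraMap_apply, Algebra.algebraMap_self_apply,
    HahnSeries.ofPowerSeries_C]

theorem LaurentSeries.algHom_smul {L A : Type*} [Field L] [CommRing A] [Algebra L A]
    (π : A →ₐ[L] L⸨X⸩) (r : L) (u : A) : π (r • u) = HahnSeries.C r * π u := by
  rw [Algebra.smul_def, map_mul, AlgHom.commutes, algebraMap_eq_C]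

/-- `π` expands the elements of `A` at a place at which `x` and `y` have poles of orders `n` and
`n + 1`, and `A` is spanned by the monomials `x ^ i * y ^ j` with `i ≤ n`. -/
structure IsPoleMap {L A : Type*} [Field L] [CommRing A] [Algebra L A] (n : ℕ) (x y : A)
    (π : A →ₐ[L] L⸨X⸩) : Prop where
  x_ne : π x ≠ 0
  y_ne : π y ≠ 0
  order_x : (π x).order = -(n : ℤ)
  order_y : (π y).order = -((n : ℤ) + 1)
  span_eq : Submodule.span L (Set.range fun m : Fin (n + 1) × ℕ => x ^ (m.1 : ℕ) * y ^ m.2) = ⊤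

namespace IsPoleMap

variable {L A : Type*} [Field L] [CommRing A] [Algebra L A] {n : ℕ} {x y : A} {π : A →ₐ[L] L⸨X⸩}

theorem monomial_ne (h : IsPoleMap n x y π) (i j : ℕ) : π (x ^ i * y ^ j) ≠ 0 := by
  rw [map_mul, map_pow, map_pow]
  exact mul_ne_zero (pow_ne_zero _ h.x_ne) (pow_ne_zero _ h.y_ne)

theorem order_monomial (h : IsPoleMap n x y π) (i j : ℕ) :
    (π (x ^ i * y ^ j)).order = -((i * n + j * (n + 1) : ℕ) : ℤ) := by
  rw [map_mul, map_pow, map_pow, HahnSeries.order_mul (pow_ne_zero _ h.x_ne)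
    (pow_ne_zero _ h.y_ne), HahnSeries.order_pow, HahnSeries.order_pow, h.order_x, h.order_y]
  push_cast
  simp
  ring

theorem weight_injective (n : ℕ) :
    Function.Injective fun m : Fin (n + 1) × ℕ => (m.1 : ℕ) * n + m.2 * (n + 1) := by
  rintro ⟨⟨i, hi⟩, j⟩ ⟨⟨i', hi'⟩, j'⟩ h
  simp only at h
  have h1 : i' + (i + j) * (n + 1) = i + (i' + j') * (n + 1) := by linarith
  have h2 : i' = i := by
    have := congrArg (· % (n + 1)) h1
    simpa [Nat.add_mul_mod_self_right, Nat.mod_eq_of_lt hi, Nat.mod_eq_of_lt hi'] using this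
  subst h2
  have : i' + j = i' + j' := Nat.eq_of_mul_eq_mul_right n.succ_pos (by
    simp only [Nat.succ_eq_add_one]; omega)
  simpa using this

theorem order_injective (h : IsPoleMap n x y π) : Function.Injective
    fun m : Fin (n + 1) × ℕ => (π (x ^ (m.1 : ℕ) * y ^ m.2)).order := by
  intro m m' hm
  simp only [h.order_monomial, neg_inj, Nat.cast_inj] at hm
  exact weight_injective n hm

theorem exists_coeff_ne_zero (h : IsPoleMap n x y π) {u : A} (hu : u ≠ 0) :
    ∃ w : ℕ, (π u).coeff (-(w : ℤ)) ≠ 0 := by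
  have hmem : u ∈ Submodule.span L
      (Set.range fun m : Fin (n + 1) × ℕ => x ^ (m.1 : ℕ) * y ^ m.2) := h.span_eq ▸ trivial
  obtain ⟨l, rfl⟩ := (Finsupp.mem_span_range_iff_exists_finsupp).1 hmem
  have hl : l ≠ 0 := by rintro rfl; simp at hu
  obtain ⟨i, -, hi⟩ := HahnSeries.exists_coeff_order_sum_ne_zero
    (fun m : Fin (n + 1) × ℕ => π (x ^ (m.1 : ℕ) * y ^ m.2)) (fun m => h.monomial_ne _ _)
    h.order_injective l hl
  rw [h.order_monomial] at hi
  refine ⟨i.1 * n + i.2 * (n + 1), ?_⟩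
  convert hi using 2
  rw [Finsupp.sum, Finsupp.sum, map_sum]
  simp only [LaurentSeries.algHom_smul, HahnSeries.C_mul_eq_smul]

theorem injective (h : IsPoleMap n x y π) : Function.Injective π := by
  rw [injective_iff_map_eq_zero]
  intro u hu
  by_contra hne
  obtain ⟨w, hw⟩ := h.exists_coeff_ne_zero hne
  simp [hu] at hw

theorem isDomain (h : IsPoleMap n x y π) : IsDomain A :=
  h.injective.isDomain π.toRingHom

theorem linearIndependent (h : IsPoleMap n x y π) :
    LinearIndependent L fun m : Fin (n + 1) × ℕ => x ^ (m.1 : ℕ) * y ^ m.2 := by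
  rw [linearIndependent_iff]
  intro l hl
  by_contra hne
  obtain ⟨i, -, hi⟩ := HahnSeries.exists_coeff_order_sum_ne_zero
    (fun m : Fin (n + 1) × ℕ => π (x ^ (m.1 : ℕ) * y ^ m.2)) (fun m => h.monomial_ne _ _)
    h.order_injective l hne
  apply hi
  have := congrArg π hl
  rw [Finsupp.linearCombination_apply, Finsupp.sum, map_sum, map_zero] at this
  simp only [LaurentSeries.algHom_smul, HahnSeries.C_mul_eq_smul] at this
  rw [Finsupp.sum, this, HahnSeries.coeff_zero]

variable (π) in
/-- The elements with a pole of order at most `m`. -/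
def poleFiltration (m : ℤ) : Submodule L A where
  carrier := {u | ((-m : ℤ) : WithTop ℤ) ≤ (π u).orderTop}
  zero_mem' := by simp
  add_mem' {u v} hu hv := by
    rw [Set.mem_ofPred_eq, map_add]
    exact (le_min hu hv).trans HahnSeries.min_orderTop_le_orderTop_add
  smul_mem' r u hu := by
    rw [Set.mem_ofPred_eq, LaurentSeries.algHom_smul, HahnSeries.C_mul_eq_smul]
    exact le_trans hu (HahnSeries.orderTop_le_orderTop_smul _ _)

theorem mem_poleFiltration {m : ℤ} {u : A} :
    u ∈ poleFiltration π m ↔ ((-m : ℤ) : WithTop ℤ) ≤ (π u).orderTop :=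
  Iff.rfl

theorem poleFiltration_mono {m m' : ℤ} (h : m ≤ m') : poleFiltration π m ≤ poleFiltration π m' :=
  fun _ hu => le_trans (by exact_mod_cast neg_le_neg h) (mem_poleFiltration.1 hu)

theorem mul_mem {m m' : ℤ} {u v : A} (hu : u ∈ poleFiltration π m) (hv : v ∈ poleFiltration π m') :
    u * v ∈ poleFiltration π (m + m') := by
  rw [mem_poleFiltration, map_mul, HahnSeries.orderTop_mul, neg_add, WithTop.coe_add]
  exact add_le_add hu hv

theorem monomial_mem (h : IsPoleMap n x y π) (i j : ℕ) :
    x ^ i * y ^ j ∈ poleFiltration π (i * n + j * (n + 1) : ℕ) := by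
  rw [mem_poleFiltration, ← h.order_monomial, HahnSeries.order_eq_orderTop_of_ne_zero
    (h.monomial_ne _ _)]

theorem one_mem : (1 : A) ∈ poleFiltration π 0 := by
  rw [mem_poleFiltration, map_one, HahnSeries.orderTop_one]; simp

theorem pow_mem {m : ℤ} {u : A} (hu : u ∈ poleFiltration π m) (e : ℕ) :
    u ^ e ∈ poleFiltration π (e * m) := by
  induction e with
  | zero => simpa using one_mem
  | succ e ih =>
    rw [pow_succ]
    convert mul_mem ih hu using 1
    push_cast; ring_nf

theorem mem_of_mul_mem {u v : A} {m e : ℤ} (hu : π u ≠ 0) (ho : (π u).order = -e)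
    (h : u * v ∈ poleFiltration π m) : v ∈ poleFiltration π (m - e) := by
  rw [mem_poleFiltration, map_mul, HahnSeries.orderTop_mul,
    ← HahnSeries.order_eq_orderTop_of_ne_zero hu, ho] at h
  rw [mem_poleFiltration]
  cases hv : (π v).orderTop with
  | top => exact le_top
  | coe a =>
    rw [hv] at h
    norm_cast at *
    omega

variable (π) in
theorem exists_mem (u : A) : ∃ m : ℕ, u ∈ poleFiltration π m := by
  refine ⟨(-(π u).order).toNat, ?_⟩
  rw [mem_poleFiltration]
  by_cases hu : π u = 0
  · simp [hu]
  · rw [← HahnSeries.order_eq_orderTop_of_ne_zero hu]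
    norm_cast
    have := Int.self_le_toNat (-(π u).order)
    omega

/-- The coefficients of orders `-m, …, 0`. -/
noncomputable def coeffMap (π : A →ₐ[L] L⸨X⸩) (m : ℕ) : A →ₗ[L] Fin (m + 1) → L where
  toFun u i := (π u).coeff (-((i : ℕ) : ℤ))
  map_add' u v := by ext i; simp
  map_smul' r u := by ext i; simp [LaurentSeries.algHom_smul]

theorem coeffMap_injOn (h : IsPoleMap n x y π) (m : ℕ) :
    Function.Injective ((coeffMap π m).comp (poleFiltration π m).subtype) := by
  rw [← LinearMap.ker_eq_bot, LinearMap.ker_eq_bot']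
  rintro ⟨u, hu⟩ h0
  by_contra hne
  obtain ⟨w, hw⟩ := h.exists_coeff_ne_zero (u := u) (by simpa using hne)
  by_cases hwm : w < m + 1
  · exact hw (congrFun h0 ⟨w, hwm⟩)
  · apply hw
    apply HahnSeries.coeff_eq_zero_of_lt_orderTop
    refine lt_of_lt_of_le ?_ (mem_poleFiltration.1 hu)
    norm_cast
    omega

theorem finite_poleFiltration (h : IsPoleMap n x y π) (m : ℕ) :
    Module.Finite L (poleFiltration π m) :=
  Module.Finite.of_injective _ (h.coeffMap_injOn m)

theorem finrank_poleFiltration_le (h : IsPoleMap n x y π) (m : ℕ) :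
    Module.finrank L (poleFiltration π m) ≤ m + 1 := by
  simpa using LinearMap.finrank_le_finrank_of_injective (h.coeffMap_injOn m)

theorem exists_weight_eq (n w : ℕ) (hw : n ^ 2 ≤ w) :
    ∃ m : Fin (n + 1) × ℕ, (m.1 : ℕ) * n + m.2 * (n + 1) = w := by
  set i := (w * n) % (n + 1)
  have hi : i < n + 1 := Nat.mod_lt _ n.succ_pos
  have h1 : i * n ≤ w := by nlinarith
  have h2 : (n + 1) ∣ w - i * n := by
    have h3 : ((w * n : ℕ) : ℤ) = (i : ℤ) + ((n + 1 : ℕ) : ℤ) * ((w * n / (n + 1) : ℕ) : ℤ) := by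
      exact_mod_cast (Nat.mod_add_div (w * n) (n + 1)).symm
    rw [← Int.natCast_dvd_natCast, Nat.cast_sub h1]
    refine ⟨w * (1 - n) + n * ((w * n / (n + 1) : ℕ) : ℤ), ?_⟩
    generalize ((w * n / (n + 1) : ℕ) : ℤ) = r at h3 ⊢
    push_cast at h3 ⊢
    linear_combination (n : ℤ) * h3
  obtain ⟨j, hj⟩ := h2
  exact ⟨(⟨i, hi⟩, j), by simp only; rw [mul_comm j, ← hj]; omega⟩

theorem le_finrank_poleFiltration (h : IsPoleMap n x y π) (m : ℕ) :
    m + 1 ≤ Module.finrank L (poleFiltration π m) + n ^ 2 := by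
  choose e he using fun w : Fin (m + 1 - n ^ 2) => exists_weight_eq n (n ^ 2 + w) (by omega)
  have hinj : Function.Injective e := by
    intro w w' hww
    have := he w
    rw [hww, he w'] at this
    ext; omega
  have hli := h.linearIndependent.comp e hinj
  have := h.finite_poleFiltration m
  have hmem : ∀ w, x ^ ((e w).1 : ℕ) * y ^ (e w).2 ∈ poleFiltration π m := by
    intro w
    refine poleFiltration_mono ?_ (h.monomial_mem _ _)
    rw [he w]
    norm_cast
    omega
  have hli' : LinearIndependent L fun w => (⟨_, hmem w⟩ : poleFiltration π m) :=
    LinearIndependent.of_comp (poleFiltration π m).subtype hli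
  have := hli'.fintype_card_le_finrank
  rw [Fintype.card_fin] at this
  omega

end IsPoleMap

end

section

open LaurentSeries

theorem HahnSeries.order_ofPowerSeries_X_pow_mul {L : Type*} [Field L] (e : ℕ)
    {w : PowerSeries L} (hw : PowerSeries.constantCoeff w ≠ 0) :
    HahnSeries.ofPowerSeries ℤ L (PowerSeries.X ^ e * w) ≠ 0 ∧
      (HahnSeries.ofPowerSeries ℤ L (PowerSeries.X ^ e * w)).order = e := by
  have hw0 : w ≠ 0 := by rintro rfl; simp at hw
  have hne : HahnSeries.ofPowerSeries ℤ L w ≠ 0 := by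
    rwa [Ne, map_eq_zero_iff _ HahnSeries.ofPowerSeries_injective]
  have hX : (HahnSeries.single (e : ℤ) (1 : L)) ≠ 0 := by simp
  rw [map_mul, HahnSeries.ofPowerSeries_X_pow]
  refine ⟨mul_ne_zero hX hne, ?_⟩
  rw [HahnSeries.order_mul hX hne, HahnSeries.order_single one_ne_zero]
  have h0 : (HahnSeries.ofPowerSeries ℤ L w).coeff 0 ≠ 0 := by
    have := HahnSeries.ofPowerSeries_apply_coeff (Γ := ℤ) w 0
    simp only [Nat.cast_zero] at this
    rwa [this, PowerSeries.coeff_zero_eq_constantCoeff_apply]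
  have h1 := HahnSeries.order_le_of_coeff_ne_zero h0
  have h2 : 0 ≤ (HahnSeries.ofPowerSeries ℤ L w).order := by
    rw [HahnSeries.le_order_iff_forall hne]
    intro j hj
    rw [PowerSeries.coeff_coe, if_pos hj]
  omega

theorem HahnSeries.order_inv' {L : Type*} [Field L] (f : L⸨X⸩) : f⁻¹.order = -f.order := by
  by_cases hf : f = 0
  · simp [hf]
  · have := HahnSeries.order_mul hf (inv_ne_zero hf)
    rw [mul_inv_cancel₀ hf, HahnSeries.order_one] at this
    omega

namespace IsFlexCurve

variable {L : Type*} [Field L] {n : ℕ} {S : Finset (ℕ × ℕ)} {c : ℕ × ℕ → L}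

open PlaneCoordRing in
theorem span_monomial_eq_top (h : IsFlexCurve n S c) : Submodule.span L
    (Set.range fun m : Fin (n + 1) × ℕ => x S c ^ (m.1 : ℕ) * y S c ^ m.2) = ⊤ := by
  set W := Submodule.span L
    (Set.range fun m : Fin (n + 1) × ℕ => x S c ^ (m.1 : ℕ) * y S c ^ m.2) with hW
  have hmon : ∀ i j, i ≤ n → x S c ^ i * y S c ^ j ∈ W := fun i j hi =>
    Submodule.subset_span ⟨(⟨i, Nat.lt_succ_of_le hi⟩, j), rfl⟩
  have hy : ∀ u ∈ W, u * y S c ∈ W := by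
    intro u hu
    induction hu using Submodule.span_induction with
    | mem u hu =>
      obtain ⟨m, rfl⟩ := hu
      simp only [mul_assoc, ← pow_succ]
      exact hmon _ _ (Nat.le_of_lt_succ m.1.2)
    | zero => simp
    | add u v _ _ hu hv => rw [add_mul]; exact W.add_mem hu hv
    | smul r u _ hu => rw [smul_mul_assoc]; exact W.smul_mem r hu
  have hyj : ∀ u ∈ W, ∀ j, u * y S c ^ j ∈ W := by
    intro u hu j
    induction j with
    | zero => simpa
    | succ j ih => rw [pow_succ, ← mul_assoc]; exact hy _ ih
  have htop : x S c ^ (n + 1) ∈ W := by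
    have h0 := aeval_planeCurve S c (x S c) (y S c)
    rw [aeval_eq_zero, ← Finset.add_sum_erase S _ h.left_mem] at h0
    have h2 : algebraMap L (PlaneCoordRing S c) (c (n + 1, 0))⁻¹ * algebraMap L _ (c (n + 1, 0)) =
        1 := by
      rw [← map_mul, inv_mul_cancel₀ h.left_ne, map_one]
    have h1 : x S c ^ (n + 1) = algebraMap L _ (c (n + 1, 0))⁻¹ *
        (- ∑ m ∈ S.erase (n + 1, 0), algebraMap L _ (c m) * x S c ^ m.1 * y S c ^ m.2) := by
      simp only [pow_zero, mul_one] at h0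
      linear_combination (-algebraMap L (PlaneCoordRing S c) (c (n + 1, 0))⁻¹) * h0 -
        x S c ^ (n + 1) * h2
    rw [h1, ← Algebra.smul_def]
    refine W.smul_mem _ (W.neg_mem (Submodule.sum_mem _ fun m hm => ?_))
    rw [mul_assoc, ← Algebra.smul_def]
    rw [Finset.mem_erase] at hm
    exact W.smul_mem _ (hmon _ _ (by have := h.le m hm.2 hm.1; omega))
  have hx : ∀ u ∈ W, u * x S c ∈ W := by
    intro u hu
    induction hu using Submodule.span_induction with
    | mem u hu =>
      obtain ⟨m, rfl⟩ := hu
      simp only [mul_right_comm _ _ (x S c), ← pow_succ]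
      by_cases hm : (m.1 : ℕ) + 1 ≤ n
      · exact hmon _ _ hm
      · rw [show (m.1 : ℕ) + 1 = n + 1 by have := m.1.2; omega]
        exact hyj _ htop _
    | zero => simp
    | add u v _ _ hu hv => rw [add_mul]; exact W.add_mem hu hv
    | smul r u _ hu => rw [smul_mul_assoc]; exact W.smul_mem r hu
  rw [eq_top_iff]
  rintro u -
  obtain ⟨p, rfl⟩ := exists_aeval u
  induction p using MvPolynomial.induction_on with
  | C r =>
    rw [MvPolynomial.algHom_C, Algebra.algebraMap_eq_smul_one]
    exact W.smul_mem _ (by simpa using hmon 0 0 (Nat.zero_le _))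
  | add p p' hp hp' => rw [map_add]; exact W.add_mem hp hp'
  | mul_X p i hp =>
    rw [map_mul, MvPolynomial.aeval_X]
    fin_cases i
    · exact hx _ hp
    · exact hy _ hp

open PlaneCoordRing in
theorem exists_isPoleMap (h : IsFlexCurve n S c) :
    ∃ (π : PlaneCoordRing S c →ₐ[L] L⸨X⸩) (w : PowerSeries L), IsPoleMap n (x S c) (y S c) π ∧
      PowerSeries.constantCoeff w ≠ 0 ∧
      π (x S c) * HahnSeries.ofPowerSeries ℤ L (PowerSeries.X ^ n * w) = 1 ∧
      π (y S c) * HahnSeries.ofPowerSeries ℤ L (PowerSeries.X ^ (n + 1) * w) = 1 := by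
  obtain ⟨w, hw, hsum⟩ := h.exists_branch_at_infinity
  obtain ⟨hn, hno⟩ := HahnSeries.order_ofPowerSeries_X_pow_mul n hw
  obtain ⟨hn1, hno1⟩ := HahnSeries.order_ofPowerSeries_X_pow_mul (n + 1) hw
  set f := HahnSeries.ofPowerSeries ℤ L (PowerSeries.X ^ n * w) with hf
  set g := HahnSeries.ofPowerSeries ℤ L (PowerSeries.X ^ (n + 1) * w) with hg
  set t := HahnSeries.ofPowerSeries ℤ L PowerSeries.X with ht
  have hfg : f⁻¹ = t * g⁻¹ := by
    have : g = t * f := by rw [hf, hg, ht, ← map_mul]; ring_nf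
    field_simp
    rw [this, mul_comm]
  have hp : MvPolynomial.aeval ![f⁻¹, g⁻¹] (planeCurve S c) = 0 := by
    have hsum' := congrArg (HahnSeries.ofPowerSeries ℤ L) hsum
    simp only [map_sum, map_mul, map_pow, map_zero] at hsum'
    rw [aeval_planeCurve]
    have : ∀ m ∈ S, algebraMap L L⸨X⸩ (c m) * f⁻¹ ^ m.1 * g⁻¹ ^ m.2 =
        (g⁻¹) ^ (n + 1) * (HahnSeries.ofPowerSeries ℤ L (PowerSeries.C (c m)) *
          g ^ (n + 1 - (m.1 + m.2)) * t ^ m.1) := by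
      intro m hm
      obtain ⟨e, he⟩ := Nat.exists_eq_add_of_le (h.le_succ hm)
      rw [hfg, LaurentSeries.algebraMap_eq_C, HahnSeries.ofPowerSeries_C, he,
        Nat.add_sub_cancel_left, pow_add, pow_add]
      have : (g⁻¹) ^ e * g ^ e = 1 := by rw [← mul_pow, inv_mul_cancel₀ hn1, one_pow]
      linear_combination (-HahnSeries.C (c m) * (t * g⁻¹) ^ m.1 * g⁻¹ ^ m.2) * this
    rw [Finset.sum_congr rfl this, ← Finset.mul_sum, hg, map_mul, map_pow]
    simp only [mul_pow] at hsum' ⊢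
    rw [hsum', mul_zero]
  refine ⟨lift _ _ hp, w, ⟨?_, ?_, ?_, ?_, h.span_monomial_eq_top⟩, hw, ?_, ?_⟩
  · simpa using hn
  · simpa using hn1
  · rw [lift_x, HahnSeries.order_inv', hno]
  · rw [lift_y, HahnSeries.order_inv', hno1]; push_cast; ring
  · rw [lift_x, inv_mul_cancel₀ hn]
  · rw [lift_y, inv_mul_cancel₀ hn1]

end IsFlexCurve

namespace IsPoleMap

variable {L A : Type*} [Field L] [CommRing A] [Algebra L A] {n : ℕ} {x y : A} {π : A →ₐ[L] L⸨X⸩}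

theorem x_mem (h : IsPoleMap n x y π) : x ∈ poleFiltration π n := by
  simpa using h.monomial_mem 1 0

theorem algebraMap_mem (r : L) : algebraMap L A r ∈ poleFiltration π 0 := by
  rw [Algebra.algebraMap_eq_smul_one]
  exact Submodule.smul_mem _ _ one_mem

theorem le_of_X_pow_dvd (h : IsPoleMap n x y π) (φ : A →ₐ[L] PowerSeries L) {x₀ u : L}
    (hu : u ≠ 0) (hφ : φ x = PowerSeries.C x₀ + PowerSeries.C u * PowerSeries.X) {w : A}
    (hw : w ≠ 0) {D N : ℕ} (hD : w ∈ poleFiltration π D) (hN : PowerSeries.X ^ N ∣ φ w) :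
    N ≤ D + n ^ 2 := by
  have := h.isDomain
  set m := D + N * n
  have hfin := h.finite_poleFiltration m
  have hfin' := h.finite_poleFiltration (m - D)
  let T : poleFiltration π m →ₗ[L] Fin N → L :=
    { toFun := fun v i => PowerSeries.coeff (i : ℕ) (φ v)
      map_add' := fun v v' => by ext i; simp
      map_smul' := fun r v => by ext i; simp }
  have hT : Function.Surjective T := by
    intro v
    have hmem : ∀ e : Fin N, (v e / u ^ (e : ℕ)) • (x - algebraMap L A x₀) ^ (e : ℕ) ∈
        poleFiltration π m := by
      intro e
      have h1 : x - algebraMap L A x₀ ∈ poleFiltration π n :=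
        Submodule.sub_mem _ h.x_mem (poleFiltration_mono (by positivity) (algebraMap_mem x₀))
      refine Submodule.smul_mem _ _ (poleFiltration_mono ?_ (pow_mem h1 e))
      have : (e : ℕ) * n ≤ N * n := Nat.mul_le_mul_right _ e.2.le
      norm_cast
      omega
    refine ⟨⟨_, Submodule.sum_mem _ (t := Finset.univ) fun e _ => hmem e⟩, ?_⟩
    ext i
    have hX : φ (x - algebraMap L A x₀) = PowerSeries.C u * PowerSeries.X := by
      rw [map_sub, hφ, AlgHom.commutes, PowerSeries.algebraMap_apply, Algebra.algebraMap_self_apply]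
      ring
    simp only [T, LinearMap.coe_mk, AddHom.coe_mk, map_sum, map_smul, map_pow, hX, mul_pow]
    simp only [← map_pow (PowerSeries.C (R := L)), PowerSeries.coeff_C_mul,
      PowerSeries.coeff_X_pow, smul_eq_mul]
    rw [Finset.sum_eq_single i]
    · simp [hu]
    · intro j _ hj
      have : (i : ℕ) ≠ j := fun h => hj (Fin.ext h.symm)
      simp [this]
    · simp
  have hker : Module.finrank L (poleFiltration π (m - D : ℕ)) ≤
      Module.finrank L (LinearMap.ker T) := by
    have hmem : ∀ v ∈ poleFiltration π (m - D : ℕ), w * v ∈ poleFiltration π m := by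
      intro v hv
      refine poleFiltration_mono ?_ (mul_mem hD hv)
      norm_cast; omega
    let M : poleFiltration π (m - D : ℕ) →ₗ[L] LinearMap.ker T :=
      { toFun := fun v => ⟨⟨w * v, hmem v v.2⟩, by
          ext i
          obtain ⟨s, hs⟩ := hN
          simp only [T, LinearMap.coe_mk, AddHom.coe_mk, map_mul, hs, mul_assoc]
          rw [PowerSeries.coeff_X_pow_mul', if_neg (by have := i.2; omega)]
          rfl⟩
        map_add' := fun v v' => by ext; simp [mul_add]
        map_smul' := fun r v => by ext; simp }
    refine LinearMap.finrank_le_finrank_of_injective (f := M) ?_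
    intro v v' hv
    have : w * (v : A) = w * v' := congrArg (fun z : LinearMap.ker T => ((z : poleFiltration π m) : A)) hv
    exact Subtype.ext (mul_left_cancel₀ hw this)
  have h1 := LinearMap.finrank_range_add_finrank_ker T
  rw [LinearMap.range_eq_top.2 hT, finrank_top, Module.finrank_fin_fun] at h1
  have h2 := h.finrank_poleFiltration_le m
  have h3 := h.le_finrank_poleFiltration (m - D)
  omega

theorem exists_ne_zero_mem_pow (h : IsPoleMap n x y π) {ι : Type*} [Fintype ι] (I : ι → Ideal A)
    (N : ℕ) (hI : ∀ i, Module.Finite L (A ⧸ I i ^ N) ∧ Module.finrank L (A ⧸ I i ^ N) ≤ N) :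
    ∃ r ≠ 0, r ∈ poleFiltration π (N * Fintype.card ι + n ^ 2 : ℕ) ∧ ∀ i, r ∈ I i ^ N := by
  set m := N * Fintype.card ι + n ^ 2
  have hfin := h.finite_poleFiltration m
  have hfin' := fun i => (hI i).1
  let T : poleFiltration π m →ₗ[L] ∀ i, A ⧸ I i ^ N :=
    LinearMap.pi fun i => (Ideal.Quotient.mkₐ L (I i ^ N)).toLinearMap.comp (Submodule.subtype _)
  have hlt : Module.finrank L (∀ i, A ⧸ I i ^ N) < Module.finrank L (poleFiltration π m) := by
    have h1 := h.le_finrank_poleFiltration m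
    have h2 : ∑ i, Module.finrank L (A ⧸ I i ^ N) ≤ N * Fintype.card ι := by
      rw [mul_comm, ← smul_eq_mul, ← Finset.card_univ]
      exact Finset.sum_le_card_nsmul _ _ _ fun i _ => (hI i).2
    rw [Module.finrank_pi_fintype]
    omega
  obtain ⟨r, hr, hr0⟩ := (Submodule.ne_bot_iff _).1 (LinearMap.ker_ne_bot_of_finrank_lt (f := T) hlt)
  refine ⟨r, by simpa using hr0, r.2, fun i => ?_⟩
  rw [← Ideal.Quotient.eq_zero_iff_mem]
  exact congrFun hr i

end IsPoleMap

end

section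

variable {L A : Type*} [Field L] [CommRing A] [Algebra L A] {I : Ideal A} {t : A}

theorem Ideal.pow_le_span_pow_sup (htI : t ∈ I) (ht : I ≤ Ideal.span {t} ⊔ I ^ 2) (N : ℕ) :
    I ^ N ≤ Ideal.span {t ^ N} ⊔ I ^ (N + 1) := by
  induction N with
  | zero => simp
  | succ N ih =>
    calc I ^ (N + 1) = I ^ N * I := pow_succ _ _
        _ ≤ (Ideal.span {t ^ N} ⊔ I ^ (N + 1)) * I := Ideal.mul_mono_left ih
        _ = Ideal.span {t ^ N} * I ⊔ I ^ (N + 2) := by rw [Ideal.sup_mul, ← pow_succ]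
        _ ≤ Ideal.span {t ^ N} * (Ideal.span {t} ⊔ I ^ 2) ⊔ I ^ (N + 2) :=
          sup_le_sup_right (Ideal.mul_mono_right ht) _
        _ ≤ Ideal.span {t ^ (N + 1)} ⊔ I ^ (N + 1 + 1) := by
          rw [Ideal.mul_sup, Ideal.span_singleton_mul_span_singleton, ← pow_succ, sup_assoc]
          refine sup_le_sup_left (sup_le ?_ le_rfl) _
          rw [pow_add I N 2]
          exact Ideal.mul_mono_left (by
            rw [Ideal.span_singleton_le_iff_mem]
            exact Ideal.pow_mem_pow htI N)

theorem Ideal.exists_sub_sum_mem_pow (htI : t ∈ I) (ht : I ≤ Ideal.span {t} ⊔ I ^ 2)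
    (hI : ∀ a : A, ∃ c : L, a - algebraMap L A c ∈ I) (N : ℕ) (a : A) :
    ∃ v : Fin N → L, a - ∑ e, v e • t ^ (e : ℕ) ∈ I ^ N := by
  induction N with
  | zero => exact ⟨0, by simp⟩
  | succ N ih =>
    obtain ⟨v, hv⟩ := ih
    obtain ⟨s, hs, i, hi, hsi⟩ := Submodule.mem_sup.1 (Ideal.pow_le_span_pow_sup htI ht N hv)
    obtain ⟨s, rfl⟩ := Ideal.mem_span_singleton'.1 hs
    obtain ⟨c, hc⟩ := hI s
    refine ⟨Fin.snoc v c, ?_⟩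
    rw [Fin.sum_univ_castSucc]
    simp only [Fin.snoc_castSucc, Fin.val_castSucc, Fin.snoc_last, Fin.val_last, Algebra.smul_def]
    simp only [Algebra.smul_def] at hsi
    have : a - (∑ e : Fin N, algebraMap L A (v e) * t ^ (e : ℕ) + algebraMap L A c * t ^ N) =
        t ^ N * (s - algebraMap L A c) + i := by
      linear_combination -hsi
    rw [this]
    refine Ideal.add_mem _ ?_ hi
    rw [pow_succ]
    exact Ideal.mul_mem_mul (Ideal.pow_mem_pow htI N) hc

theorem Ideal.finrank_quotient_pow_le (htI : t ∈ I) (ht : I ≤ Ideal.span {t} ⊔ I ^ 2)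
    (hI : ∀ a : A, ∃ c : L, a - algebraMap L A c ∈ I) (N : ℕ) :
    Module.Finite L (A ⧸ I ^ N) ∧ Module.finrank L (A ⧸ I ^ N) ≤ N := by
  let T : (Fin N → L) →ₗ[L] A ⧸ I ^ N :=
    (Ideal.Quotient.mkₐ L (I ^ N)).toLinearMap.comp
      (Fintype.linearCombination L fun e : Fin N => t ^ (e : ℕ))
  have hT : Function.Surjective T := by
    intro z
    obtain ⟨a, rfl⟩ := Ideal.Quotient.mk_surjective z
    obtain ⟨v, hv⟩ := Ideal.exists_sub_sum_mem_pow htI ht hI N a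
    exact ⟨v, ((Ideal.Quotient.mk_eq_mk_iff_sub_mem _ _).2 hv).symm⟩
  exact ⟨Module.Finite.of_surjective T hT, by simpa using LinearMap.finrank_le_finrank_of_surjective hT⟩

end

namespace PlaneCoordRing

variable {L : Type*} [Field L] {S : Finset (ℕ × ℕ)} {c : ℕ × ℕ → L}

/-- The ideal of a point. -/
noncomputable def pointIdeal (S : Finset (ℕ × ℕ)) (c : ℕ × ℕ → L) (a b : L) :
    Ideal (PlaneCoordRing S c) :=
  Ideal.span {x S c - algebraMap L _ a, y S c - algebraMap L _ b}

theorem aeval_sub_mem_pointIdeal (a b : L) (p : MvPolynomial (Fin 2) L) :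
    MvPolynomial.aeval ![x S c, y S c] p - algebraMap L _ (MvPolynomial.aeval ![a, b] p) ∈
      pointIdeal S c a b := by
  induction p using MvPolynomial.induction_on with
  | C r => simp [MvPolynomial.algHom_C]
  | add p p' hp hp' =>
    rw [map_add, map_add, map_add, add_sub_add_comm]
    exact Ideal.add_mem _ hp hp'
  | mul_X p i hp =>
    rw [map_mul, map_mul, map_mul, MvPolynomial.aeval_X, MvPolynomial.aeval_X]
    have hi : (![x S c, y S c] i : PlaneCoordRing S c) - algebraMap L _ (![a, b] i) ∈
        pointIdeal S c a b := by
      fin_cases i <;> exact Ideal.subset_span (by simp)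
    convert Ideal.add_mem _ (Ideal.mul_mem_right (![x S c, y S c] i) _ hp)
      (Ideal.mul_mem_left _ (algebraMap L _ (MvPolynomial.aeval ![a, b] p)) hi) using 1
    ring

theorem exists_sub_algebraMap_mem (a b : L) (u : PlaneCoordRing S c) :
    ∃ r : L, u - algebraMap L _ r ∈ pointIdeal S c a b := by
  obtain ⟨p, rfl⟩ := exists_aeval u
  exact ⟨_, aeval_sub_mem_pointIdeal a b p⟩

theorem finrank_quotient_pow_le {a b : L}
    (h : MvPolynomial.aeval ![a, b] (planeCurve S c) = 0)
    (hs : MvPolynomial.aeval ![a, b] (MvPolynomial.pderiv 0 (planeCurve S c)) ≠ 0 ∨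
      MvPolynomial.aeval ![a, b] (MvPolynomial.pderiv 1 (planeCurve S c)) ≠ 0) (N : ℕ) :
    Module.Finite L (PlaneCoordRing S c ⧸ pointIdeal S c a b ^ N) ∧
      Module.finrank L (PlaneCoordRing S c ⧸ pointIdeal S c a b ^ N) ≤ N := by
  set I := pointIdeal S c a b with hI
  set A := x S c - algebraMap L _ a with hA
  set B := y S c - algebraMap L _ b with hB
  have hAI : A ∈ I := Ideal.subset_span (by simp [hA])
  have hBI : B ∈ I := Ideal.subset_span (by simp [hB])
  obtain ⟨r₁, r₂, r₃, hr⟩ :=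
    (planeCurve S c).exists_taylor_two_aeval (PlaneCoordRing S c)
  have ht := hr (algebraMap L _ a) (algebraMap L _ b) A B
  have hev : ∀ q : MvPolynomial (Fin 2) L, MvPolynomial.aeval
      ![algebraMap L (PlaneCoordRing S c) a, algebraMap L (PlaneCoordRing S c) b] q =
        algebraMap L _ (MvPolynomial.aeval ![a, b] q) := fun q =>
    (MvPolynomial.map_aeval_pair (algebraMap L _) (fun r => by simp) a b q).symm
  rw [hA, hB, add_sub_cancel, add_sub_cancel, ← hA, ← hB, aeval_eq_zero, hev, hev, hev, h,
    map_zero, zero_add] at ht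
  set α := MvPolynomial.aeval ![a, b] (MvPolynomial.pderiv 0 (planeCurve S c))
  set β := MvPolynomial.aeval ![a, b] (MvPolynomial.pderiv 1 (planeCurve S c))
  have hquad : algebraMap L _ α * A + algebraMap L _ β * B ∈ I ^ 2 := by
    have h1 := Ideal.mul_mem_left (I ^ 2) (MvPolynomial.aeval ![algebraMap L _ a, algebraMap L _ b, A, B] r₁)
      (Ideal.pow_mem_pow hAI 2)
    have h2 := Ideal.mul_mem_left (I ^ 2) (MvPolynomial.aeval ![algebraMap L _ a, algebraMap L _ b, A, B] r₂)
      (sq I ▸ Ideal.mul_mem_mul hAI hBI)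
    have h3 := Ideal.mul_mem_left (I ^ 2) (MvPolynomial.aeval ![algebraMap L _ a, algebraMap L _ b, A, B] r₃)
      (Ideal.pow_mem_pow hBI 2)
    convert (I ^ 2).neg_mem (Ideal.add_mem _ (Ideal.add_mem _ h1 h2) h3) using 1
    linear_combination -ht
  have key : ∀ {u v : PlaneCoordRing S c} {r s : L}, r ≠ 0 →
      algebraMap L _ r * u + algebraMap L _ s * v ∈ I ^ 2 → u ∈ Ideal.span {v} ⊔ I ^ 2 := by
    intro u v r s hr0 huv
    have hinv : algebraMap L (PlaneCoordRing S c) r⁻¹ * algebraMap L _ r = 1 := by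
      rw [← map_mul, inv_mul_cancel₀ hr0, map_one]
    have : u = (-(algebraMap L _ r⁻¹ * algebraMap L _ s)) * v +
        algebraMap L _ r⁻¹ * (algebraMap L _ r * u + algebraMap L _ s * v) := by
      linear_combination (-u) * hinv
    rw [this]
    exact Submodule.add_mem_sup (Ideal.mul_mem_left _ _ (Ideal.mem_span_singleton_self v))
      (Ideal.mul_mem_left _ _ huv)
  rcases hs with hs | hs
  · refine Ideal.finrank_quotient_pow_le (t := B) hBI ?_ (exists_sub_algebraMap_mem a b) N
    refine Ideal.span_le.2 ?_
    rintro z (rfl | rfl)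
    · exact key hs hquad
    · exact Ideal.mem_sup_left (Ideal.mem_span_singleton_self B)
  · refine Ideal.finrank_quotient_pow_le (t := A) hAI ?_ (exists_sub_algebraMap_mem a b) N
    refine Ideal.span_le.2 ?_
    rintro z (rfl | rfl)
    · exact Ideal.mem_sup_left (Ideal.mem_span_singleton_self A)
    · exact key hs (add_comm (algebraMap L _ α * A) _ ▸ hquad)

end PlaneCoordRing

section

open PowerSeries

section Secant

variable {k R : Type*} [Field k] [CommRing R] [Algebra k R] (S : Finset (ℕ × ℕ)) (c : ℕ × ℕ → k)

/-- The divided difference in the first variable of a plane curve. -/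
noncomputable def secantX (x₁ x₂ y₂ : R) : R :=
  ∑ m ∈ S, algebraMap k R (c m) * (∑ p ∈ Finset.range m.1, x₁ ^ p * x₂ ^ (m.1 - 1 - p)) * y₂ ^ m.2

/-- The divided difference in the second variable of a plane curve. -/
noncomputable def secantY (x₁ y₁ y₂ : R) : R :=
  ∑ m ∈ S, algebraMap k R (c m) * x₁ ^ m.1 * ∑ p ∈ Finset.range m.2, y₁ ^ p * y₂ ^ (m.2 - 1 - p)

theorem secantX_mul_add_secantY_mul (x₁ y₁ x₂ y₂ : R) :
    (x₁ - x₂) * secantX S c x₁ x₂ y₂ + (y₁ - y₂) * secantY S c x₁ y₁ y₂ =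
      MvPolynomial.aeval ![x₁, y₁] (planeCurve S c) -
        MvPolynomial.aeval ![x₂, y₂] (planeCurve S c) := by
  simp only [aeval_planeCurve, secantX, secantY]
  rw [Finset.mul_sum, Finset.mul_sum, ← Finset.sum_add_distrib, ← Finset.sum_sub_distrib]
  refine Finset.sum_congr rfl fun m _ => ?_
  have h1 := (Commute.all x₁ x₂).mul_geom_sum₂ m.1
  have h2 := (Commute.all y₁ y₂).mul_geom_sum₂ m.2
  linear_combination algebraMap k R (c m) * y₂ ^ m.2 * h1 + algebraMap k R (c m) * x₁ ^ m.1 * h2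

theorem map_secantX {R' : Type*} [CommRing R'] [Algebra k R'] (σ : R →+* R')
    (hσ : ∀ r, σ (algebraMap k R r) = algebraMap k R' r) (x₁ x₂ y₂ : R) :
    σ (secantX S c x₁ x₂ y₂) = secantX S c (σ x₁) (σ x₂) (σ y₂) := by
  simp [secantX, hσ]

theorem map_secantY {R' : Type*} [CommRing R'] [Algebra k R'] (σ : R →+* R')
    (hσ : ∀ r, σ (algebraMap k R r) = algebraMap k R' r) (x₁ y₁ y₂ : R) :
    σ (secantY S c x₁ y₁ y₂) = secantY S c (σ x₁) (σ y₁) (σ y₂) := by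
  simp [secantY, hσ]

theorem secantX_tower {K : Type*} [Field K] [Algebra k K] [Algebra K R] [IsScalarTower k K R]
    (x₁ x₂ y₂ : R) : secantX S (fun m => algebraMap k K (c m)) x₁ x₂ y₂ = secantX S c x₁ x₂ y₂ := by
  simp [secantX, ← IsScalarTower.algebraMap_apply]

theorem secantY_tower {K : Type*} [Field K] [Algebra k K] [Algebra K R] [IsScalarTower k K R]
    (x₁ y₁ y₂ : R) : secantY S (fun m => algebraMap k K (c m)) x₁ y₁ y₂ = secantY S c x₁ y₁ y₂ := by
  simp [secantY, ← IsScalarTower.algebraMap_apply]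

theorem secantY_self (x y : R) :
    secantY S c x y y = MvPolynomial.aeval ![x, y] (MvPolynomial.pderiv 1 (planeCurve S c)) := by
  simp only [secantY, planeCurve, map_sum]
  refine Finset.sum_congr rfl fun m _ => ?_
  rw [(MvPolynomial.pderiv 1).leibniz, (MvPolynomial.pderiv 1).leibniz_pow,
    (MvPolynomial.pderiv 1).leibniz, (MvPolynomial.pderiv 1).leibniz_pow, MvPolynomial.pderiv_C,
    MvPolynomial.pderiv_X_of_ne (i := 1) (j := 0) (by decide), MvPolynomial.pderiv_X_self]
  have : ∑ p ∈ Finset.range m.2, y ^ p * y ^ (m.2 - 1 - p) = m.2 * y ^ (m.2 - 1) := by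
    rw [Finset.sum_congr rfl (g := fun _ => y ^ (m.2 - 1))]
    · simp
    · intro p hp
      rw [← pow_add]
      congr 1
      have := Finset.mem_range.1 hp
      omega
  rw [this]
  simp [MvPolynomial.algHom_C]

theorem secantX_self (x y : R) :
    secantX S c x x y = MvPolynomial.aeval ![x, y] (MvPolynomial.pderiv 0 (planeCurve S c)) := by
  simp only [secantX, planeCurve, map_sum]
  refine Finset.sum_congr rfl fun m _ => ?_
  rw [(MvPolynomial.pderiv 0).leibniz, (MvPolynomial.pderiv 0).leibniz_pow,
    (MvPolynomial.pderiv 0).leibniz, (MvPolynomial.pderiv 0).leibniz_pow, MvPolynomial.pderiv_C,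
    MvPolynomial.pderiv_X_of_ne (i := 0) (j := 1) (by decide), MvPolynomial.pderiv_X_self]
  have : ∑ p ∈ Finset.range m.1, x ^ p * x ^ (m.1 - 1 - p) = m.1 * x ^ (m.1 - 1) := by
    rw [Finset.sum_congr rfl (g := fun _ => x ^ (m.1 - 1))]
    · simp
    · intro p hp
      rw [← pow_add]
      congr 1
      have := Finset.mem_range.1 hp
      omega
  rw [this]
  simp [MvPolynomial.algHom_C]
  ring

end Secant

section Extension

variable {K V ι J : Type*} [Field K] [AddCommGroup V] [Module K V]

theorem LinearIndependent.exists_sum_elim_comp [Fintype ι] {v : ι → V} (hv : LinearIndependent K v)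
    (f : J → V) (hf : Submodule.span K (Set.range f) = ⊤) (m : ℕ)
    (hm : Fintype.card ι + m ≤ Module.finrank K V) :
    ∃ g : Fin m → J, LinearIndependent K (Sum.elim v (f ∘ g)) := by
  induction m with
  | zero =>
    refine ⟨Fin.elim0, ?_⟩
    have := hv.comp (Equiv.sumEmpty ι (Fin 0)) (Equiv.injective _)
    convert this using 1
    ext i
    rcases i with i | i
    · rfl
    · exact i.elim0
  | succ m ih =>
    obtain ⟨g, hg⟩ := ih (by omega)
    have hne : ∃ j, f j ∉ Submodule.span K (Set.range (Sum.elim v (f ∘ g))) := by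
      by_contra! hall
      have htop : Submodule.span K (Set.range (Sum.elim v (f ∘ g))) = ⊤ := by
        rw [eq_top_iff, ← hf, Submodule.span_le]
        rintro _ ⟨j, rfl⟩
        exact hall j
      have := finrank_span_eq_card hg
      rw [htop, finrank_top] at this
      simp at this
      omega
    obtain ⟨j, hj⟩ := hne
    refine ⟨Fin.snoc g j, ?_⟩
    have hopt : LinearIndependent K
        (fun o : Option (ι ⊕ Fin m) => o.elim (f j) (Sum.elim v (f ∘ g))) := by
      rw [linearIndependent_option]
      exact ⟨hg, hj⟩
    let s : ι ⊕ Fin (m + 1) → Option (ι ⊕ Fin m) :=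
      Sum.elim (fun i => some (Sum.inl i)) (Fin.snoc (α := fun _ => Option (ι ⊕ Fin m))
        (fun i => some (Sum.inr i)) none)
    have hs : Function.Injective s := by
      rintro (i | i) (i' | i') h
      · simpa [s] using h
      · induction i' using Fin.lastCases <;> simp [s] at h
      · induction i using Fin.lastCases <;> simp [s] at h
      · induction i using Fin.lastCases <;> induction i' using Fin.lastCases <;> simp_all [s]
    convert hopt.comp s hs using 1
    ext i
    rcases i with i | i
    · rfl
    · induction i using Fin.lastCases <;> simp [s]

end Extension

end

section

open PowerSeries LaurentSeries

namespace IsPoleMap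

variable {K A : Type*} [Field K] [CommRing A] [Algebra K A] {n : ℕ} {x y : A} {π : A →ₐ[K] K⸨X⸩}

theorem x_sub_ne_and_order (h : IsPoleMap n x y π) (hn : 1 ≤ n) (r : K) :
    π (x - algebraMap K A r) ≠ 0 ∧ (π (x - algebraMap K A r)).order = -(n : ℤ) := by
  have h1 : (π x).orderTop = ((-(n : ℤ) : ℤ) : WithTop ℤ) := by
    rw [← HahnSeries.order_eq_orderTop_of_ne_zero h.x_ne, h.order_x]
  have h2 : (π x).orderTop < (π (algebraMap K A r)).orderTop := by
    refine lt_of_lt_of_le ?_ (mem_poleFiltration.1 (algebraMap_mem r))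
    rw [h1]
    exact_mod_cast (by omega)
  have h3 : (π (x - algebraMap K A r)).orderTop = ((-(n : ℤ) : ℤ) : WithTop ℤ) := by
    rw [map_sub, HahnSeries.orderTop_sub h2, h1]
  have h4 : π (x - algebraMap K A r) ≠ 0 := by
    intro h0
    rw [h0, HahnSeries.orderTop_zero] at h3
    exact WithTop.top_ne_coe h3
  refine ⟨h4, ?_⟩
  rw [← HahnSeries.order_eq_orderTop_of_ne_zero h4] at h3
  exact_mod_cast h3

end IsPoleMap

/-- A sequence of power series `κ l` obtained from elements `a l`, `b l` of a ring `A` of functions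
on an affine curve, expanded by `φ`, by a recursion whose denominators are `x - ξ 0` and
`y - η 0`. -/
structure IsSecantSeq {K A : Type*} [Field K] [CommRing A] [Algebra K A] (x y : A)
    (φ : A →ₐ[K] K⟦X⟧) (ξ η : ℕ → K) (a b : ℕ → A) (κ : ℕ → K⟦X⟧) : Prop where
  mul_x : ∀ l, φ (x - algebraMap K A (ξ 0)) * κ l =
    ∑ j ∈ Finset.range l, C (ξ (j + 1)) * κ (l - 1 - j) + φ (b l)
  mul_y : ∀ l, φ (y - algebraMap K A (η 0)) * κ l =
    ∑ j ∈ Finset.range l, C (η (j + 1)) * κ (l - 1 - j) + φ (a l)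

namespace IsSecantSeq

variable {K A : Type*} [Field K] [CommRing A] [Algebra K A] {n : ℕ} {x y : A} {π : A →ₐ[K] K⸨X⸩}
  {φ : A →ₐ[K] K⟦X⟧} {ξ η : ℕ → K} {a b : ℕ → A} {κ : ℕ → K⟦X⟧}

theorem exists_of_mem_pow (hκ : IsSecantSeq x y φ ξ η a b κ) (l : ℕ) {w : A}
    (hw : w ∈ Ideal.span {x - algebraMap K A (ξ 0), y - algebraMap K A (η 0)} ^ (l + 1)) :
    ∃ u, φ u = φ w * κ l := by
  set I := Ideal.span {x - algebraMap K A (ξ 0), y - algebraMap K A (η 0)} with hI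
  induction l using Nat.strong_induction_on generalizing w with
  | _ l ih =>
    have key : ∀ w ∈ I ^ l, ∀ (ζ : ℕ → K) (d : A), ∃ u,
        φ u = φ w * (∑ j ∈ Finset.range l, C (ζ (j + 1)) * κ (l - 1 - j) + φ d) := by
      intro w hw ζ d
      have : ∀ j, ∃ u, j < l → φ u = φ w * κ (l - 1 - j) := by
        intro j
        by_cases hj : j < l
        · obtain ⟨u, hu⟩ := ih (l - 1 - j) (by omega)
            (Ideal.pow_le_pow_right (by omega : l - 1 - j + 1 ≤ l) hw)
          exact ⟨u, fun _ => hu⟩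
        · exact ⟨0, fun h => absurd h hj⟩
      choose u hu using this
      refine ⟨∑ j ∈ Finset.range l, algebraMap K A (ζ (j + 1)) * u j + w * d, ?_⟩
      rw [map_add, map_sum, mul_add, Finset.mul_sum, map_mul]
      congr 1
      refine Finset.sum_congr rfl fun j hj => ?_
      rw [map_mul, hu j (Finset.mem_range.1 hj), AlgHom.commutes, PowerSeries.algebraMap_apply,
        Algebra.algebraMap_self_apply]
      ring
    rw [pow_succ] at hw
    refine Submodule.mul_induction_on hw (fun w hw g hg => ?_) ?_
    · obtain ⟨α, β, rfl⟩ := Ideal.mem_span_pair.1 hg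
      obtain ⟨u, hu⟩ := key w hw ξ (b l)
      obtain ⟨v, hv⟩ := key w hw η (a l)
      refine ⟨α * u + β * v, ?_⟩
      rw [map_add, map_mul, map_mul, hu, hv, ← hκ.mul_x, ← hκ.mul_y, map_mul, map_add, map_mul,
        map_mul]
      ring
    · rintro w w' ⟨u, hu⟩ ⟨u', hu'⟩
      exact ⟨u + u', by rw [map_add, hu, hu', map_add, add_mul]⟩

theorem exists_numerator (hκ : IsSecantSeq x y φ ξ η a b κ) (h : IsPoleMap n x y π) {D : ℕ}
    (hb : ∀ l, b l ∈ IsPoleMap.poleFiltration π D) (ev : A →ₐ[K] K) (hev : ev x = ξ 0) (l : ℕ) :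
    ∃ p, φ p = φ ((x - algebraMap K A (ξ 0)) ^ (l + 1)) * κ l ∧
      p ∈ IsPoleMap.poleFiltration π (l * n + D : ℕ) ∧ ev p = ξ 1 ^ l * ev (b 0) := by
  set t := x - algebraMap K A (ξ 0) with ht
  have htmem : t ∈ IsPoleMap.poleFiltration π n := Submodule.sub_mem _ h.x_mem
    (IsPoleMap.poleFiltration_mono (by positivity) (IsPoleMap.algebraMap_mem _))
  have hevt : ev t = 0 := by simp [ht, hev]
  induction l using Nat.strong_induction_on with
  | _ l ih =>
    have : ∀ j, ∃ p, j < l → φ p = φ (t ^ (l - 1 - j + 1)) * κ (l - 1 - j) ∧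
        p ∈ IsPoleMap.poleFiltration π ((l - 1 - j) * n + D : ℕ) ∧
        ev p = ξ 1 ^ (l - 1 - j) * ev (b 0) := by
      intro j
      by_cases hj : j < l
      · obtain ⟨p, hp⟩ := ih (l - 1 - j) (by omega)
        exact ⟨p, fun _ => hp⟩
      · exact ⟨0, fun h => absurd h hj⟩
    choose p hp using this
    refine ⟨∑ j ∈ Finset.range l, algebraMap K A (ξ (j + 1)) * (t ^ j * p j) + t ^ l * b l,
      ?_, ?_, ?_⟩
    · rw [pow_succ, map_mul, mul_assoc, hκ.mul_x, map_add, mul_add, map_mul, map_sum,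
        Finset.mul_sum]
      congr 1
      refine Finset.sum_congr rfl fun j hj => ?_
      have hj := Finset.mem_range.1 hj
      rw [map_mul, map_mul, (hp j hj).1, AlgHom.commutes, PowerSeries.algebraMap_apply,
        Algebra.algebraMap_self_apply, ← mul_assoc (φ (t ^ j)), ← map_mul, ← pow_add,
        show j + (l - 1 - j + 1) = l by omega]
      ring
    · refine Submodule.add_mem _ (Submodule.sum_mem _ fun j hj => ?_) ?_
      · have hj := Finset.mem_range.1 hj
        rw [← Algebra.smul_def]
        refine Submodule.smul_mem _ _ (IsPoleMap.poleFiltration_mono ?_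
          (IsPoleMap.mul_mem (IsPoleMap.pow_mem htmem j) (hp j hj).2.1))
        have : (j + (l - 1 - j)) * n ≤ l * n := Nat.mul_le_mul_right _ (by omega)
        rw [add_mul] at this
        norm_cast
        omega
      · refine IsPoleMap.poleFiltration_mono ?_
          (IsPoleMap.mul_mem (IsPoleMap.pow_mem htmem l) (hb l))
        norm_cast
    · rw [map_add, map_mul, map_pow, hevt, map_sum]
      rcases l with _ | l
      · simp
      · rw [Finset.sum_range_succ']
        simp only [map_mul, map_pow, hevt]
        rw [Finset.sum_eq_zero (fun j _ => by rw [zero_pow (by omega)]; simp), (hp 0 (by omega)).2.2]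
        simp
        ring

end IsSecantSeq

end

section

open PowerSeries LaurentSeries

namespace IsSecantSeq

variable {K A : Type*} [Field K] [CommRing A] [Algebra K A] {n : ℕ} {x y : A} {π : A →ₐ[K] K⸨X⸩}
  {φ : A →ₐ[K] K⟦X⟧} {ξ η : ℕ → K} {a b : ℕ → A} {κ : ℕ → K⟦X⟧}

theorem eq_zero_of_X_pow_dvd (hκ : IsSecantSeq x y φ ξ η a b κ) (h : IsPoleMap n x y π)
    (hn : 1 ≤ n) {x₀ u : K} (hu : u ≠ 0) (hφ : φ x = C x₀ + C u * X) {D : ℕ}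
    (hb : ∀ l, b l ∈ IsPoleMap.poleFiltration π D) (ev : A →ₐ[K] K) (hev : ev x = ξ 0)
    (hI : ∀ N, Module.Finite K (A ⧸ Ideal.span {x - algebraMap K A (ξ 0),
        y - algebraMap K A (η 0)} ^ N) ∧ Module.finrank K (A ⧸ Ideal.span
        {x - algebraMap K A (ξ 0), y - algebraMap K A (η 0)} ^ N) ≤ N)
    {v : A} {D' m N : ℕ} (hv : v ∈ IsPoleMap.poleFiltration π D') (e : Fin m → K)
    (hN : m + D + D' + 2 * n ^ 2 < N)
    (hdvd : X ^ N ∣ φ v + ∑ l, C (e l) * κ l) : φ v + ∑ l, C (e l) * κ l = 0 := by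
  have := h.isDomain
  set t := x - algebraMap K A (ξ 0) with ht
  obtain ⟨r, hr0, hr, hrI⟩ := h.exists_ne_zero_mem_pow (ι := Unit)
    (fun _ => Ideal.span {x - algebraMap K A (ξ 0), y - algebraMap K A (η 0)}) m
    (fun _ => hI m)
  rw [Fintype.card_unit, mul_one] at hr
  have hinj : Function.Injective φ := by
    refine (injective_iff_map_eq_zero φ).2 fun w hw => ?_
    by_contra hw0
    obtain ⟨D₀, hD₀⟩ := IsPoleMap.exists_mem π w
    have := h.le_of_X_pow_dvd φ hu hφ hw0 hD₀ (N := D₀ + n ^ 2 + 1) (by simp [hw])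
    omega
  have hex : ∀ l : Fin m, ∃ w, φ w = φ r * κ l ∧
      w ∈ IsPoleMap.poleFiltration π (m + n ^ 2 + D : ℕ) := by
    intro l
    obtain ⟨w, hw⟩ := hκ.exists_of_mem_pow l
      (Ideal.pow_le_pow_right (show (l : ℕ) + 1 ≤ m by omega) (hrI ()))
    obtain ⟨p, hp, hpD, -⟩ := hκ.exists_numerator h hb ev hev l
    refine ⟨w, hw, ?_⟩
    have hwp : t ^ ((l : ℕ) + 1) * w = r * p := hinj (by rw [map_mul, hw, map_mul, hp]; ring)
    obtain ⟨ht0, hto⟩ := h.x_sub_ne_and_order hn (ξ 0)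
    refine IsPoleMap.poleFiltration_mono ?_ (IsPoleMap.mem_of_mul_mem (u := t ^ ((l : ℕ) + 1))
      (e := ((l + 1) * n : ℕ)) (by rw [map_pow]; exact pow_ne_zero _ ht0) ?_
      (hwp ▸ IsPoleMap.mul_mem hr hpD))
    · push_cast
      nlinarith
    · rw [map_pow, HahnSeries.order_pow, hto]
      push_cast
      simp
  choose w hw hwD using hex
  have hsum : φ (r * v + ∑ l, algebraMap K A (e l) * w l) = φ r * (φ v + ∑ l, C (e l) * κ l) := by
    rw [map_add, map_sum, map_mul, mul_add, Finset.mul_sum]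
    congr 1
    refine Finset.sum_congr rfl fun l _ => ?_
    rw [map_mul, hw, AlgHom.commutes, PowerSeries.algebraMap_apply,
      Algebra.algebraMap_self_apply]
    ring
  have hzero : r * v + ∑ l, algebraMap K A (e l) * w l = 0 := by
    by_contra hne
    have hmem : r * v + ∑ l, algebraMap K A (e l) * w l ∈
        IsPoleMap.poleFiltration π (m + n ^ 2 + D + D' : ℕ) := by
      refine Submodule.add_mem _ (IsPoleMap.poleFiltration_mono ?_ (IsPoleMap.mul_mem hr hv))
        (Submodule.sum_mem _ fun l _ => ?_)
      · push_cast; linarith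
      · rw [← Algebra.smul_def]
        exact Submodule.smul_mem _ _ (IsPoleMap.poleFiltration_mono (by push_cast; linarith)
          (hwD l))
    have := h.le_of_X_pow_dvd φ hu hφ hne hmem (N := N) (hsum ▸ Dvd.dvd.mul_left hdvd _)
    omega
  rw [hzero, map_zero] at hsum
  exact (mul_eq_zero.1 hsum.symm).resolve_left fun h0 => hr0 (hinj (by rw [h0, map_zero]))

theorem linearIndependent_coeff (hκ : IsSecantSeq x y φ ξ η a b κ) (h : IsPoleMap n x y π)
    (hn : 1 ≤ n) {x₀ u : K} (hu : u ≠ 0) (hφ : φ x = C x₀ + C u * X) {D : ℕ}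
    (hb : ∀ l, b l ∈ IsPoleMap.poleFiltration π D) (ev : A →ₐ[K] K) (hev : ev x = ξ 0)
    (hξ : ξ 1 ≠ 0) (hevb : ev (b 0) ≠ 0)
    (hI : ∀ N, Module.Finite K (A ⧸ Ideal.span {x - algebraMap K A (ξ 0),
        y - algebraMap K A (η 0)} ^ N) ∧ Module.finrank K (A ⧸ Ideal.span
        {x - algebraMap K A (ξ 0), y - algebraMap K A (η 0)} ^ N) ≤ N)
    {M m N : ℕ} (hN : m + D + (n + 1) * M + 3 * n ^ 2 < N) :
    LinearIndependent K (Sum.elim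
      (fun (s : Fin (n + 1) × Fin (M + 1)) (i : Fin N) =>
        coeff (i : ℕ) (φ (x ^ (s.1 : ℕ) * y ^ (s.2 : ℕ))))
      (fun (l : Fin m) (i : Fin N) => coeff (i : ℕ) (κ l))) := by
  have hinj : Function.Injective φ := by
    refine (injective_iff_map_eq_zero φ).2 fun w hw => ?_
    by_contra hw0
    obtain ⟨D₀, hD₀⟩ := IsPoleMap.exists_mem π w
    have := h.le_of_X_pow_dvd φ hu hφ hw0 hD₀ (N := D₀ + n ^ 2 + 1) (by simp [hw])
    omega
  rw [Fintype.linearIndependent_iff]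
  intro g hg
  rw [Fintype.sum_sum_type] at hg
  simp only [Sum.elim_inl, Sum.elim_inr] at hg
  set v := ∑ s : Fin (n + 1) × Fin (M + 1), g (Sum.inl s) • (x ^ (s.1 : ℕ) * y ^ (s.2 : ℕ)) with hv
  have hvD : v ∈ IsPoleMap.poleFiltration π (n ^ 2 + (n + 1) * M : ℕ) := by
    refine Submodule.sum_mem _ fun s _ => Submodule.smul_mem _ _
      (IsPoleMap.poleFiltration_mono ?_ (h.monomial_mem _ _))
    have h1 : (s.1 : ℕ) * n ≤ n * n := Nat.mul_le_mul_right _ (by omega)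
    have h2 : (s.2 : ℕ) * (n + 1) ≤ M * (n + 1) := Nat.mul_le_mul_right _ (by omega)
    exact_mod_cast (by nlinarith)
  have hφv : φ v = ∑ s : Fin (n + 1) × Fin (M + 1),
      C (g (Sum.inl s)) * φ (x ^ (s.1 : ℕ) * y ^ (s.2 : ℕ)) := by
    rw [hv, map_sum]
    refine Finset.sum_congr rfl fun s _ => ?_
    rw [Algebra.smul_def, map_mul, AlgHom.commutes, PowerSeries.algebraMap_apply,
      Algebra.algebraMap_self_apply]
  have hzero := hκ.eq_zero_of_X_pow_dvd h hn hu hφ hb ev hev hI hvD (fun l => g (Sum.inr l))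
    (N := N) (by omega) <| by
      rw [X_pow_dvd_iff]
      intro i hi
      have := congrFun hg ⟨i, hi⟩
      simpa [hφv, coeff_C_mul] using this
  have hr : ∀ l, g (Sum.inr l) = 0 := by
    classical
    clear_value v
    by_contra! hne
    obtain ⟨l₁, hl₁⟩ := hne
    obtain ⟨l, hl, hmax⟩ := Finset.exists_max_image (Finset.univ.filter fun l => g (Sum.inr l) ≠ 0)
      (fun l : Fin m => (l : ℕ)) ⟨l₁, by simp [hl₁]⟩
    simp only [Finset.mem_filter, Finset.mem_univ, true_and] at hl hmax
    choose p hp _ hpev using fun l => hκ.exists_numerator h hb ev hev l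
    set t := x - algebraMap K A (ξ 0) with ht
    have hevt : ev t = 0 := by simp [ht, hev]
    have : t ^ ((l : ℕ) + 1) * v + ∑ i : Fin m, algebraMap K A (g (Sum.inr i)) *
        (t ^ ((l : ℕ) - i) * p i) = 0 := by
      apply hinj
      rw [map_zero, ← mul_zero (φ (t ^ ((l : ℕ) + 1))), ← hzero, mul_add, map_add, map_mul,
        map_sum φ, Finset.mul_sum]
      congr 1
      refine Finset.sum_congr rfl fun i _ => ?_
      by_cases hi : g (Sum.inr i) = 0
      · simp [hi]
      · have hil : (i : ℕ) ≤ l := hmax i hi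
        rw [map_mul, map_mul, hp, AlgHom.commutes, PowerSeries.algebraMap_apply,
          Algebra.algebraMap_self_apply, ← mul_assoc (φ _) (φ _), ← map_mul, ← pow_add,
          show (l : ℕ) - i + (i + 1) = l + 1 by omega]
        ring
    apply_fun ev at this
    rw [map_add, map_mul, map_pow, hevt, map_sum, map_zero, Finset.sum_eq_single l] at this
    · simp [hpev, hl, hξ, hevb] at this
    · intro i _ hil
      by_cases hi : g (Sum.inr i) = 0
      · simp [hi]
      · have hil' : (i : ℕ) ≤ l := hmax i hi
        have : (i : ℕ) ≠ l := fun h' => hil (Fin.ext h')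
        rw [map_mul, map_mul, map_pow, hevt, zero_pow (by omega)]
        simp
    · simp
  rintro (s | l)
  · have hv0 : v = 0 := by
      apply hinj
      simpa [hr] using hzero
    have hli := h.linearIndependent.comp
      (fun s : Fin (n + 1) × Fin (M + 1) => (s.1, (s.2 : ℕ))) (by
        rintro ⟨i, j⟩ ⟨i', j'⟩ hs
        simpa [Fin.ext_iff] using hs)
    exact Fintype.linearIndependent_iff.1 hli (fun s => g (Sum.inl s)) hv0 s
  · exact hr l

theorem exists_det_coeffMatrix_ne_zero (hκ : IsSecantSeq x y φ ξ η a b κ) (h : IsPoleMap n x y π)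
    (hn : 1 ≤ n) {x₀ u : K} (hu : u ≠ 0) (hφ : φ x = C x₀ + C u * X) {D : ℕ}
    (hb : ∀ l, b l ∈ IsPoleMap.poleFiltration π D) (ev : A →ₐ[K] K) (hev : ev x = ξ 0)
    (hξ : ξ 1 ≠ 0) (hevb : ev (b 0) ≠ 0)
    (hI : ∀ N, Module.Finite K (A ⧸ Ideal.span {x - algebraMap K A (ξ 0),
        y - algebraMap K A (η 0)} ^ N) ∧ Module.finrank K (A ⧸ Ideal.span
        {x - algebraMap K A (ξ 0), y - algebraMap K A (η 0)} ^ N) ≤ N)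
    {M m nf N : ℕ} (hN : m + D + (n + 1) * M + 3 * n ^ 2 < N)
    (hcard : (n + 1) * (M + 1) + nf + m = N) :
    ∃ g : Fin nf → Fin N, ∀ e : ((Fin (n + 1) × Fin (M + 1)) ⊕ Fin nf) ⊕ Fin m ≃ Fin N,
      (coeffMatrix e (Sum.elim (Sum.elim
        (fun s : Fin (n + 1) × Fin (M + 1) => φ (x ^ (s.1 : ℕ) * y ^ (s.2 : ℕ)))
        (fun i => (φ x - C x₀) ^ (g i : ℕ))) (fun l : Fin m => κ l))).det ≠ 0 := by
  have hli := hκ.linearIndependent_coeff h hn hu hφ hb ev hev hξ hevb hI hN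
  have hspan : Submodule.span K (Set.range fun (g i : Fin N) =>
      coeff (i : ℕ) ((φ x - C x₀) ^ (g : ℕ))) = ⊤ := by
    rw [Submodule.eq_top_iff']
    intro v
    have : v = ∑ g : Fin N, (v g * (u ^ (g : ℕ))⁻¹) • fun i : Fin N =>
        coeff (i : ℕ) ((φ x - C x₀) ^ (g : ℕ)) := by
      ext i
      simp only [hφ, add_sub_cancel_left, mul_pow, ← map_pow, coeff_C_mul, coeff_X_pow,
        Finset.sum_apply, Pi.smul_apply, smul_eq_mul]
      rw [Finset.sum_eq_single i]
      · simp [hu]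
      · intro j _ hj
        rw [if_neg (fun h' => hj (Fin.ext h'.symm))]
        simp
      · simp
    rw [this]
    exact Submodule.sum_mem _ fun g _ => Submodule.smul_mem _ _ (Submodule.subset_span ⟨g, rfl⟩)
  obtain ⟨g, hg⟩ := hli.exists_sum_elim_comp _ hspan nf (by simp; omega)
  refine ⟨g, fun e => ?_⟩
  rw [← isUnit_iff_ne_zero, ← Matrix.isUnit_iff_isUnit_det,
    ← Matrix.linearIndependent_cols_iff_isUnit]
  have h1 := (hg.comp (fun s : ((Fin (n + 1) × Fin (M + 1)) ⊕ Fin nf) ⊕ Fin m =>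
    Sum.elim (Sum.elim (fun a => Sum.inl (Sum.inl a)) Sum.inr) (fun l => Sum.inl (Sum.inr l)) s)
    (by rintro ((_ | _) | _) ((_ | _) | _) <;> simp)).map' (LinearMap.funLeft K K e)
    (LinearMap.ker_eq_bot.2 (LinearMap.funLeft_injective_of_surjective _ _ _ e.surjective))
  refine Eq.subst (motive := fun v => LinearIndependent K v) ?_ h1
  ext s i
  rcases s with (s | s) | s <;> rfl

end IsSecantSeq

end

section

open PowerSeries LaurentSeries

theorem PowerSeries.coeff_C_sub_map_C_mul {K : Type*} [Field K] (f g : K⟦X⟧) (κ : K⟦X⟧⟦X⟧) (l : ℕ) :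
    coeff l ((C f - PowerSeries.map C g) * κ) = (f - C (constantCoeff g)) * coeff l κ -
      ∑ j ∈ Finset.range l, C (coeff (j + 1) g) * coeff (l - 1 - j) κ := by
  rw [sub_mul, map_sub, coeff_C_mul, coeff_mul, Finset.Nat.sum_antidiagonal_eq_sum_range_succ
    (fun i j => coeff i (PowerSeries.map C g) * coeff j κ), Finset.sum_range_succ']
  simp only [coeff_map, coeff_zero_eq_constantCoeff, Nat.sub_zero]
  rw [Finset.sum_congr rfl (g := fun j => C (coeff (j + 1) g) * coeff (l - 1 - j) κ)
    (fun j hj => by rw [Nat.sub_sub, add_comm 1 j])]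
  ring

theorem IsPoleMap.coeff_secantY_mem {K A : Type*} [Field K] [CommRing A] [Algebra K A] {n : ℕ}
    {x y : A} {π : A →ₐ[K] K⸨X⸩} (h : IsPoleMap n x y π) {S : Finset (ℕ × ℕ)} {c : ℕ × ℕ → K}
    (hc : IsFlexCurve n S c) (η : K⟦X⟧) (l : ℕ) :
    coeff l (secantY S c (C x) (C y) (PowerSeries.map (algebraMap K A) η)) ∈
      IsPoleMap.poleFiltration π (2 * n * (n + 1) : ℕ) := by
  simp only [secantY, map_sum, Finset.mul_sum]
  refine Submodule.sum_mem _ fun m hm => Submodule.sum_mem _ fun p hp => ?_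
  have hp := Finset.mem_range.1 hp
  rw [← map_pow (PowerSeries.map (algebraMap K A)), ← map_pow C, ← map_pow C,
    PowerSeries.algebraMap_apply, mul_assoc, mul_assoc, coeff_C_mul, coeff_C_mul, coeff_C_mul,
    coeff_map, ← mul_assoc (x ^ m.1), mul_comm _ (algebraMap K A _), ← Algebra.smul_def,
    ← Algebra.smul_def]
  refine Submodule.smul_mem _ _ (Submodule.smul_mem _ _ (IsPoleMap.poleFiltration_mono ?_
    (h.monomial_mem _ _)))
  have h1 := hc.le_succ hm
  have h2 : m.2 ≤ n := by
    by_cases h' : m = (n + 1, 0)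
    · simp [h']
    · have := hc.le m hm h'
      omega
  have h3 : m.1 * n ≤ (n + 1) * n := Nat.mul_le_mul_right _ (by omega)
  have h4 : p * (n + 1) ≤ n * (n + 1) := Nat.mul_le_mul_right _ (by omega)
  exact_mod_cast (by nlinarith)

theorem IsFlexCurve.exists_det_coeffMatrix_ne_zero {K : Type*} [Field K] {n : ℕ}
    {S : Finset (ℕ × ℕ)} {c : ℕ × ℕ → K} (hc : IsFlexCurve n S c) {x₁ y₁ ξ η : K⟦X⟧} {x₀ u : K}
    (hu : u ≠ 0) (hx₁ : x₁ = C x₀ + C u * X)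
    (h₁ : MvPolynomial.aeval ![x₁, y₁] (planeCurve S c) = 0)
    (h₂ : MvPolynomial.aeval ![constantCoeff ξ, constantCoeff η] (planeCurve S c) = 0)
    (hs : MvPolynomial.aeval ![constantCoeff ξ, constantCoeff η]
      (MvPolynomial.pderiv 1 (planeCurve S c)) ≠ 0) (hξ : coeff 1 ξ ≠ 0) {κ : K⟦X⟧⟦X⟧}
    (hκx : (C x₁ - PowerSeries.map C ξ) * κ = secantY S c (C x₁) (C y₁) (PowerSeries.map C η))
    (hκy : (C y₁ - PowerSeries.map C η) * κ =
      -secantX S c (C x₁) (PowerSeries.map C ξ) (PowerSeries.map C η))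
    {M m nf N : ℕ} (hN : m + 2 * n * (n + 1) + (n + 1) * M + 3 * n ^ 2 < N)
    (hcard : (n + 1) * (M + 1) + nf + m = N) :
    ∃ g : Fin nf → Fin N, ∀ e : ((Fin (n + 1) × Fin (M + 1)) ⊕ Fin nf) ⊕ Fin m ≃ Fin N,
      (coeffMatrix e (Sum.elim (Sum.elim
        (fun s : Fin (n + 1) × Fin (M + 1) => x₁ ^ (s.1 : ℕ) * y₁ ^ (s.2 : ℕ))
        (fun i => (x₁ - C x₀) ^ (g i : ℕ))) (fun l : Fin m => coeff (l : ℕ) κ))).det ≠ 0 := by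
  obtain ⟨π, -, h, -⟩ := hc.exists_isPoleMap
  set A := PlaneCoordRing S c
  set φ : A →ₐ[K] K⟦X⟧ := PlaneCoordRing.lift x₁ y₁ h₁ with hφ
  have hφx : φ (PlaneCoordRing.x S c) = x₁ := PlaneCoordRing.lift_x _ _ _
  have hφy : φ (PlaneCoordRing.y S c) = y₁ := PlaneCoordRing.lift_y _ _ _
  have hφC (f : K⟦X⟧) : PowerSeries.map (φ : A →+* K⟦X⟧) (PowerSeries.map (algebraMap K A) f) =
      PowerSeries.map C f := by
    ext l : 1
    simp
  have hφalg (r : K) : PowerSeries.map (φ : A →+* K⟦X⟧) (algebraMap K A⟦X⟧ r) =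
      algebraMap K K⟦X⟧⟦X⟧ r := by
    simp [PowerSeries.algebraMap_apply]
  have hκ : IsSecantSeq (PlaneCoordRing.x S c) (PlaneCoordRing.y S c) φ (fun l => coeff l ξ)
      (fun l => coeff l η)
      (fun l => coeff l (-secantX S c (C (PlaneCoordRing.x S c))
        (PowerSeries.map (algebraMap K A) ξ) (PowerSeries.map (algebraMap K A) η)))
      (fun l => coeff l (secantY S c (C (PlaneCoordRing.x S c)) (C (PlaneCoordRing.y S c))
        (PowerSeries.map (algebraMap K A) η))) (fun l => coeff l κ) := by
    constructor
    · intro l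
      have := congrArg (coeff l) hκx
      rw [coeff_C_sub_map_C_mul, sub_eq_iff_eq_add'] at this
      rw [map_sub, hφx, AlgHom.commutes, PowerSeries.algebraMap_apply,
        Algebra.algebraMap_self_apply, coeff_zero_eq_constantCoeff_apply, this]
      congr 1
      rw [← AlgHom.coe_toRingHom, ← coeff_map, map_secantY S c _ hφalg, hφC, map_C, map_C,
        AlgHom.coe_toRingHom, hφx, hφy]
    · intro l
      have := congrArg (coeff l) hκy
      rw [coeff_C_sub_map_C_mul, sub_eq_iff_eq_add'] at this
      rw [map_sub, hφy, AlgHom.commutes, PowerSeries.algebraMap_apply,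
        Algebra.algebraMap_self_apply, coeff_zero_eq_constantCoeff_apply, this]
      congr 1
      rw [← AlgHom.coe_toRingHom, ← coeff_map, map_neg (PowerSeries.map _), map_secantX S c _ hφalg, hφC, hφC, map_C,
        AlgHom.coe_toRingHom, hφx]
  let ev : A →ₐ[K] K := PlaneCoordRing.lift (constantCoeff ξ) (constantCoeff η) h₂
  have hevx : ev (PlaneCoordRing.x S c) = constantCoeff ξ := PlaneCoordRing.lift_x _ _ _
  have hevy : ev (PlaneCoordRing.y S c) = constantCoeff η := PlaneCoordRing.lift_y _ _ _
  have := hκ.exists_det_coeffMatrix_ne_zero h hc.pos hu (hφx.trans hx₁)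
    (h.coeff_secantY_mem hc η) ev (by simp [hevx]) hξ ?_ ?_ hN hcard
  · simpa only [map_mul, map_pow, hφx, hφy] using this
  · rw [coeff_zero_eq_constantCoeff_apply, ← AlgHom.coe_toRingHom, ← RingHom.comp_apply,
      map_secantY S c _ (fun r => by simp [PowerSeries.algebraMap_apply])]
    simp only [RingHom.comp_apply, constantCoeff_C, AlgHom.coe_toRingHom, hevx, hevy]
    rw [← coeff_zero_eq_constantCoeff_apply (PowerSeries.map _ η), coeff_map, AlgHom.commutes,
      Algebra.algebraMap_self_apply, coeff_zero_eq_constantCoeff_apply, secantY_self]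
    exact hs
  · intro N
    have key : ∀ a b, a = constantCoeff ξ → b = constantCoeff η →
        Module.Finite K (A ⧸ PlaneCoordRing.pointIdeal S c a b ^ N) ∧
          Module.finrank K (A ⧸ PlaneCoordRing.pointIdeal S c a b ^ N) ≤ N := by
      rintro _ _ rfl rfl
      exact PlaneCoordRing.finrank_quotient_pow_le h₂ (Or.inr hs) N
    exact key _ _ (coeff_zero_eq_constantCoeff_apply _) (coeff_zero_eq_constantCoeff_apply _)

end

section

open PowerSeries

section Twist

variable (k K : Type*) [Field k] [Fintype k] [Field K] [Algebra k K]

/-- The coefficientwise Frobenius, with values in power series in a second variable. -/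
noncomputable def frobTwist : K⟦X⟧ →+* K⟦X⟧⟦X⟧ :=
  (PowerSeries.map C).comp (PowerSeries.map (FiniteField.frobeniusAlgHom k K : K →+* K))

variable {k K}

theorem frobTwist_apply (f : K⟦X⟧) : frobTwist k K f = PowerSeries.map C
    (PowerSeries.map (FiniteField.frobeniusAlgHom k K : K →+* K) f) :=
  rfl

theorem frobTwist_algebraMap (r : k) :
    frobTwist k K (algebraMap k K⟦X⟧ r) = algebraMap k K⟦X⟧⟦X⟧ r := by
  simp [frobTwist, PowerSeries.algebraMap_apply]

theorem constantCoeff_map_frobenius (f : K⟦X⟧) :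
    constantCoeff (PowerSeries.map (FiniteField.frobeniusAlgHom k K : K →+* K) f) =
      constantCoeff f ^ Fintype.card k := by
  rw [← coeff_zero_eq_constantCoeff_apply, coeff_map, coeff_zero_eq_constantCoeff_apply]
  rfl

theorem constantCoeff_frobTwist (f : K⟦X⟧) :
    constantCoeff (frobTwist k K f) = C (constantCoeff f ^ Fintype.card k) := by
  rw [frobTwist_apply, ← coeff_zero_eq_constantCoeff_apply, coeff_map,
    coeff_zero_eq_constantCoeff_apply, constantCoeff_map_frobenius]

theorem frobTwist_mem {O : Subring K} {τ f : K⟦X⟧} {a b : ℕ} (hf : f ∈ approxSubring O τ b) :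
    frobTwist k K f ∈ approxSubring (approxSubring O τ a) (PowerSeries.map C
      (PowerSeries.map (FiniteField.frobeniusAlgHom k K : K →+* K) τ)) b :=
  approxSubring.map_mem _ (fun _ hs => approxSubring.C_mem hs)
    (approxSubring.map_mem _ (fun _ hs => Subring.pow_mem _ hs _) hf)

end Twist

/-- Power series expansions of the generic point `(x, y)` of a plane curve, and of the slope of the
secant joining it to its Frobenius twist. -/
structure SecantData {k K : Type*} [Field k] [Fintype k] [Field K] [Algebra k K]
    (S : Finset (ℕ × ℕ)) (c : ℕ × ℕ → k) (x y : K) where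
  x₁ : K⟦X⟧
  y₁ : K⟦X⟧
  κ : K⟦X⟧⟦X⟧
  x₁_eq : x₁ = C x + C (MvPolynomial.aeval ![x, y] (MvPolynomial.pderiv 1 (planeCurve S c))) * X
  constantCoeff_y₁ : constantCoeff y₁ = y
  coeff_one_y₁ : coeff 1 y₁ = -MvPolynomial.aeval ![x, y] (MvPolynomial.pderiv 0 (planeCurve S c))
  aeval_eq_zero : MvPolynomial.aeval ![x₁, y₁] (planeCurve S c) = 0
  x_mul_κ : (C x₁ - frobTwist k K x₁) * κ = secantY S c (C x₁) (C y₁) (frobTwist k K y₁)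
  y_mul_κ : (C y₁ - frobTwist k K y₁) * κ =
    -secantX S c (C x₁) (frobTwist k K x₁) (frobTwist k K y₁)

namespace SecantData

variable {k K : Type*} [Field k] [Fintype k] [Field K] [Algebra k K] {S : Finset (ℕ × ℕ)}
  {c : ℕ × ℕ → k} {x y : K}

theorem isUnit_C_sub_frobTwist {f : K⟦X⟧}
    (hf : constantCoeff f ^ Fintype.card k ≠ constantCoeff f) : IsUnit (C f - frobTwist k K f) := by
  rw [isUnit_iff_constantCoeff, map_sub, constantCoeff_C, constantCoeff_frobTwist,
    isUnit_iff_constantCoeff, map_sub, constantCoeff_C, isUnit_iff_ne_zero]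
  exact sub_ne_zero.2 hf.symm

theorem nonempty (hxy : MvPolynomial.aeval ![x, y] (planeCurve S c) = 0)
    (hu : MvPolynomial.aeval ![x, y] (MvPolynomial.pderiv 1 (planeCurve S c)) ≠ 0)
    (hx : x ^ Fintype.card k ≠ x) : Nonempty (SecantData S c x y) := by
  obtain ⟨y₁, hy₁, h0, hy₁'⟩ := exists_branch _ hxy hu
  set x₁ := C x + C (MvPolynomial.aeval ![x, y] (MvPolynomial.pderiv 1 (planeCurve S c))) * X
    with hx₁
  obtain ⟨U, hU⟩ := isUnit_C_sub_frobTwist (k := k) (f := x₁) (by simpa [hx₁] using hx)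
  have hC := MvPolynomial.map_aeval_pair (C (R := K⟦X⟧))
    (fun a => (PowerSeries.algebraMap_apply (A := K⟦X⟧) (r := a)).symm) x₁ y₁ (planeCurve S c)
  have hT := MvPolynomial.map_aeval_pair (frobTwist k K) frobTwist_algebraMap x₁ y₁
    (planeCurve S c)
  rw [h0, map_zero] at hC hT
  have h1 := secantX_mul_add_secantY_mul S c (C x₁) (C y₁) (frobTwist k K x₁) (frobTwist k K y₁)
  rw [← hC, ← hT, sub_zero, ← hU] at h1
  refine ⟨⟨x₁, y₁, ↑U⁻¹ * secantY S c (C x₁) (C y₁) (frobTwist k K y₁), hx₁, hy₁, hy₁', h0, ?_, ?_⟩⟩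
  · rw [← hU, Units.mul_inv_cancel_left]
  · apply U.isUnit.mul_left_cancel
    rw [← mul_assoc, mul_comm (U : K⟦X⟧⟦X⟧), mul_assoc, Units.mul_inv_cancel_left]
    linear_combination h1

variable (d : SecantData S c x y)

theorem constantCoeff_x₁ : constantCoeff d.x₁ = x := by
  rw [d.x₁_eq, map_add, constantCoeff_C, map_mul, constantCoeff_X, mul_zero, add_zero]

theorem coeff_one_x₁ : coeff 1 d.x₁ =
    MvPolynomial.aeval ![x, y] (MvPolynomial.pderiv 1 (planeCurve S c)) := by
  rw [d.x₁_eq, map_add, coeff_C_mul, coeff_one_X, mul_one, coeff_C, if_neg one_ne_zero, zero_add]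

/-- The columns of the determinant. -/
noncomputable def column (n M : ℕ) {N nf : ℕ} (g : Fin nf → Fin N) :
    (Fin (n + 1) × Fin (M + 1)) ⊕ Fin nf → K⟦X⟧ :=
  Sum.elim (fun s => d.x₁ ^ (s.1 : ℕ) * d.y₁ ^ (s.2 : ℕ)) fun i => (d.x₁ - C x) ^ (g i : ℕ)

/-- The determinant. -/
noncomputable def det {n M N nf m : ℕ} (g : Fin nf → Fin N)
    (e : ((Fin (n + 1) × Fin (M + 1)) ⊕ Fin nf) ⊕ Fin m ≃ Fin N) : K :=
  (coeffMatrix e (Sum.elim (d.column n M g) fun l : Fin m => coeff (l : ℕ) d.κ)).det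

theorem exists_det_ne_zero {n : ℕ} (hc : IsFlexCurve n S c)
    (hu : MvPolynomial.aeval ![x, y] (MvPolynomial.pderiv 1 (planeCurve S c)) ≠ 0) {M m nf N : ℕ}
    (hN : m + 2 * n * (n + 1) + (n + 1) * M + 3 * n ^ 2 < N)
    (hcard : (n + 1) * (M + 1) + nf + m = N) :
    ∃ g : Fin nf → Fin N, ∀ e : ((Fin (n + 1) × Fin (M + 1)) ⊕ Fin nf) ⊕ Fin m ≃ Fin N,
      d.det g e ≠ 0 := by
  set Fr : K →+* K := ((FiniteField.frobeniusAlgHom k K : K →ₐ[k] K) : K →+* K) with hFr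
  have hFralg (a : k) : Fr (algebraMap k K a) = algebraMap k K a :=
    (FiniteField.frobeniusAlgHom k K).commutes a
  have hplane : planeCurve S (fun m => algebraMap k K (c m)) =
      MvPolynomial.map (algebraMap k K) (planeCurve S c) := by
    simp [planeCurve]
  have hmap (R : Type _) [CommRing R] [Algebra k R] [Algebra K R] [IsScalarTower k K R]
      (a b : R) (p : MvPolynomial (Fin 2) k) : MvPolynomial.aeval ![a, b]
        (MvPolynomial.map (algebraMap k K) p) = MvPolynomial.aeval ![a, b] p :=
    MvPolynomial.aeval_map_algebraMap _ _ _
  have hconst (p : MvPolynomial (Fin 2) k) :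
      MvPolynomial.aeval ![constantCoeff (PowerSeries.map Fr d.x₁),
        constantCoeff (PowerSeries.map Fr d.y₁)] p = Fr (MvPolynomial.aeval ![x, y] p) := by
    rw [constantCoeff_map_frobenius, constantCoeff_map_frobenius, d.constantCoeff_x₁,
      d.constantCoeff_y₁, MvPolynomial.map_aeval_pair Fr hFralg]
    rfl
  have hxy : MvPolynomial.aeval ![x, y] (planeCurve S c) = 0 := by
    have := congrArg constantCoeff d.aeval_eq_zero
    rwa [MvPolynomial.aeval_pair_constantCoeff, map_zero, d.constantCoeff_x₁,
      d.constantCoeff_y₁] at this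
  refine IsFlexCurve.exists_det_coeffMatrix_ne_zero (hc.map (algebraMap k K)) hu d.x₁_eq
    (ξ := PowerSeries.map Fr d.x₁) (η := PowerSeries.map Fr d.y₁) (κ := d.κ) ?_ ?_ ?_ ?_ ?_ ?_
    hN hcard
  · rw [hplane, hmap, d.aeval_eq_zero]
  · rw [hplane, hmap, hconst, hxy, map_zero]
  · rw [hplane, MvPolynomial.pderiv_map, hmap, hconst]
    exact (map_ne_zero Fr).2 hu
  · rw [coeff_map, d.coeff_one_x₁]
    exact (map_ne_zero Fr).2 hu
  · rw [secantY_tower]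
    exact d.x_mul_κ
  · rw [secantX_tower]
    exact d.y_mul_κ

end SecantData

end

section

open PowerSeries

namespace approxSubring

theorem algebraMap_mem {k R : Type*} [CommRing k] [CommRing R] [Algebra k R] {S : Subring R}
    (hS : ∀ a : k, algebraMap k R a ∈ S) (τ : R⟦X⟧) (m : ℕ) (a : k) :
    algebraMap k R⟦X⟧ a ∈ approxSubring S τ m := by
  rw [PowerSeries.algebraMap_apply]
  exact C_mem (hS a)

end approxSubring

section Secant

variable {k R : Type*} [Field k] [CommRing R] [Algebra k R] (S : Finset (ℕ × ℕ)) (c : ℕ × ℕ → k)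
  {T : Subring R}

theorem secantX_mem (hT : ∀ a, algebraMap k R a ∈ T) {x₁ x₂ y₂ : R} (hx₁ : x₁ ∈ T) (hx₂ : x₂ ∈ T)
    (hy₂ : y₂ ∈ T) : secantX S c x₁ x₂ y₂ ∈ T :=
  Subring.sum_mem _ fun _ _ => T.mul_mem (T.mul_mem (hT _) (Subring.sum_mem _ fun _ _ =>
    T.mul_mem (T.pow_mem hx₁ _) (T.pow_mem hx₂ _))) (T.pow_mem hy₂ _)

theorem secantY_mem (hT : ∀ a, algebraMap k R a ∈ T) {x₁ y₁ y₂ : R} (hx₁ : x₁ ∈ T) (hy₁ : y₁ ∈ T)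
    (hy₂ : y₂ ∈ T) : secantY S c x₁ y₁ y₂ ∈ T :=
  Subring.sum_mem _ fun _ _ => T.mul_mem (T.mul_mem (hT _) (T.pow_mem hx₁ _))
    (Subring.sum_mem _ fun _ _ => T.mul_mem (T.pow_mem hy₁ _) (T.pow_mem hy₂ _))

end Secant

namespace SecantData

variable {k K : Type*} [Field k] [Fintype k] [Field K] [Algebra k K] {S : Finset (ℕ × ℕ)}
  {c : ℕ × ℕ → k} {x y : K} (d : SecantData S c x y) {n M N nf m : ℕ} (g : Fin nf → Fin N)
  (e : ((Fin (n + 1) × Fin (M + 1)) ⊕ Fin nf) ⊕ Fin m ≃ Fin N)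

theorem column_mem {O : Subring K} (hx : x ∈ O) {τ : K⟦X⟧} (hx₁ : d.x₁ ∈ approxSubring O τ N)
    (hy₁ : d.y₁ ∈ approxSubring O τ N) (i) : d.column n M g i ∈ approxSubring O τ N := by
  rcases i with i | i
  · exact Subring.mul_mem _ (Subring.pow_mem _ hx₁ _) (Subring.pow_mem _ hy₁ _)
  · exact Subring.pow_mem _ (Subring.sub_mem _ hx₁ (approxSubring.C_mem hx)) _

/-- In an affine chart the determinant is divisible by powers of the local parameter. -/
theorem pow_mul_det_eq {O : Subring K} (hx : x ∈ O) {τ : K⟦X⟧} (hτ : constantCoeff τ = 0)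
    (hmem : ∀ m, d.x₁ ∈ approxSubring O τ m ∧ d.y₁ ∈ approxSubring O τ m) {f : K⟦X⟧}
    (hf : ∀ m, f ∈ approxSubring O τ m) {z : K} (hfz : constantCoeff f = z) (hzO : z ∈ O)
    (hz : z ^ Fintype.card k ≠ z)
    (hκ : (C f - frobTwist k K f) * d.κ ∈ approxSubring (approxSubring O τ N)
      (map C (map (FiniteField.frobeniusAlgHom k K : K →+* K) τ)) m) :
    ∃ o ∈ O, (z - z ^ Fintype.card k) ^ (m * N) * d.det g e =
      coeff 1 τ ^ (∑ i ∈ Finset.range N, i + Fintype.card k * ∑ i ∈ Finset.range m, i) * o := by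
  have hzq : z ^ Fintype.card k ∈ O := O.pow_mem hzO _
  obtain ⟨o, ho, h⟩ := exists_local_det_eq e (O := O) (τ₁ := τ)
    (τ₂ := map (FiniteField.frobeniusAlgHom k K : K →+* K) τ) (A := f - C (z ^ Fintype.card k))
    (ω := frobTwist k K f - C (C (z ^ Fintype.card k))) (κ' := d.κ) (κ := d.κ) hτ
    (by rw [constantCoeff_map_frobenius, hτ, zero_pow Fintype.card_ne_zero])
    (Subring.sub_mem _ (hf N) (approxSubring.C_mem hzq))
    (by rw [map_sub, hfz, constantCoeff_C]; exact sub_ne_zero.2 hz.symm)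
    (Subring.sub_mem _ (frobTwist_mem (hf m))
      (approxSubring.C_mem (approxSubring.C_mem hzq)))
    (by rw [map_sub, constantCoeff_frobTwist, constantCoeff_C, hfz, sub_self])
    (by rwa [map_sub, sub_sub_sub_cancel_right])
    (d.column n M g) 1 (fun _ => 0) (by simp) (fun _ => 1) (G := 1) (Subring.one_mem _)
    (fun i => by
      rw [map_one, one_mul, one_mul]
      exact d.column_mem g hx (hmem N).1 (hmem N).2 i)
  refine ⟨o, ho, ?_⟩
  simp only [map_one, one_mul, one_pow, Finset.prod_const_one, mul_one, map_sub, hfz,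
    constantCoeff_C] at h
  rw [pow_mul, det, h, coeff_map, pow_add, pow_mul]
  rfl

variable {g e}

theorem x_pow_mul_det_eq {O : Subring K} (hO : ∀ a, algebraMap k K a ∈ O) (hx : x ∈ O)
    (hxq : x ^ Fintype.card k ≠ x) {τ : K⟦X⟧} (hτ : constantCoeff τ = 0)
    (hmem : ∀ m, d.x₁ ∈ approxSubring O τ m ∧ d.y₁ ∈ approxSubring O τ m) :
    ∃ o ∈ O, (x - x ^ Fintype.card k) ^ (m * N) * d.det g e =
      coeff 1 τ ^ (∑ i ∈ Finset.range N, i + Fintype.card k * ∑ i ∈ Finset.range m, i) * o := by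
  refine d.pow_mul_det_eq g e hx hτ hmem (fun m => (hmem m).1) d.constantCoeff_x₁ hx hxq ?_
  rw [d.x_mul_κ]
  exact secantY_mem S c (approxSubring.algebraMap_mem (approxSubring.algebraMap_mem hO τ N) _ m)
    (approxSubring.C_mem (hmem N).1) (approxSubring.C_mem (hmem N).2) (frobTwist_mem (hmem m).2)

theorem y_pow_mul_det_eq {O : Subring K} (hO : ∀ a, algebraMap k K a ∈ O) (hx : x ∈ O) (hy : y ∈ O)
    (hyq : y ^ Fintype.card k ≠ y) {τ : K⟦X⟧} (hτ : constantCoeff τ = 0)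
    (hmem : ∀ m, d.x₁ ∈ approxSubring O τ m ∧ d.y₁ ∈ approxSubring O τ m) :
    ∃ o ∈ O, (y - y ^ Fintype.card k) ^ (m * N) * d.det g e =
      coeff 1 τ ^ (∑ i ∈ Finset.range N, i + Fintype.card k * ∑ i ∈ Finset.range m, i) * o := by
  refine d.pow_mul_det_eq g e hx hτ hmem (fun m => (hmem m).2) d.constantCoeff_y₁ hy hyq ?_
  rw [d.y_mul_κ]
  exact Subring.neg_mem _ (secantX_mem S c
    (approxSubring.algebraMap_mem (approxSubring.algebraMap_mem hO τ N) _ m)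
    (approxSubring.C_mem (hmem N).1) (frobTwist_mem (hmem m).1) (frobTwist_mem (hmem m).2))

end SecantData

end

section

open PowerSeries

theorem FiniteField.prod_sub_algebraMap {k R : Type*} [Field k] [Fintype k] [CommRing R]
    [Algebra k R] (z : R) : ∏ a : k, (z - algebraMap k R a) = z ^ Fintype.card k - z := by
  have hq : 1 < Fintype.card k := Fintype.one_lt_card
  have h := Polynomial.prod_multiset_X_sub_C_of_monic_of_roots_card_eq
    (p := (Polynomial.X ^ Fintype.card k - Polynomial.X : Polynomial k))
    (Polynomial.monic_X_pow_sub (by simpa using hq)) (by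
      rw [FiniteField.roots_X_pow_card_sub_X, FiniteField.X_pow_card_sub_X_natDegree_eq k hq]
      rfl)
  rw [FiniteField.roots_X_pow_card_sub_X] at h
  have h' := congrArg (Polynomial.aeval z) h
  rw [map_multiset_prod, Multiset.map_map, map_sub, map_pow, Polynomial.aeval_X] at h'
  rw [← h', Finset.prod]
  congr 1
  refine Multiset.map_congr rfl fun a _ => ?_
  rw [Function.comp_apply, map_sub, Polynomial.aeval_X, Polynomial.aeval_C]

theorem ValuationSubring.exists_valuation_sub_algebraMap_lt_one {k K : Type*} [Field k] [Fintype k]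
    [Field K] [Algebra k K] (O : ValuationSubring K) {z : K}
    (hz : O.valuation (z - z ^ Fintype.card k) < 1) :
    ∃ s : k, O.valuation (z - algebraMap k K s) < 1 ∧
      O.valuation (z - z ^ Fintype.card k) = O.valuation (z - algebraMap k K s) := by
  obtain ⟨s, hs⟩ : ∃ s : k, O.valuation (z - algebraMap k K s) < 1 := by
    by_contra! hall
    rw [O.valuation.map_sub_swap, ← FiniteField.prod_sub_algebraMap (k := k), map_prod] at hz
    exact hz.not_ge (Finset.one_le_prod' fun a _ => hall a)
  refine ⟨s, hs, ?_⟩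
  have : z - z ^ Fintype.card k =
      (z - algebraMap k K s) - (z - algebraMap k K s) ^ Fintype.card k := by
    have h1 := map_sub (FiniteField.frobeniusAlgHom k K) z (algebraMap k K s)
    rw [(FiniteField.frobeniusAlgHom k K).commutes] at h1
    have h2 : (z - algebraMap k K s) ^ Fintype.card k = z ^ Fintype.card k - algebraMap k K s := h1
    rw [h2]
    ring
  by_cases h0 : z - algebraMap k K s = 0
  · rw [this, h0, zero_pow Fintype.card_ne_zero, sub_zero]
  rw [this, O.valuation.map_sub_eq_of_lt_left]
  rw [map_pow]
  exact pow_lt_self_of_lt_one₀ (zero_lt_iff.2 (by simpa using h0)) hs Fintype.one_lt_card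

theorem ValuationSubring.valuation_le_of_mem_pow {A K : Type*} [CommRing A] [Field K]
    {O : ValuationSubring K} (φ : A →+* K) (hφ : ∀ a, φ a ∈ O) {I : Ideal A} {γ : O.ValueGroup}
    (hI : ∀ u ∈ I, O.valuation (φ u) ≤ γ) {N : ℕ} {r : A} (hr : r ∈ I ^ N) :
    O.valuation (φ r) ≤ γ ^ N := by
  induction N generalizing r with
  | zero => simpa using (O.valuation_le_one_iff _).2 (hφ r)
  | succ N ih =>
    rw [pow_succ] at hr
    refine Submodule.mul_induction_on hr (fun a ha b hb => ?_) fun a b ha hb => ?_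
    · rw [map_mul, map_mul, pow_succ]
      exact mul_le_mul' (ih ha) (hI b hb)
    · rw [map_add]
      exact O.valuation.map_add_le ha hb

theorem PlaneCoordRing.valuation_le_of_mem_pointIdeal {k K : Type*} [Field k] [Field K]
    [Algebra k K] {S : Finset (ℕ × ℕ)} {c : ℕ × ℕ → k} {O : ValuationSubring K}
    (φ : PlaneCoordRing S c →ₐ[k] K) (hφ : ∀ a, φ a ∈ O) {s t : k} {γ : O.ValueGroup}
    (hx : O.valuation (φ (x S c) - algebraMap k K s) ≤ γ)
    (hy : O.valuation (φ (y S c) - algebraMap k K t) ≤ γ) (u : PlaneCoordRing S c)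
    (hu : u ∈ pointIdeal S c s t) : O.valuation (φ u) ≤ γ := by
  refine Submodule.span_induction ?_ (by simp) ?_ ?_ hu
  · rintro z (rfl | rfl)
    · simpa using hx
    · simpa using hy
  · intro a b _ _ ha hb
    rw [map_add]
    exact O.valuation.map_add_le ha hb
  · intro a b _ hb
    rw [smul_eq_mul, map_mul, map_mul]
    exact (mul_le_mul' ((O.valuation_le_one_iff _).2 (hφ a)) hb).trans (one_mul γ).le

theorem PlaneCoordRing.algHom_mem {k K : Type*} [Field k] [Field K] [Algebra k K]
    {S : Finset (ℕ × ℕ)} {c : ℕ × ℕ → k} {O : Subring K} (hO : ∀ a, algebraMap k K a ∈ O)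
    (φ : PlaneCoordRing S c →ₐ[k] K) (hx : φ (x S c) ∈ O) (hy : φ (y S c) ∈ O)
    (a : PlaneCoordRing S c) : φ a ∈ O := by
  obtain ⟨p, rfl⟩ := exists_aeval a
  have : φ (MvPolynomial.aeval ![x S c, y S c] p) =
      MvPolynomial.aeval ![φ (x S c), φ (y S c)] p :=
    MvPolynomial.map_aeval_pair (φ : PlaneCoordRing S c →+* K) (fun r => φ.commutes r) _ _ p
  rw [this]
  refine MvPolynomial.aeval_mem_subring hO (fun i => ?_) p
  fin_cases i <;> assumption

namespace SecantData

variable {k K : Type*} [Field k] [Fintype k] [Field K] [Algebra k K] {S : Finset (ℕ × ℕ)}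
  {c : ℕ × ℕ → k} {x y : K} (φ : PlaneCoordRing S c →ₐ[k] K)
  (d : SecantData S c x y) {n M N nf m : ℕ}
  {g : Fin nf → Fin N} {e : ((Fin (n + 1) × Fin (M + 1)) ⊕ Fin nf) ⊕ Fin m ≃ Fin N}

theorem valuation_mul_det_le_one (hφx : φ (PlaneCoordRing.x S c) = x)
    (hφy : φ (PlaneCoordRing.y S c) = y) {O : ValuationSubring K} (hO : ∀ a, algebraMap k K a ∈ O)
    (hx : x ∈ O) (hy : y ∈ O)
    (hxq : x ^ Fintype.card k ≠ x)
    (hyq : y ^ Fintype.card k ≠ y)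
    (hu : MvPolynomial.aeval ![x, y]
      (MvPolynomial.pderiv 1 (planeCurve S c)) ≠ 0)
    (hmN : m * N ≤ ∑ i ∈ Finset.range N, i + Fintype.card k * ∑ i ∈ Finset.range m, i)
    {r : PlaneCoordRing S c}
    (hr : ∀ s t : k, MvPolynomial.aeval ![s, t] (planeCurve S c) = 0 →
      (MvPolynomial.aeval ![s, t] (MvPolynomial.pderiv 0 (planeCurve S c)) ≠ 0 ∨
        MvPolynomial.aeval ![s, t] (MvPolynomial.pderiv 1 (planeCurve S c)) ≠ 0) →
      r ∈ PlaneCoordRing.pointIdeal S c s t ^ (m * N)) :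
    O.valuation (φ r * d.det g e) ≤ 1 := by
  have hφ := PlaneCoordRing.algHom_mem (O := O.toSubring) hO φ (hφx ▸ hx) (hφy ▸ hy)
  set v := O.valuation with hv
  set p := planeCurve S c with hp
  set E := ∑ i ∈ Finset.range N, i + Fintype.card k * ∑ i ∈ Finset.range m, i with hE
  have hrO : v (φ r) ≤ 1 := (O.valuation_le_one_iff _).2 (hφ r)
  have hval {α π : K} (h : ∃ o ∈ O.toSubring, α ^ (m * N) * d.det g e = π ^ E * o) :
      v α ^ (m * N) * v (d.det g e) ≤ v π ^ E := by
    obtain ⟨o, ho, h⟩ := h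
    have := congrArg v h
    rw [map_mul, map_mul, map_pow, map_pow] at this
    rw [this]
    exact (mul_le_mul' le_rfl ((O.valuation_le_one_iff _).2 ho)).trans (mul_one _).le
  obtain ⟨τ, hτ0, hτ1, hτ⟩ := exists_chart hO p d.aeval_eq_zero d.constantCoeff_x₁
    d.constantCoeff_y₁ hx hy (Or.inr hu) 1 (by rw [one_mul]; exact d.coeff_one_x₁)
    (by rw [neg_one_mul]; exact d.coeff_one_y₁)
  have hX := hval (d.x_pow_mul_det_eq (g := g) (e := e) hO hx hxq hτ0 hτ)
  have hY := hval (d.y_pow_mul_det_eq (g := g) (e := e) hO hx hy hyq hτ0 hτ)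
  rw [hτ1, map_one, one_pow] at hX hY
  have hmemq {z : K} (hz : z ∈ O) : v (z - z ^ Fintype.card k) ≤ 1 :=
    (O.valuation_le_one_iff _).2 (O.toSubring.sub_mem hz (O.toSubring.pow_mem hz _))
  have htriv (h : v (d.det g e) ≤ 1) : v (φ r * d.det g e) ≤ 1 := by
    rw [map_mul]
    exact (mul_le_mul' hrO h).trans (one_mul _).le
  rcases (hmemq hx).lt_or_eq with hxlt | hxeq
  swap
  · rw [hxeq, one_pow, one_mul] at hX
    exact htriv hX
  rcases (hmemq hy).lt_or_eq with hylt | hyeq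
  swap
  · rw [hyeq, one_pow, one_mul] at hY
    exact htriv hY
  obtain ⟨s, hs, hxs⟩ := O.exists_valuation_sub_algebraMap_lt_one hxlt
  obtain ⟨t, ht, hyt⟩ := O.exists_valuation_sub_algebraMap_lt_one hylt
  have hpxy : MvPolynomial.aeval ![x, y] p = 0 := by
    have := congrArg constantCoeff d.aeval_eq_zero
    rwa [MvPolynomial.aeval_pair_constantCoeff, map_zero, d.constantCoeff_x₁,
      d.constantCoeff_y₁] at this
  have hst : MvPolynomial.aeval ![s, t] p = 0 := by
    have h1 := PlaneCoordRing.valuation_le_of_mem_pointIdeal φ hφ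
      (γ := max (v (x - algebraMap k K s)) (v (y - algebraMap k K t)))
      (hφx ▸ le_max_left _ _) (hφy ▸ le_max_right _ _) _
      (PlaneCoordRing.aeval_sub_mem_pointIdeal s t p)
    rw [PlaneCoordRing.aeval_eq_zero, zero_sub, map_neg, AlgHom.commutes, Valuation.map_neg] at h1
    by_contra h0
    have h2 : v (algebraMap k K (MvPolynomial.aeval ![s, t] p)⁻¹) ≤ 1 :=
      (O.valuation_le_one_iff _).2 (hO _)
    rw [map_inv₀, map_inv₀] at h2
    have h3 := h1.trans_lt (max_lt hs ht)
    exact absurd h2 (not_le.2 (one_lt_inv₀ (zero_lt_iff.2 (by simpa using h0)) |>.2 h3))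
  have finish (π : K) (hπ0 : π ≠ 0) (hπ1 : v π ≤ 1) (hπx : v (x - algebraMap k K s) ≤ v π)
      (hπy : v (y - algebraMap k K t) ≤ v π) (h1 : v π ^ (m * N) * v (d.det g e) ≤ 1)
      (h2 : MvPolynomial.aeval ![s, t] (MvPolynomial.pderiv 0 p) = 0 →
        MvPolynomial.aeval ![s, t] (MvPolynomial.pderiv 1 p) = 0 →
        v π ^ (m * N) * v (d.det g e) ≤ v π ^ E) : v (φ r * d.det g e) ≤ 1 := by
    by_cases hsm : MvPolynomial.aeval ![s, t] (MvPolynomial.pderiv 0 p) ≠ 0 ∨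
        MvPolynomial.aeval ![s, t] (MvPolynomial.pderiv 1 p) ≠ 0
    · rw [map_mul]
      exact (mul_le_mul' (O.valuation_le_of_mem_pow (φ : PlaneCoordRing S c →+* K) hφ
        (PlaneCoordRing.valuation_le_of_mem_pointIdeal φ hφ (hφx ▸ hπx) (hφy ▸ hπy))
        (hr s t hst hsm)) le_rfl).trans h1
    · push Not at hsm
      refine htriv ?_
      have h3 := (h2 hsm.1 hsm.2).trans (pow_le_pow_right_of_le_one' hπ1 hmN)
      have h0 : 0 < v π ^ (m * N) := pow_pos (zero_lt_iff.2 (by simpa using hπ0)) _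
      exact le_of_mul_le_mul_left (h3.trans (mul_one _).ge) h0
  have hne {z : K} {a : k} (hz : z ^ Fintype.card k ≠ z) : z - algebraMap k K a ≠ 0 := by
    intro h
    apply hz
    rw [sub_eq_zero.1 h, ← map_pow, FiniteField.pow_card]
  rcases le_total (v (y - algebraMap k K t)) (v (x - algebraMap k K s)) with hle | hle
  · refine finish _ (hne hxq) hs.le le_rfl hle (hxs ▸ hX) fun h0 h1 => ?_
    obtain ⟨τ, hτ0, hτ1, hτ⟩ := exists_blowup_chart hO p d.aeval_eq_zero d.constantCoeff_x₁
      d.constantCoeff_y₁ s t ((O.valuation_le_one_iff _).1 hs.le) (hne hxq)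
      ((O.valuation_le_one_iff _).1 (by
        rw [map_div₀]; exact div_le_one_of_le₀ hle zero_le)) hst h0 h1 (Or.inr hu) 1
      (by rw [one_mul]; exact d.coeff_one_x₁) (by rw [neg_one_mul]; exact d.coeff_one_y₁)
    have := hval (d.x_pow_mul_det_eq (g := g) (e := e) hO hx hxq hτ0 hτ)
    rwa [hτ1, one_mul, hxs] at this
  · refine finish _ (hne hyq) ht.le hle le_rfl (hyt ▸ hY) fun h0 h1 => ?_
    obtain ⟨τ, hτ0, hτ1, hτ⟩ := exists_blowup_chart hO (MvPolynomial.rename (Equiv.swap 0 1) p)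
      (f := d.y₁) (g := d.x₁) (by rw [MvPolynomial.aeval_rename_swap, d.aeval_eq_zero])
      d.constantCoeff_y₁ d.constantCoeff_x₁ t s ((O.valuation_le_one_iff _).1 ht.le) (hne hyq)
      ((O.valuation_le_one_iff _).1 (by
        rw [map_div₀]; exact div_le_one_of_le₀ hle zero_le))
      (by rw [MvPolynomial.aeval_rename_swap, hst])
      (by rw [MvPolynomial.pderiv_rename_swap, MvPolynomial.aeval_rename_swap]; exact h1)
      (by rw [MvPolynomial.pderiv_rename_swap, MvPolynomial.aeval_rename_swap]; exact h0)
      (Or.inl (by rw [MvPolynomial.pderiv_rename_swap, MvPolynomial.aeval_rename_swap]; exact hu))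
      (-1)
      (by
        rw [MvPolynomial.pderiv_rename_swap, MvPolynomial.aeval_rename_swap, neg_one_mul]
        exact d.coeff_one_y₁)
      (by
        rw [MvPolynomial.pderiv_rename_swap, MvPolynomial.aeval_rename_swap, neg_neg, one_mul]
        exact d.coeff_one_x₁)
    have := hval (d.y_pow_mul_det_eq (g := g) (e := e) hO hx hy hyq hτ0
      fun m => ⟨(hτ m).2, (hτ m).1⟩)
    rwa [hτ1, neg_one_mul, Valuation.map_neg, hyt] at this

end SecantData

end

section

open LaurentSeries

namespace IsPoleMap

section

variable {L A K : Type*} [Field L] [CommRing A] [Algebra L A] {n : ℕ} {x y : A} {π : A →ₐ[L] L⸨X⸩}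

theorem order_nonpos (h : IsPoleMap n x y π) {a : A} (ha : a ≠ 0) : (π a).order ≤ 0 := by
  obtain ⟨w, hw⟩ := h.exists_coeff_ne_zero ha
  exact (HahnSeries.order_le_of_coeff_ne_zero hw).trans (by omega)

theorem order_nonpos_of_forall_mem (h : IsPoleMap n x y π) [IsDomain A] [Field K] [Algebra A K]
    [IsFractionRing A K] {ψ : K →+* L⸨X⸩} (hψ : ∀ a, ψ (algebraMap A K a) = π a) {w : K}
    (hw0 : w ≠ 0)
    (hw : ∀ O : ValuationSubring K, (∀ a : A, algebraMap A K a ∈ O) → w ∈ O) :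
    (ψ w).order ≤ 0 := by
  have hint : IsIntegral A w := by
    let s : Set K := Set.range (algebraMap A K)
    have h1 : w ∈ (integralClosure (Subring.closure s) K).toSubring := by
      rw [← iInf_valuationSubring_superset, Subring.mem_iInf]
      rintro ⟨O, hO⟩
      exact hw O fun a => hO ⟨a, rfl⟩
    have hs : Subring.closure s = (algebraMap A K).range := by
      rw [← Subring.closure_eq (algebraMap A K).range]
      rfl
    let f : A →+* Subring.closure s :=
      (algebraMap A K).codRestrict _ fun a => Subring.subset_closure ⟨a, rfl⟩
    let : Algebra A (Subring.closure s) := f.toAlgebra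
    have : IsScalarTower A (Subring.closure s) K := IsScalarTower.of_algebraMap_eq fun _ => rfl
    have hf : Function.Surjective (algebraMap A (Subring.closure s)) := by
      rintro ⟨z, hz⟩
      have hz' := hz
      rw [hs] at hz'
      obtain ⟨a, rfl⟩ := hz'
      exact ⟨a, rfl⟩
    have := Algebra.isIntegral_of_surjective hf
    exact isIntegral_trans w h1
  obtain ⟨β, hβ, hβw⟩ := hint.isAlmostIntegral
  have hβ0 : β ≠ 0 := nonZeroDivisors.ne_zero hβ
  by_contra! hpos
  have hψw : ψ w ≠ 0 := (map_ne_zero ψ).2 hw0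
  have hπβ : π β ≠ 0 := (map_ne_zero_iff π h.injective).2 hβ0
  obtain ⟨a, ha⟩ := hβw ((π β).order.natAbs + 1)
  have ha' : π a = π β * ψ w ^ ((π β).order.natAbs + 1) := by
    rw [← hψ, ha, Algebra.smul_def, map_mul, map_pow, hψ β]
  have ha0 : a ≠ 0 := by
    rintro rfl
    rw [map_zero] at ha'
    exact mul_ne_zero hπβ (pow_ne_zero _ hψw) ha'.symm
  have h2 := h.order_nonpos ha0
  rw [ha', HahnSeries.order_mul hπβ (pow_ne_zero _ hψw), HahnSeries.order_pow, nsmul_eq_mul] at h2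
  have h3 : ((((π β).order.natAbs + 1 : ℕ) : ℤ)) * 1 ≤
      ((((π β).order.natAbs + 1 : ℕ) : ℤ)) * (ψ w).order :=
    mul_le_mul_of_nonneg_left hpos (by positivity)
  push_cast at h2 h3
  have := neg_abs_le (π β).order
  linarith

end

section Frobenius

variable {k A : Type*} [Field k] [CommRing A] [Algebra k A] {n : ℕ} {x y : A}
  {π : A →ₐ[k] k⸨X⸩}

theorem x_pow_ne (h : IsPoleMap n x y π) (hn : 1 ≤ n) {q : ℕ} (hq : 1 < q) : x ^ q ≠ x := by
  intro hx
  have := congrArg (fun u => (π u).order) hx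
  simp only [map_pow, HahnSeries.order_pow, h.order_x, nsmul_eq_mul] at this
  have h2 : (2 : ℤ) ≤ q := by exact_mod_cast hq
  have h3 : (1 : ℤ) ≤ n := by exact_mod_cast hn
  nlinarith

theorem y_pow_ne (h : IsPoleMap n x y π) {q : ℕ} (hq : 1 < q) : y ^ q ≠ y := by
  intro hy
  have := congrArg (fun u => (π u).order) hy
  simp only [map_pow, HahnSeries.order_pow, h.order_y, nsmul_eq_mul] at this
  have h2 : (2 : ℤ) ≤ q := by exact_mod_cast hq
  nlinarith

end Frobenius

end IsPoleMap

namespace SecantData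

variable {k K : Type*} [Field k] [Fintype k] [Field K] [Algebra k K] {S : Finset (ℕ × ℕ)}
  {c : ℕ × ℕ → k} [Algebra (PlaneCoordRing S c) K] [IsFractionRing (PlaneCoordRing S c) K]
  [IsScalarTower k (PlaneCoordRing S c) K] {x y : K} (d : SecantData S c x y) {n M N nf m : ℕ}
  {g : Fin nf → Fin N} {e : ((Fin (n + 1) × Fin (M + 1)) ⊕ Fin nf) ⊕ Fin m ≃ Fin N}

/-- The determinant has a pole of large order at infinity relative to the number of points. -/
theorem order_det_le (hn : 1 ≤ n) {π : PlaneCoordRing S c →ₐ[k] k⸨X⸩}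
    (h : IsPoleMap n (PlaneCoordRing.x S c) (PlaneCoordRing.y S c) π) {ψ : K →+* k⸨X⸩}
    (hψ : ∀ a, ψ (algebraMap (PlaneCoordRing S c) K a) = π a)
    (hx : algebraMap (PlaneCoordRing S c) K (PlaneCoordRing.x S c) = x)
    (hy : algebraMap (PlaneCoordRing S c) K (PlaneCoordRing.y S c) = y)
    (hu : MvPolynomial.aeval ![x, y] (MvPolynomial.pderiv 1 (planeCurve S c)) ≠ 0)
    (hmN : m * N ≤ ∑ i ∈ Finset.range N, i + Fintype.card k * ∑ i ∈ Finset.range m, i)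
    (hdet : d.det g e ≠ 0) :
    (ψ (d.det g e)).order ≤ (m * N *
      Nat.card {p : k × k // MvPolynomial.aeval ![p.1, p.2] (planeCurve S c) = 0} + n ^ 2 : ℕ) := by
  classical
  have := h.isDomain
  have hq : 1 < Fintype.card k := Fintype.one_lt_card
  have hinj := IsFractionRing.injective (PlaneCoordRing S c) K
  let ι := {p : k × k // MvPolynomial.aeval ![p.1, p.2] (planeCurve S c) = 0 ∧
    (MvPolynomial.aeval ![p.1, p.2] (MvPolynomial.pderiv 0 (planeCurve S c)) ≠ 0 ∨
      MvPolynomial.aeval ![p.1, p.2] (MvPolynomial.pderiv 1 (planeCurve S c)) ≠ 0)}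
  have hι : Fintype.card ι ≤
      Nat.card {p : k × k // MvPolynomial.aeval ![p.1, p.2] (planeCurve S c) = 0} := by
    rw [Nat.card_eq_fintype_card]
    exact Fintype.card_subtype_mono _ _ fun p hp => hp.1
  obtain ⟨r, hr0, hrpole, hr⟩ := h.exists_ne_zero_mem_pow
    (fun p : ι => PlaneCoordRing.pointIdeal S c p.1.1 p.1.2) (m * N)
    fun p => PlaneCoordRing.finrank_quotient_pow_le p.2.1 p.2.2 (m * N)
  have hr0' : algebraMap (PlaneCoordRing S c) K r ≠ 0 := (map_ne_zero_iff _ hinj).2 hr0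
  have key := h.order_nonpos_of_forall_mem hψ (mul_ne_zero hr0' hdet) fun O hO => by
    refine (O.valuation_le_one_iff _).1 ?_
    refine d.valuation_mul_det_le_one (IsScalarTower.toAlgHom k (PlaneCoordRing S c) K) hx hy
      (fun a => ?_) (hx ▸ hO _) (hy ▸ hO _) ?_ ?_ hu hmN fun s t hst hsm => hr ⟨(s, t), hst, hsm⟩
    · rw [IsScalarTower.algebraMap_apply k (PlaneCoordRing S c) K]
      exact hO _
    · rw [← hx, ← map_pow]
      exact hinj.ne (h.x_pow_ne hn hq)
    · rw [← hy, ← map_pow]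
      exact hinj.ne (h.y_pow_ne hq)
  rw [map_mul, HahnSeries.order_mul ((map_ne_zero ψ).2 hr0') ((map_ne_zero ψ).2 hdet), hψ] at key
  have hπr : π r ≠ 0 := (map_ne_zero_iff π h.injective).2 hr0
  have hr1 := IsPoleMap.mem_poleFiltration.1 hrpole
  rw [← HahnSeries.order_eq_orderTop_of_ne_zero hπr] at hr1
  have hr2 : -((m * N * Fintype.card ι + n ^ 2 : ℕ) : ℤ) ≤ (π r).order := by exact_mod_cast hr1
  have hle : (m * N * Fintype.card ι + n ^ 2 : ℕ) ≤ m * N *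
      Nat.card {p : k × k // MvPolynomial.aeval ![p.1, p.2] (planeCurve S c) = 0} + n ^ 2 := by
    gcongr
  zify at hle hr2 ⊢
  linarith

end SecantData

end

section

open PowerSeries

namespace approxSubring

variable {K : Type*} [Field K] {O : Subring K} {τ f : K⟦X⟧} {z : K} {m : ℕ}

theorem le_C_inv_mul (hz : z ∈ O) (hz0 : z ≠ 0) :
    approxSubring O τ m ≤ approxSubring O (C z⁻¹ * τ) m := by
  refine le_of_mem ?_
  have hmem : C z * (C z⁻¹ * τ) ∈ approxSubring O (C z⁻¹ * τ) m :=
    Subring.mul_mem _ (C_mem hz) self_mem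
  rwa [← mul_assoc, ← map_mul, mul_inv_cancel₀ hz0, map_one, one_mul] at hmem

theorem C_inv_mul_mem (hz : z ∈ O) (hz0 : z ≠ 0) (hτ : constantCoeff τ = 0)
    (hf : f ∈ approxSubring O τ m) (hf0 : z⁻¹ * constantCoeff f ∈ O) :
    C z⁻¹ * f ∈ approxSubring O (C z⁻¹ * τ) m := by
  rcases Nat.eq_zero_or_pos m with rfl | hm
  · exact mem_of_dvd (by simp)
  obtain ⟨P, hP⟩ := hf
  have hle := le_C_inv_mul (τ := τ) (m := m) hz hz0
  have hP0 : (P.coeff 0 : K) = constantCoeff f := by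
    have h1 := X_dvd_iff.1 ((dvd_pow_self _ hm.ne').trans hP)
    rw [map_sub, sub_eq_zero, Polynomial.hom_eval₂, hτ, Polynomial.eval₂_at_zero] at h1
    simpa using h1.symm
  have hdiv := congrArg (Polynomial.eval₂ ((C (R := K)).comp O.subtype) τ) P.divX_mul_X_add
  rw [Polynomial.eval₂_add, Polynomial.eval₂_mul, Polynomial.eval₂_X, Polynomial.eval₂_C] at hdiv
  set Q := P.divX.eval₂ ((C (R := K)).comp O.subtype) τ with hQ
  have : C z⁻¹ * f = C z⁻¹ * (f - P.eval₂ ((C (R := K)).comp O.subtype) τ) +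
      (Q * (C z⁻¹ * τ) + C (z⁻¹ * constantCoeff f)) := by
    rw [← hdiv, map_mul, ← hP0]
    simp only [RingHom.comp_apply, Subring.subtype_apply]
    ring
  rw [this]
  refine Subring.add_mem _ (mem_of_dvd (hP.mul_left _)) (Subring.add_mem _
    (Subring.mul_mem _ (hle (eval_mem _ self_mem)) self_mem) (C_mem hf0))

theorem C_pow_mul_mem (hz : z ∈ O) (hz0 : z ≠ 0) (hτ : constantCoeff τ = 0)
    (hf : f ∈ approxSubring O (C z⁻¹ * τ) m) : C (z ^ m) * f ∈ approxSubring O τ m := by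
  obtain ⟨P, hP⟩ := hf
  have h1 : C (z ^ m) * P.eval₂ ((C (R := K)).comp O.subtype) (C z⁻¹ * τ) ∈
      approxSubring O τ m := by
    rw [Polynomial.eval₂_eq_sum, Polynomial.sum, Finset.mul_sum]
    refine Subring.sum_mem _ fun j _ => ?_
    rcases le_total m j with hj | hj
    · refine mem_of_dvd (Dvd.dvd.mul_left (Dvd.dvd.mul_left ?_ _) _)
      rw [mul_pow]
      exact Dvd.dvd.mul_left ((pow_dvd_pow _ hj).trans (pow_dvd_pow_of_dvd (X_dvd_iff.2 hτ) j)) _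
    · have : C (z ^ m) * (((C (R := K)).comp O.subtype) (P.coeff j) * (C z⁻¹ * τ) ^ j) =
          C (z ^ (m - j)) * (C ((P.coeff j : O) : K) * τ ^ j) := by
        have h2 : (C (z ^ m) : K⟦X⟧) = C (z ^ (m - j)) * C (z ^ j) := by
          rw [← map_mul, ← pow_add, Nat.sub_add_cancel hj]
        have h3 : (C (z ^ j) * C z⁻¹ ^ j : K⟦X⟧) = 1 := by
          rw [← map_pow, ← map_mul, inv_pow, mul_inv_cancel₀ (pow_ne_zero _ hz0), map_one]
        rw [h2, mul_pow, RingHom.comp_apply, Subring.subtype_apply]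
        linear_combination (C (z ^ (m - j)) * C ((P.coeff j : O) : K) * τ ^ j) * h3
      rw [this]
      exact Subring.mul_mem _ (C_mem (O.pow_mem hz _)) (Subring.mul_mem _ (C_mem (P.coeff j).2)
        (Subring.pow_mem _ self_mem _))
  have := Subring.add_mem _ (mem_of_dvd (S := O) (τ := τ) (hP.mul_left (C (z ^ m)))) h1
  rwa [← mul_add, sub_add_cancel] at this

end approxSubring

/-- The exponents of the equation of a plane curve of degree `n + 1` in the coordinates
`1 / y`, `x / y` at infinity. -/
def supportAtInfinity (n : ℕ) (S : Finset (ℕ × ℕ)) : Finset (ℕ × ℕ) :=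
  S.image fun m => (n + 1 - m.1 - m.2, m.1)

/-- The coefficients of the equation of a plane curve of degree `n + 1` in the coordinates
`1 / y`, `x / y` at infinity. -/
def coeffAtInfinity {L : Type*} (n : ℕ) (c : ℕ × ℕ → L) (m : ℕ × ℕ) : L :=
  c (m.2, n + 1 - m.1 - m.2)

namespace IsFlexCurve

variable {k : Type*} [Field k] {n : ℕ} {S : Finset (ℕ × ℕ)} {c : ℕ × ℕ → k}

theorem sum_supportAtInfinity (h : IsFlexCurve n S c) {M : Type*} [AddCommMonoid M]
    (f : k → ℕ × ℕ → M) :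
    ∑ m ∈ supportAtInfinity n S, f (coeffAtInfinity n c m) m =
      ∑ m ∈ S, f (c m) (n + 1 - m.1 - m.2, m.1) := by
  rw [supportAtInfinity, Finset.sum_image]
  · refine Finset.sum_congr rfl fun m hm => ?_
    have := h.le_succ hm
    rw [coeffAtInfinity]
    congr 2
    exact Prod.ext rfl (by simp; omega)
  · intro m hm m' hm' heq
    have h1 := h.le_succ hm
    have h2 := h.le_succ hm'
    simp only [Prod.mk.injEq] at heq
    ext <;> omega

variable {R : Type*} [CommRing R] [Algebra k R]

theorem aeval_planeCurve_atInfinity (h : IsFlexCurve n S c) (X Y : R) :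
    MvPolynomial.aeval ![X, Y] (planeCurve (supportAtInfinity n S) (coeffAtInfinity n c)) =
      ∑ m ∈ S, algebraMap k R (c m) * X ^ (n + 1 - m.1 - m.2) * Y ^ m.1 := by
  rw [aeval_planeCurve]
  exact h.sum_supportAtInfinity fun r m => algebraMap k R r * X ^ m.1 * Y ^ m.2

theorem aeval_planeCurve_atInfinity_eq (h : IsFlexCurve n S c) {x y z : R} (hz : z * y = 1) :
    MvPolynomial.aeval ![z, x * z] (planeCurve (supportAtInfinity n S) (coeffAtInfinity n c)) =
      z ^ (n + 1) * MvPolynomial.aeval ![x, y] (planeCurve S c) := by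
  rw [h.aeval_planeCurve_atInfinity, aeval_planeCurve, Finset.mul_sum]
  refine Finset.sum_congr rfl fun m hm => ?_
  have := h.le_succ hm
  have e : z ^ (n + 1) = z ^ (n + 1 - m.1 - m.2) * z ^ m.1 * z ^ m.2 := by
    rw [← pow_add, ← pow_add]
    congr 1
    omega
  have e2 : z ^ m.2 * y ^ m.2 = 1 := by rw [← mul_pow, hz, one_pow]
  rw [e, mul_pow]
  linear_combination
    (-(algebraMap k R (c m) * z ^ (n + 1 - m.1 - m.2) * x ^ m.1 * z ^ m.1)) * e2

theorem secantY_atInfinity (h : IsFlexCurve n S c) (X Y₁ Y₂ : R) :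
    secantY (supportAtInfinity n S) (coeffAtInfinity n c) X Y₁ Y₂ =
      ∑ m ∈ S, algebraMap k R (c m) * X ^ (n + 1 - m.1 - m.2) *
        ∑ p ∈ Finset.range m.1, Y₁ ^ p * Y₂ ^ (m.1 - 1 - p) := by
  rw [secantY]
  exact h.sum_supportAtInfinity fun r m => algebraMap k R r * X ^ m.1 *
    ∑ p ∈ Finset.range m.2, Y₁ ^ p * Y₂ ^ (m.2 - 1 - p)

/-- The value of the derivative at infinity on the curve. -/
theorem aeval_pderiv_zero_atInfinity (h : IsFlexCurve n S c) {x y z : R} (hz : z * y = 1)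
    (hxy : MvPolynomial.aeval ![x, y] (planeCurve S c) = 0) :
    z * MvPolynomial.aeval ![z, x * z] (MvPolynomial.pderiv 0
        (planeCurve (supportAtInfinity n S) (coeffAtInfinity n c))) =
      -(z ^ (n + 1) * (x * MvPolynomial.aeval ![x, y] (MvPolynomial.pderiv 0 (planeCurve S c)) +
        y * MvPolynomial.aeval ![x, y] (MvPolynomial.pderiv 1 (planeCurve S c)))) := by
  rw [aeval_planeCurve] at hxy
  have hgeom (a : R) (i : ℕ) : a * ∑ p ∈ Finset.range i, a ^ p * a ^ (i - 1 - p) = i * a ^ i := by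
    rw [Finset.mul_sum, Finset.sum_congr rfl (g := fun _ => a ^ i)]
    · simp
    · intro p hp
      have := Finset.mem_range.1 hp
      rw [← pow_add, ← pow_succ']
      congr 1
      omega
  rw [← secantX_self, ← secantX_self, ← secantY_self, secantX, secantX, secantY,
    h.sum_supportAtInfinity fun r m => algebraMap k R r *
      (∑ p ∈ Finset.range m.1, z ^ p * z ^ (m.1 - 1 - p)) * (x * z) ^ m.2]
  have h0 : ((n + 1 : ℕ) : R) * z ^ (n + 1) *
      ∑ m ∈ S, algebraMap k R (c m) * x ^ m.1 * y ^ m.2 = 0 := by rw [hxy, mul_zero]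
  rw [← sub_eq_zero, ← h0, Finset.mul_sum, Finset.mul_sum, Finset.mul_sum, Finset.mul_sum,
    ← Finset.sum_add_distrib, Finset.mul_sum, ← Finset.sum_neg_distrib, ← Finset.sum_sub_distrib]
  refine Finset.sum_congr rfl fun m hm => ?_
  have hle := h.le_succ hm
  have e : z ^ (n + 1) = z ^ (n + 1 - m.1 - m.2) * z ^ m.1 * z ^ m.2 := by
    rw [← pow_add, ← pow_add]
    congr 1
    omega
  have e2 : z ^ m.2 * y ^ m.2 = 1 := by rw [← mul_pow, hz, one_pow]
  have e3 : ((n + 1 : ℕ) : R) = ((n + 1 - m.1 - m.2 : ℕ) : R) + m.1 + m.2 := by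
    rw [← Nat.cast_add, ← Nat.cast_add]
    congr 1
    omega
  have g1 := hgeom z (n + 1 - m.1 - m.2)
  have g2 := hgeom x m.1
  have g3 := hgeom y m.2
  rw [e3, e, mul_pow]
  linear_combination (algebraMap k R (c m) * x ^ m.1 * z ^ m.1) * g1 +
    (z ^ (n + 1 - m.1 - m.2) * z ^ m.1 * z ^ m.2) * algebraMap k R (c m) * (y ^ m.2 * g2 +
      x ^ m.1 * g3) - (algebraMap k R (c m) * z ^ (n + 1 - m.1 - m.2) * x ^ m.1 * z ^ m.1 *
        ((n + 1 - m.1 - m.2 : ℕ) : R)) * e2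

end IsFlexCurve

end

section BoxCoeff

variable {k R : Type*} [Field k] [CommRing R] [Algebra k R] (n M : ℕ) (S : Finset (ℕ × ℕ))
  (c : ℕ × ℕ → k)

/-- The coefficients of the box monomials in the principal part at infinity of the secant slope. -/
noncomputable def boxCoeff (x₂ y₂ z₂ : R) (s : Fin (n + 1) × Fin (M + 1)) : R :=
  ∑ m ∈ S, if (s.1 : ℕ) < m.1 ∧ (s.2 : ℕ) < m.2 + (M + m.1 - n - s.1) then
    algebraMap k R (c m) * x₂ ^ (m.1 - 1 - s.1) * z₂ ^ (M + m.1 - n - s.1) *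
      y₂ ^ (m.2 + (M + m.1 - n - s.1) - 1 - s.2) else 0

theorem map_boxCoeff {R' : Type*} [CommRing R'] [Algebra k R'] (σ : R →+* R')
    (hσ : ∀ r, σ (algebraMap k R r) = algebraMap k R' r) (x₂ y₂ z₂ : R)
    (s : Fin (n + 1) × Fin (M + 1)) :
    σ (boxCoeff n M S c x₂ y₂ z₂ s) = boxCoeff n M S c (σ x₂) (σ y₂) (σ z₂) s := by
  simp only [boxCoeff, map_sum, apply_ite σ, map_mul, map_pow, map_zero, hσ]

variable {n M S c}

theorem IsFlexCurve.sum_box_mul_boxCoeff (h : IsFlexCurve n S c) (hM : n ≤ M)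
    (x₁ y₁ x₂ y₂ z₂ : R) :
    ∑ s : Fin (n + 1) × Fin (M + 1), x₁ ^ (s.1 : ℕ) * y₁ ^ (s.2 : ℕ) * boxCoeff n M S c x₂ y₂ z₂ s =
      ∑ m ∈ S, algebraMap k R (c m) * ∑ p ∈ Finset.range m.1, x₁ ^ p * x₂ ^ (m.1 - 1 - p) *
        z₂ ^ (M + m.1 - n - p) * ∑ u ∈ Finset.range (m.2 + (M + m.1 - n - p)),
          y₁ ^ u * y₂ ^ (m.2 + (M + m.1 - n - p) - 1 - u) := by
  simp only [boxCoeff, Finset.mul_sum]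
  rw [Finset.sum_comm]
  refine Finset.sum_congr rfl fun m hm => ?_
  have hle := h.le_succ hm
  have hle' (hm' : m ≠ (n + 1, 0)) := h.le m hm hm'
  rw [Fintype.sum_prod_type, Finset.sum_fin_eq_sum_range]
  rw [← Finset.sum_subset (Finset.range_subset_range.2 (show m.1 ≤ n + 1 by omega))]
  · refine Finset.sum_congr rfl fun p hp => ?_
    have hp := Finset.mem_range.1 hp
    rw [dif_pos (by omega), Finset.sum_fin_eq_sum_range]
    have hu : m.2 + (M + m.1 - n - p) ≤ M + 1 := by
      by_cases hm' : m = (n + 1, 0)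
      · rw [hm']
        dsimp only
        omega
      · have := hle' hm'
        omega
    rw [← Finset.sum_subset (Finset.range_subset_range.2 hu)]
    · refine Finset.sum_congr rfl fun u hu' => ?_
      have hu' := Finset.mem_range.1 hu'
      rw [dif_pos (by omega), if_pos ⟨hp, hu'⟩]
      ring
    · intro u hu' hu''
      rw [Finset.mem_range] at hu' hu''
      rw [dif_pos hu', if_neg (fun h => hu'' h.2), mul_zero]
  · intro p hp hp'
    rw [Finset.mem_range] at hp hp'
    rw [dif_pos hp]
    exact Finset.sum_eq_zero fun u _ => by rw [if_neg (fun h => hp' h.1), mul_zero]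

theorem IsFlexCurve.eq_add_sum_box (h : IsFlexCurve n S c) (hM : n ≤ M) {x₁ y₁ x₂ y₂ z₁ z₂ κ κ' : R}
    (hz₁ : z₁ * y₁ = 1) (hz₂ : z₂ * y₂ = 1) (hu : IsUnit (y₁ - y₂))
    (hκ : (y₁ - y₂) * κ = -secantX S c x₁ x₂ y₂)
    (hκ' : (z₁ - z₂) * κ' =
      secantY (supportAtInfinity n S) (coeffAtInfinity n c) z₁ (x₁ * z₁) (x₂ * z₂)) :
    κ = y₁ ^ M * z₂ ^ (M + 2 - n) * κ' +
      ∑ s : Fin (n + 1) × Fin (M + 1),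
        x₁ ^ (s.1 : ℕ) * y₁ ^ (s.2 : ℕ) * boxCoeff n M S c x₂ y₂ z₂ s := by
  apply hu.mul_left_cancel
  have h1 : (y₁ - y₂) * (y₁ ^ M * z₂ ^ (M + 2 - n) * κ') =
      -(y₁ ^ (M + 1) * z₂ ^ (M + 1 - n) *
        secantY (supportAtInfinity n S) (coeffAtInfinity n c) z₁ (x₁ * z₁) (x₂ * z₂)) := by
    rw [← hκ', show M + 2 - n = M + 1 - n + 1 by omega]
    have : (z₁ - z₂) * y₁ = -(y₁ - y₂) * z₂ := by linear_combination hz₁ - hz₂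
    linear_combination (y₁ ^ M * z₂ ^ (M + 1 - n) * κ') * this
  rw [mul_add, h1, hκ, h.sum_box_mul_boxCoeff hM, h.secantY_atInfinity, secantX, Finset.mul_sum,
    Finset.mul_sum, ← Finset.sum_neg_distrib, ← Finset.sum_neg_distrib, ← Finset.sum_add_distrib]
  refine Finset.sum_congr rfl fun m hm => ?_
  have hle := h.le_succ hm
  simp only [Finset.mul_sum, Finset.sum_mul, ← Finset.sum_neg_distrib, ← Finset.sum_add_distrib]
  refine Finset.sum_congr rfl fun p hp => ?_
  have hp := Finset.mem_range.1 hp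
  rw [← Finset.mul_sum, ← Finset.mul_sum, ← Finset.mul_sum]
  set e := m.2 + (M + m.1 - n - p) with he
  have hg := (Commute.all y₁ y₂).mul_geom_sum₂ e
  have e1 : z₂ ^ (M + m.1 - n - p) * y₂ ^ e = y₂ ^ m.2 := by
    rw [he, pow_add, mul_left_comm, ← mul_pow, hz₂, one_pow, mul_one]
  have e2 : y₁ ^ (M + 1) * (z₁ ^ (n + 1 - m.1 - m.2) * z₁ ^ p) = y₁ ^ e := by
    rw [← pow_add, show M + 1 = e + (n + 1 - m.1 - m.2 + p) by omega, pow_add, mul_assoc,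
      ← mul_pow, mul_comm y₁ z₁, hz₁, one_pow, mul_one]
  have e3 : z₂ ^ (M + m.1 - n - p) = z₂ ^ (M + 1 - n) * z₂ ^ (m.1 - 1 - p) := by
    rw [← pow_add]
    congr 1
    omega
  rw [mul_pow, mul_pow]
  linear_combination (-algebraMap k R (c m) * x₁ ^ p * x₂ ^ (m.1 - 1 - p) *
    z₂ ^ (M + m.1 - n - p)) * hg + (algebraMap k R (c m) * x₁ ^ p * x₂ ^ (m.1 - 1 - p)) * e1 + (algebraMap k R (c m) * x₁ ^ p * x₂ ^ (m.1 - 1 - p) * z₂ ^ (M + 1 - n) * z₂ ^ (m.1 - 1 - p)) * e2 - (algebraMap k R (c m) * x₁ ^ p * x₂ ^ (m.1 - 1 - p) * y₁ ^ e) * e3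
  
end BoxCoeff

section

open PowerSeries

namespace SecantData

variable {k K : Type*} [Field k] [Fintype k] [Field K] [Algebra k K] {S : Finset (ℕ × ℕ)}
  {c : ℕ × ℕ → k} {x y z : K} (d : SecantData S c x y) {n M N nf m : ℕ} {O : Subring K}

theorem exists_inv_y₁ (hz : z * y = 1) : ∃ z₁ : K⟦X⟧, z₁ * d.y₁ = 1 ∧ constantCoeff z₁ = z := by
  have hy : constantCoeff d.y₁ ≠ 0 := by
    rw [d.constantCoeff_y₁]
    exact right_ne_zero_of_mul_eq_one hz
  refine ⟨d.y₁⁻¹, PowerSeries.inv_mul_cancel _ hy, ?_⟩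
  rw [PowerSeries.constantCoeff_inv, d.constantCoeff_y₁]
  exact (eq_inv_of_mul_eq_one_left hz).symm

theorem exists_chart_atInfinity (h : IsFlexCurve n S c) (hO : ∀ a, algebraMap k K a ∈ O)
    (hz : z * y = 1) (hzO : z ∈ O) (hw : x * z ∈ O)
    (hF : MvPolynomial.aeval ![z, x * z] (MvPolynomial.pderiv 0
      (planeCurve (supportAtInfinity n S) (coeffAtInfinity n c))) ≠ 0)
    (hF' : (MvPolynomial.aeval ![z, x * z] (MvPolynomial.pderiv 0
      (planeCurve (supportAtInfinity n S) (coeffAtInfinity n c))))⁻¹ ∈ O) {z₁ : K⟦X⟧}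
    (hz₁ : z₁ * d.y₁ = 1) (hz₁0 : constantCoeff z₁ = z) :
    ∃ τ : K⟦X⟧, constantCoeff τ = 0 ∧ coeff 1 τ = z ^ 2 / z ^ n ∧
      ∀ m, z₁ ∈ approxSubring O τ m ∧ d.x₁ * z₁ ∈ approxSubring O τ m := by
  have hz0 : z ≠ 0 := left_ne_zero_of_mul_eq_one hz
  have hxy : MvPolynomial.aeval ![x, y] (planeCurve S c) = 0 := by
    have := congrArg constantCoeff d.aeval_eq_zero
    rwa [MvPolynomial.aeval_pair_constantCoeff, map_zero, d.constantCoeff_x₁,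
      d.constantCoeff_y₁] at this
  refine exists_chart_of_ratio_mem_swap hO
    (planeCurve (supportAtInfinity n S) (coeffAtInfinity n c)) ?_ hz₁0
    (y := x * z) (by rw [map_mul, d.constantCoeff_x₁, hz₁0]) hzO hw hF ?_ _ ?_
  · rw [h.aeval_planeCurve_atInfinity_eq hz₁, d.aeval_eq_zero, mul_zero]
  · rw [div_eq_mul_inv]
    refine O.mul_mem (MvPolynomial.aeval_mem_subring hO ?_ _) hF'
    simpa [Fin.forall_fin_two] using ⟨hzO, hw⟩
  · have h1 := congrArg (coeff 1) hz₁
    rw [coeff_one_mul, coeff_one, if_neg one_ne_zero, hz₁0, d.constantCoeff_y₁,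
      d.coeff_one_y₁] at h1
    rw [coeff_one_mul, hz₁0, d.constantCoeff_x₁, d.coeff_one_x₁]
    have h2 := h.aeval_pderiv_zero_atInfinity hz hxy
    have h3 : z * (z ^ 2 / z ^ n) * z ^ n = z ^ 3 := by
      field_simp
    have h4 : z ^ (n + 1) ≠ 0 := pow_ne_zero _ hz0
    apply mul_left_cancel₀ h4
    generalize MvPolynomial.aeval ![z, x * z] (MvPolynomial.pderiv 0
      (planeCurve (supportAtInfinity n S) (coeffAtInfinity n c))) = A at *
    generalize MvPolynomial.aeval ![x, y] (MvPolynomial.pderiv 0 (planeCurve S c)) = B at *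
    generalize MvPolynomial.aeval ![x, y] (MvPolynomial.pderiv 1 (planeCurve S c)) = D at *
    generalize z ^ 2 / z ^ n = r at *
    have h5 : coeff 1 z₁ = z ^ 2 * B := by linear_combination z * h1 - coeff 1 z₁ * hz
    rw [h5]
    linear_combination z ^ 2 * h2 + A * h3 - z ^ (n + 2) * D * hz

theorem exists_secant_atInfinity (h : IsFlexCurve n S c) (hz : z * y = 1)
    (hyq : y ^ Fintype.card k ≠ y) {z₁ : K⟦X⟧}
    (hz₁ : z₁ * d.y₁ = 1) (hz₁0 : constantCoeff z₁ = z) :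
    ∃ κ' : K⟦X⟧⟦X⟧,
      (C z₁ - frobTwist k K z₁) * κ' = secantY (supportAtInfinity n S) (coeffAtInfinity n c)
        (C z₁) (C d.x₁ * C z₁) (frobTwist k K d.x₁ * frobTwist k K z₁) ∧
      (C d.x₁ * C z₁ - frobTwist k K d.x₁ * frobTwist k K z₁) * κ' =
        -secantX (supportAtInfinity n S) (coeffAtInfinity n c)
        (C z₁) (frobTwist k K z₁) (frobTwist k K d.x₁ * frobTwist k K z₁) := by
  have hz0 : z ≠ 0 := left_ne_zero_of_mul_eq_one hz
  have hzq : z ^ Fintype.card k ≠ z := by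
    rw [eq_inv_of_mul_eq_one_left hz, inv_pow]
    exact fun h => hyq (inv_injective h)
  obtain ⟨U, hU⟩ := isUnit_C_sub_frobTwist (k := k) (f := z₁) (by rwa [hz₁0])
  have hF1 : MvPolynomial.aeval ![z₁, d.x₁ * z₁]
      (planeCurve (supportAtInfinity n S) (coeffAtInfinity n c)) = 0 := by
    rw [h.aeval_planeCurve_atInfinity_eq hz₁, d.aeval_eq_zero, mul_zero]
  have hC := MvPolynomial.map_aeval_pair (C (R := K⟦X⟧))
    (fun a => (PowerSeries.algebraMap_apply (A := K⟦X⟧) (r := a)).symm) z₁ (d.x₁ * z₁)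
    (planeCurve (supportAtInfinity n S) (coeffAtInfinity n c))
  have hT := MvPolynomial.map_aeval_pair (frobTwist k K) frobTwist_algebraMap z₁ (d.x₁ * z₁)
    (planeCurve (supportAtInfinity n S) (coeffAtInfinity n c))
  rw [hF1, map_zero, map_mul] at hC hT
  have h1 := secantX_mul_add_secantY_mul (supportAtInfinity n S) (coeffAtInfinity n c)
    (C z₁) (C d.x₁ * C z₁) (frobTwist k K z₁) (frobTwist k K d.x₁ * frobTwist k K z₁)
  rw [← hC, ← hT, sub_zero, ← hU] at h1
  refine ⟨↑U⁻¹ * secantY (supportAtInfinity n S) (coeffAtInfinity n c)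
        (C z₁) (C d.x₁ * C z₁) (frobTwist k K d.x₁ * frobTwist k K z₁), ?_, ?_⟩
  · rw [← hU, Units.mul_inv_cancel_left]
  · apply U.isUnit.mul_left_cancel
    rw [mul_left_comm, Units.mul_inv_cancel_left]
    linear_combination h1

theorem C_pow_mul_column_mem (hz : z * y = 1) (hzO : z ∈ O) (hw : x * z ∈ O) {z₁ τ : K⟦X⟧}
    (hz₁ : z₁ * d.y₁ = 1) (hz₁0 : constantCoeff z₁ = z) (hτ : constantCoeff τ = 0)
    (hzτ : z₁ ∈ approxSubring O τ N) (hwτ : d.x₁ * z₁ ∈ approxSubring O τ N)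
    (g : Fin nf → Fin N) (i : (Fin (n + 1) × Fin (M + 1)) ⊕ Fin nf) :
    C (Sum.elim (fun _ => 1) (fun _ => z ^ (2 * N)) i) * (z₁ ^ (M + n) * d.column n M g i) ∈
      approxSubring O τ N := by
  have hz0 : z ≠ 0 := left_ne_zero_of_mul_eq_one hz
  rcases i with i | i
  · simp only [Sum.elim_inl, column, map_one, one_mul]
    have h1 := i.1.2
    have h2 := i.2.2
    have e1 : z₁ ^ (M + n) = z₁ ^ (M + n - i.1 - i.2) * z₁ ^ (i.1 : ℕ) * z₁ ^ (i.2 : ℕ) := by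
      rw [← pow_add, ← pow_add]
      congr 1
      omega
    have e2 : z₁ ^ (i.2 : ℕ) * d.y₁ ^ (i.2 : ℕ) = 1 := by rw [← mul_pow, hz₁, one_pow]
    have : z₁ ^ (M + n) * (d.x₁ ^ (i.1 : ℕ) * d.y₁ ^ (i.2 : ℕ)) =
        z₁ ^ (M + n - i.1 - i.2) * (d.x₁ * z₁) ^ (i.1 : ℕ) := by
      rw [e1, mul_pow]
      linear_combination (z₁ ^ (M + n - i.1 - i.2) * z₁ ^ (i.1 : ℕ) * d.x₁ ^ (i.1 : ℕ)) * e2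
    rw [this]
    exact Subring.mul_mem _ (Subring.pow_mem _ hzτ _) (Subring.pow_mem _ hwτ _)
  · simp only [Sum.elim_inr, column]
    have hle := approxSubring.le_C_inv_mul (O := O) (τ := τ) (m := N) hzO hz0
    have hρ := approxSubring.C_inv_mul_mem hzO hz0 hτ hzτ
      (by rw [hz₁0, inv_mul_cancel₀ hz0]; exact O.one_mem)
    have hσ : C z * d.y₁ ∈ approxSubring O (C z⁻¹ * τ) N := by
      refine approxSubring.mem_of_one_sub_mul_mem (ω := 1 - C z⁻¹ * z₁)
        (Subring.sub_mem _ (Subring.one_mem _) hρ) ?_ ?_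
      · rw [map_sub, map_one, map_mul, constantCoeff_C, hz₁0, inv_mul_cancel₀ hz0, sub_self]
      · have e : (C z⁻¹ * C z : K⟦X⟧) = 1 := by rw [← map_mul, inv_mul_cancel₀ hz0, map_one]
        have : (1 - (1 - C z⁻¹ * z₁)) * (C z * d.y₁) = 1 := by
          linear_combination (z₁ * d.y₁) * e + hz₁
        rw [this]
        exact Subring.one_mem _
    have hx : C z * (d.x₁ - C x) ∈ approxSubring O (C z⁻¹ * τ) N := by
      have : C z * (d.x₁ - C x) = C z * d.y₁ * (d.x₁ * z₁) - C (x * z) := by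
        rw [map_mul]
        linear_combination (-C z * d.x₁) * hz₁
      rw [this]
      exact Subring.sub_mem _ (Subring.mul_mem _ hσ (hle hwτ)) (approxSubring.C_mem hw)
    have hi := (g i).2
    have e : C (z ^ (2 * N)) * (z₁ ^ (M + n) * (d.x₁ - C x) ^ (g i : ℕ)) =
        C (z ^ N) * (C (z ^ (N - g i)) * z₁ ^ (M + n) * (C z * (d.x₁ - C x)) ^ (g i : ℕ)) := by
      rw [mul_pow, ← map_pow, show 2 * N = N + (N - g i) + g i by omega, pow_add, pow_add,
        map_mul, map_mul]
      ring
    rw [e]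
    exact approxSubring.C_pow_mul_mem hzO hz0 hτ (Subring.mul_mem _ (Subring.mul_mem _
      (approxSubring.C_mem (O.pow_mem hzO _)) (Subring.pow_mem _ (hle hzτ) _))
      (Subring.pow_mem _ hx _))

/-- The behaviour of the determinant at infinity. -/
theorem atInfinity_mul_det_eq (h : IsFlexCurve n S c) (hM : n ≤ M)
    (hO : ∀ a, algebraMap k K a ∈ O) (hz : z * y = 1) (hzO : z ∈ O) (hw : x * z ∈ O)
    (hyq : y ^ Fintype.card k ≠ y) (hwq : (x * z) ^ Fintype.card k ≠ x * z)
    (hF : MvPolynomial.aeval ![z, x * z] (MvPolynomial.pderiv 0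
      (planeCurve (supportAtInfinity n S) (coeffAtInfinity n c))) ≠ 0)
    (hF' : (MvPolynomial.aeval ![z, x * z] (MvPolynomial.pderiv 0
      (planeCurve (supportAtInfinity n S) (coeffAtInfinity n c))))⁻¹ ∈ O)
    (g : Fin nf → Fin N) (e : ((Fin (n + 1) × Fin (M + 1)) ⊕ Fin nf) ⊕ Fin m ≃ Fin N) :
    ∃ o ∈ O, (x * z - (x * z) ^ Fintype.card k) ^ (m * N) * z ^ (2 * N * nf) * (z ^ (M + n)) ^ N *
      d.det g e = (z ^ 2 / z ^ n) ^
        (∑ i ∈ Finset.range N, i + Fintype.card k * ∑ i ∈ Finset.range m, i) *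
        z ^ (Fintype.card k * (M + 2 - n) * m) * o := by
  obtain ⟨z₁, hz₁, hz₁0⟩ := d.exists_inv_y₁ hz
  obtain ⟨τ, hτ, hτ1, hmem⟩ := d.exists_chart_atInfinity h hO hz hzO hw hF hF' hz₁ hz₁0
  obtain ⟨κ', hκ'z, hκ'w⟩ := d.exists_secant_atInfinity h hz hyq hz₁ hz₁0
  set Fr : K →+* K := ((FiniteField.frobeniusAlgHom k K : K →ₐ[k] K) : K →+* K) with hFr
  have hTz : frobTwist k K z₁ = map C (map Fr z₁) := rfl
  have hwO : (x * z) ^ Fintype.card k ∈ O := O.pow_mem hw _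
  have hw₁ : constantCoeff (d.x₁ * z₁) = x * z := by rw [map_mul, d.constantCoeff_x₁, hz₁0]
  have hkey := h.eq_add_sum_box hM (z₁ := C z₁) (z₂ := frobTwist k K z₁)
    (by rw [← map_mul, hz₁, map_one]) (by rw [← map_mul, hz₁, map_one])
    (isUnit_C_sub_frobTwist (k := k) (f := d.y₁) (by rwa [d.constantCoeff_y₁])) d.y_mul_κ hκ'z
  let f := fun i => z₁ ^ (M + n) * d.column n M g i
  let G : (Fin (n + 1) × Fin (M + 1)) ⊕ Fin nf → K⟦X⟧ := Sum.elim
    (fun s => boxCoeff n M S c (map Fr d.x₁) (map Fr d.y₁) (map Fr z₁) s) fun _ => 0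
  obtain ⟨o, ho, ho'⟩ := exists_local_det_eq e (O := O) (τ₁ := τ) (τ₂ := map Fr τ)
    (A := d.x₁ * z₁ - C ((x * z) ^ Fintype.card k))
    (ω := frobTwist k K d.x₁ * frobTwist k K z₁ - C (C ((x * z) ^ Fintype.card k)))
    (κ' := C (z₁ ^ n) * κ') (κ := C (z₁ ^ (M + n)) * d.κ) hτ
    (by rw [constantCoeff_map_frobenius, hτ, zero_pow Fintype.card_ne_zero])
    (Subring.sub_mem _ (hmem N).2 (approxSubring.C_mem hwO))
    (by rw [map_sub, hw₁, constantCoeff_C]; exact sub_ne_zero.2 hwq.symm)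
    (Subring.sub_mem _ (by rw [← map_mul]; exact frobTwist_mem (hmem m).2)
      (approxSubring.C_mem (approxSubring.C_mem hwO)))
    (by rw [map_sub, ← map_mul, constantCoeff_frobTwist, constantCoeff_C, hw₁, sub_self])
    (by
      rw [map_sub, sub_sub_sub_cancel_right, map_mul, mul_left_comm, hκ'w]
      refine Subring.mul_mem _ (approxSubring.C_mem (Subring.pow_mem _ (hmem N).1 _))
        (Subring.neg_mem _ (secantX_mem _ _
        (approxSubring.algebraMap_mem (approxSubring.algebraMap_mem hO τ N) _ m)
        (approxSubring.C_mem (hmem N).1) (frobTwist_mem (hmem m).1) ?_))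
      rw [← map_mul]
      exact frobTwist_mem (hmem m).2)
    f ((map Fr z₁) ^ (M + 2 - n)) G
    (by
      have hbox : ∑ i, C (f i) * map C (G i) = C (z₁ ^ (M + n)) *
          ∑ s : Fin (n + 1) × Fin (M + 1), C d.x₁ ^ (s.1 : ℕ) * C d.y₁ ^ (s.2 : ℕ) *
            boxCoeff n M S c (frobTwist k K d.x₁) (frobTwist k K d.y₁) (frobTwist k K z₁) s := by
        have h0 : ∀ i : Fin nf, C (f (Sum.inr i)) * map C (G (Sum.inr i)) = 0 := fun i => by
          simp [G]
        rw [Fintype.sum_sum_type, Finset.sum_eq_zero fun i _ => h0 i, add_zero, Finset.mul_sum]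
        refine Finset.sum_congr rfl fun s _ => ?_
        have h1 := map_boxCoeff n M S c (map (C (R := K))) (R := K⟦X⟧) (R' := K⟦X⟧⟦X⟧)
          (fun r => by simp [PowerSeries.algebraMap_apply]) (map Fr d.x₁) (map Fr d.y₁)
          (map Fr z₁) s
        simp only [f, G, Sum.elim_inl, column]
        rw [h1, map_mul, map_mul, map_pow, map_pow, map_pow, mul_assoc]
        rfl
      have hzy : (C z₁ * C d.y₁ : K⟦X⟧⟦X⟧) ^ M = 1 := by rw [← map_mul, hz₁, map_one, one_pow]
      rw [hbox, hkey, map_pow (map (C (R := K))) (map Fr z₁), ← hTz, mul_add, map_pow, map_pow,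
        pow_add]
      rw [mul_pow] at hzy
      linear_combination
        (C z₁ ^ n * frobTwist k K z₁ ^ (M + 2 - n) * κ') * hzy)
    (Sum.elim (fun _ => 1) fun _ => z ^ (2 * N)) (G := 1) (Subring.one_mem _)
    (fun i => by
      rw [one_mul]
      exact d.C_pow_mul_column_mem hz hzO hw hz₁ hz₁0 hτ (hmem N).1 (hmem N).2 g i)
  refine ⟨o, ho, ?_⟩
  have hdet : (coeffMatrix e (Sum.elim f fun l : Fin m => coeff (l : ℕ)
      (C (z₁ ^ (M + n)) * d.κ))).det = (z ^ (M + n)) ^ N * d.det g e := by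
    rw [det, ← hz₁0, ← map_pow, ← det_coeffMatrix_mul_left]
    congr 2
    ext1 j
    rcases j with j | j
    · rfl
    · rw [Sum.elim_inr, Sum.elim_inr, coeff_C_mul]
  have hprod : ∏ i : (Fin (n + 1) × Fin (M + 1)) ⊕ Fin nf,
      Sum.elim (fun _ => (1 : K)) (fun _ => z ^ (2 * N)) i = z ^ (2 * N * nf) := by
    simp [Fintype.prod_sum_type, pow_mul]
  have hFrz : constantCoeff (map Fr z₁ ^ (M + 2 - n)) ^ m =
      z ^ (Fintype.card k * (M + 2 - n) * m) := by
    rw [map_pow, constantCoeff_map_frobenius, hz₁0, pow_mul, pow_mul]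
  have hFrτ : coeff 1 (map Fr τ) = (z ^ 2 / z ^ n) ^ Fintype.card k := by
    rw [coeff_map, hτ1]
    rfl
  rw [hdet, hprod, hFrz, hFrτ, hτ1, map_one, one_mul, map_sub, hw₁, constantCoeff_C,
    ← pow_mul, ← pow_mul] at ho'
  rw [pow_add]
  linear_combination ho'

end SecantData

end

section

open PowerSeries LaurentSeries

theorem IsFlexCurve.aeval_zero_pderiv_zero_atInfinity {k : Type*} [Field k] {n : ℕ}
    {S : Finset (ℕ × ℕ)} {c : ℕ × ℕ → k} (h : IsFlexCurve n S c) :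
    MvPolynomial.aeval ![(0 : k), 0] (MvPolynomial.pderiv 0
      (planeCurve (supportAtInfinity n S) (coeffAtInfinity n c))) = c (0, n) := by
  rw [← secantX_self, secantX, h.sum_supportAtInfinity fun r m => algebraMap k k r *
      (∑ p ∈ Finset.range m.1, 0 ^ p * 0 ^ (m.1 - 1 - p)) * 0 ^ m.2,
    Finset.sum_eq_single_of_mem (0, n) h.right_mem]
  · simp
  · rintro ⟨i, j⟩ hm hne
    rcases Nat.eq_zero_or_pos i with rfl | hi
    · have hle := h.le_succ hm
      have hn : n ≠ j := fun hnj => hne (by rw [hnj])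
      have hj : j ≤ n := by
        by_cases h0 : ((0, j) : ℕ × ℕ) = (n + 1, 0)
        · simp at h0
        · simpa using h.le _ hm h0
      rw [Finset.sum_eq_zero, mul_zero, zero_mul]
      intro p _
      dsimp only
      rcases Nat.eq_zero_or_pos p with rfl | hp
      · rw [zero_pow (n := n + 1 - 0 - j - 1 - 0) (by omega), mul_zero]
      · rw [zero_pow hp.ne', zero_mul]
    · rw [zero_pow hi.ne', mul_zero]

namespace SecantData

variable {k K : Type*} [Field k] [Fintype k] [Field K] [Algebra k K] {S : Finset (ℕ × ℕ)}
  {c : ℕ × ℕ → k} {x y : K} (d : SecantData S c x y) {n M N nf m : ℕ}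
  {g : Fin nf → Fin N} {e : ((Fin (n + 1) × Fin (M + 1)) ⊕ Fin nf) ⊕ Fin m ≃ Fin N}

/-- The determinant vanishes to high order at infinity. -/
theorem le_order_det (h : IsFlexCurve n S c) (hM : n ≤ M) {ψ : K →+* k⸨X⸩}
    (hψk : ∀ a, ψ (algebraMap k K a) = HahnSeries.ofPowerSeries ℤ k (C a)) {w : k⟦X⟧}
    (hw0 : constantCoeff w ≠ 0) (hψx : ψ x * HahnSeries.ofPowerSeries ℤ k (X ^ n * w) = 1)
    (hψy : ψ y * HahnSeries.ofPowerSeries ℤ k (X ^ (n + 1) * w) = 1)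
    (hdet : d.det g e ≠ 0) :
    (2 - n : ℤ) * (n + 1) *
        (∑ i ∈ Finset.range N, i + Fintype.card k * ∑ i ∈ Finset.range m, i : ℕ) +
      (n + 1) * (Fintype.card k * (M + 2 - n) * m : ℕ) ≤
      m * N + (n + 1) * (2 * N * nf) + (n + 1) * ((M + n) * N) + (ψ (d.det g e)).order := by
  set L := HahnSeries.ofPowerSeries ℤ k with hL
  obtain ⟨hY0, hYo⟩ := HahnSeries.order_ofPowerSeries_X_pow_mul (n + 1) hw0
  have hq : 1 < Fintype.card k := Fintype.one_lt_card
  have hy0 : y ≠ 0 := by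
    rintro rfl
    rw [map_zero, zero_mul] at hψy
    exact zero_ne_one hψy
  set z := y⁻¹ with hz
  have hzy : z * y = 1 := inv_mul_cancel₀ hy0
  have hψz : ψ z = L (X ^ (n + 1) * w) := by
    rw [hz, map_inv₀]
    exact inv_eq_of_mul_eq_one_right hψy
  have hψw : ψ (x * z) = L X := by
    rw [map_mul, hψz, pow_succ', mul_assoc, map_mul, mul_left_comm, hψx, mul_one]
  let O : Subring K := Subring.comap ψ L.range
  have hO (a : k) : algebraMap k K a ∈ O := ⟨C a, (hψk a).symm⟩
  have hzO : z ∈ O := ⟨_, hψz.symm⟩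
  have hwO : x * z ∈ O := ⟨_, hψw.symm⟩
  obtain ⟨hW0, hWo⟩ := HahnSeries.order_ofPowerSeries_X_pow_mul (L := k) 1
    (w := 1 - X ^ (Fintype.card k - 1)) (by
      rw [map_sub, map_pow, constantCoeff_X, zero_pow (by omega), sub_zero, map_one]
      exact one_ne_zero)
  have hψwq : ψ (x * z - (x * z) ^ Fintype.card k) =
      L (X ^ 1 * (1 - X ^ (Fintype.card k - 1))) := by
    rw [map_sub, map_pow, hψw, ← map_pow, ← map_sub, mul_sub, mul_one, ← pow_add, pow_one,
      Nat.add_sub_cancel' hq.le]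
  have hwq : (x * z) ^ Fintype.card k ≠ x * z := by
    intro h0
    rw [h0, sub_self, map_zero] at hψwq
    exact hW0 hψwq.symm
  have hyq : y ^ Fintype.card k ≠ y := by
    intro h0
    have h1 : ψ z ^ Fintype.card k = ψ z := by rw [← map_pow, hz, inv_pow, h0]
    have h2 := congrArg HahnSeries.order h1
    rw [hψz, HahnSeries.order_pow, hYo, nsmul_eq_mul] at h2
    have h3 : (2 : ℤ) ≤ Fintype.card k := by exact_mod_cast hq
    push_cast at h2
    nlinarith
  set F := MvPolynomial.pderiv 0 (planeCurve (supportAtInfinity n S) (coeffAtInfinity n c)) with hF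
  obtain ⟨U, hU⟩ : IsUnit (MvPolynomial.aeval ![X ^ (n + 1) * w, X] F : k⟦X⟧) := by
    rw [isUnit_iff_constantCoeff, MvPolynomial.aeval_pair_constantCoeff]
    have : ![constantCoeff (X ^ (n + 1) * w), constantCoeff (X : k⟦X⟧)] = ![0, 0] := by
      simp
    rw [this, h.aeval_zero_pderiv_zero_atInfinity]
    exact h.right_ne.isUnit
  have hψF : ψ (MvPolynomial.aeval ![z, x * z] F) = L U := by
    let : Algebra k k⸨X⸩ := (L.comp (C (R := k))).toAlgebra
    rw [MvPolynomial.map_aeval_pair (R' := k⸨X⸩) ψ hψk, hU,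
      MvPolynomial.map_aeval_pair (R' := k⸨X⸩) L (fun a => by
        rw [PowerSeries.algebraMap_apply]; rfl), hψz, hψw]
  have hUinv : L U * L ((U⁻¹ : k⟦X⟧ˣ) : k⟦X⟧) = 1 := by rw [← map_mul, Units.mul_inv, map_one]
  obtain ⟨o, ⟨r, hr⟩, ho⟩ := d.atInfinity_mul_det_eq h hM hO hzy hzO hwO hyq hwq
    (by
      intro h0
      rw [h0, map_zero] at hψF
      rw [← hψF, zero_mul] at hUinv
      exact zero_ne_one hUinv)
    (by
      refine ⟨((U⁻¹ : k⟦X⟧ˣ) : k⟦X⟧), ?_⟩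
      rw [map_inv₀, hψF]
      exact (inv_eq_of_mul_eq_one_right hUinv).symm) g e
  have hψz0 : ψ z ≠ 0 := by rwa [hψz]
  have hψd0 : ψ (d.det g e) ≠ 0 := (map_ne_zero ψ).2 hdet
  have hψwq0 : ψ (x * z - (x * z) ^ Fintype.card k) ≠ 0 := by rwa [hψwq]
  have hzo : (ψ z).order = n + 1 := by rw [hψz, hYo]; push_cast; ring
  have hψ := congrArg ψ ho
  simp only [map_mul, map_pow, map_div₀] at hψ
  have hlhs : ψ (x * z - (x * z) ^ Fintype.card k) ^ (m * N) * ψ z ^ (2 * N * nf) *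
      (ψ z ^ (M + n)) ^ N * ψ (d.det g e) ≠ 0 :=
    mul_ne_zero (mul_ne_zero (mul_ne_zero (pow_ne_zero _ hψwq0) (pow_ne_zero _ hψz0))
      (pow_ne_zero _ (pow_ne_zero _ hψz0))) hψd0
  have hψo0 : ψ o ≠ 0 := by
    intro h0
    rw [h0, mul_zero] at hψ
    exact hlhs hψ
  have hro : 0 ≤ (ψ o).order := by
    rw [← hr]
    have hr0 : r ≠ 0 := by
      rintro rfl
      exact hψo0 (by rw [← hr]; exact map_zero L)
    rw [← X_pow_order_mul_divXPowOrder (f := r), (HahnSeries.order_ofPowerSeries_X_pow_mul _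
      (constantCoeff_divXPowOrder_eq_zero_iff.not.2 hr0)).2]
    positivity
  have hc : (ψ z ^ 2 / ψ z ^ n).order = (2 - n) * (n + 1) := by
    rw [div_eq_mul_inv, HahnSeries.order_mul (pow_ne_zero _ hψz0) (inv_ne_zero (pow_ne_zero _ hψz0)),
      HahnSeries.order_inv', HahnSeries.order_pow, HahnSeries.order_pow, hzo]
    simp only [nsmul_eq_mul]
    push_cast
    ring
  have hc0 : ψ z ^ 2 / ψ z ^ n ≠ 0 := div_ne_zero (pow_ne_zero _ hψz0) (pow_ne_zero _ hψz0)
  have hord := congrArg HahnSeries.order hψ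
  generalize (∑ i ∈ Finset.range N, i + Fintype.card k * ∑ i ∈ Finset.range m, i : ℕ) = E at *
  rw [HahnSeries.order_mul (mul_ne_zero (mul_ne_zero (pow_ne_zero _ hψwq0) (pow_ne_zero _ hψz0))
      (pow_ne_zero _ (pow_ne_zero _ hψz0))) hψd0,
    HahnSeries.order_mul (mul_ne_zero (pow_ne_zero _ hψwq0) (pow_ne_zero _ hψz0))
      (pow_ne_zero _ (pow_ne_zero _ hψz0)),
    HahnSeries.order_mul (pow_ne_zero _ hψwq0) (pow_ne_zero _ hψz0),
    HahnSeries.order_mul (mul_ne_zero (pow_ne_zero _ hc0) (pow_ne_zero _ hψz0)) hψo0,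
    HahnSeries.order_mul (pow_ne_zero _ hc0) (pow_ne_zero _ hψz0)] at hord
  simp only [HahnSeries.order_pow, hzo, hc, nsmul_eq_mul, hψwq] at hord
  rw [show (L _).order = _ from hWo] at hord
  push_cast at hord ⊢
  linarith

end SecantData

end

section

open Filter Topology

theorem sum_range_cast (n : ℕ) : ((∑ i ∈ Finset.range n, i : ℕ) : ℝ) = n * (n - 1) / 2 := by
  induction n with
  | zero => simp
  | succ n ih =>
    rw [Finset.sum_range_succ, Nat.cast_add, ih]
    push_cast
    ring

theorem sub_mul_sqrt_le_of_forall_le {q n a P : ℕ} (hq : 1 < q)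
    (H : ∀ m M N : ℕ, n ≤ M → (n + 1) * (M + 1) + a + m = N →
      m * N ≤ ∑ i ∈ Finset.range N, i + q * ∑ i ∈ Finset.range m, i →
      (2 - n : ℤ) * (n + 1) * (∑ i ∈ Finset.range N, i + q * ∑ i ∈ Finset.range m, i : ℕ) +
        (n + 1) * (q * (M + 2 - n) * m : ℕ) ≤
      m * N + (n + 1) * (2 * N * a) + (n + 1) * ((M + n) * N) + (m * N * P + n ^ 2 : ℕ)) :
    (q : ℝ) - n * (n - 1) * √q ≤ P := by
  set s := √(q : ℝ) with hs
  have hsq : s * s = q := Real.mul_self_sqrt (Nat.cast_nonneg q)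
  have hs1 : 1 < s := by
    rw [hs, Real.lt_sqrt zero_le_one]
    simpa using hq
  have hn : (0 : ℝ) < n + 1 := by positivity
  set r := (s - 1) / (n + 1) with hr
  have hr0 : 0 < r := div_pos (by linarith) hn
  have hrs : (n + 1) * r + 1 = s := by
    rw [hr]
    field_simp
    ring
  let M : ℕ → ℕ := fun m => ⌊r * m⌋₊
  let N : ℕ → ℕ := fun m => (n + 1) * (M m + 1) + a + m
  have ht : Tendsto (fun m : ℕ => (1 : ℝ) / m) atTop (𝓝 0) := tendsto_one_div_atTop_nhds_zero_nat
  have hM : Tendsto (fun m : ℕ => (M m : ℝ) / m) atTop (𝓝 r) :=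
    (tendsto_nat_floor_mul_div_atTop hr0.le).comp tendsto_natCast_atTop_atTop
  have hN : Tendsto (fun m : ℕ => (N m : ℝ) / m) atTop (𝓝 s) := by
    have h1 : Tendsto (fun m : ℕ => (n + 1) * ((M m : ℝ) / m + 1 / m) + a * (1 / m) + 1) atTop
        (𝓝 ((n + 1) * (r + 0) + a * 0 + 1)) :=
      (((hM.add ht).const_mul _).add (ht.const_mul _)).add_const _
    rw [add_zero, mul_zero, add_zero, hrs] at h1
    refine h1.congr' ?_
    filter_upwards [eventually_gt_atTop 0] with m hm
    have : (m : ℝ) ≠ 0 := by positivity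
    simp only [N]
    push_cast
    field_simp
  have hMtop : ∀ᶠ m : ℕ in atTop, n ≤ M m :=
    (tendsto_nat_floor_atTop.comp (tendsto_natCast_atTop_atTop.const_mul_atTop hr0)).eventually_ge_atTop n
  have hE : Tendsto (fun m : ℕ => ((N m : ℝ) / m * (N m / m - 1 / m) + q * (1 - 1 / m)) / 2) atTop
      (𝓝 ((s * (s - 0) + q * (1 - 0)) / 2)) :=
    ((hN.mul (hN.sub ht)).add ((tendsto_const_nhds.sub ht).const_mul _)).div_const _
  rw [sub_zero, sub_zero, mul_one, hsq, add_self_div_two] at hE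
  have hcond := hN.eventually_lt hE (by nlinarith)
  have hlhs : Tendsto (fun m : ℕ => (2 - n : ℝ) * (n + 1) *
      (((N m : ℝ) / m * (N m / m - 1 / m) + q * (1 - 1 / m)) / 2) +
      (n + 1) * (q * ((M m : ℝ) / m + (2 - n) * (1 / m)))) atTop
      (𝓝 ((2 - n) * (n + 1) * q + (n + 1) * (q * (r + (2 - n) * 0)))) :=
    (hE.const_mul _).add (((hM.add (ht.const_mul _)).const_mul _).const_mul _)
  have hrhs : Tendsto (fun m : ℕ => (N m : ℝ) / m + (n + 1) * (2 * a * ((N m : ℝ) / m * (1 / m))) +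
      (n + 1) * (((M m : ℝ) / m + n * (1 / m)) * (N m / m)) + N m / m * P + n ^ 2 * (1 / m * (1 / m)))
      atTop (𝓝 (s + (n + 1) * (2 * a * (s * 0)) + (n + 1) * ((r + n * 0) * s) + s * P +
        n ^ 2 * (0 * 0))) :=
    (((hN.add (((hN.mul ht).const_mul _).const_mul _)).add
      (((hM.add (ht.const_mul _)).mul hN).const_mul _)).add (hN.mul_const _)).add
      ((ht.mul ht).const_mul _)
  have key := le_of_tendsto_of_tendsto hlhs hrhs (by
    filter_upwards [hMtop, hcond, eventually_gt_atTop 0] with m hm hc hm0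
    have hm0' : (0 : ℝ) < m := by exact_mod_cast hm0
    have hEm : ((∑ i ∈ Finset.range (N m), i + q * ∑ i ∈ Finset.range m, i : ℕ) : ℝ) =
        m ^ 2 * (((N m : ℝ) / m * (N m / m - 1 / m) + q * (1 - 1 / m)) / 2) := by
      rw [Nat.cast_add, Nat.cast_mul, sum_range_cast, sum_range_cast]
      field_simp
    have h1 := H m (M m) (N m) hm rfl (by
      rw [← Nat.cast_le (α := ℝ), hEm, Nat.cast_mul]
      have : (m : ℝ) * N m = m ^ 2 * (N m / m) := by field_simp
      rw [this]
      gcongr)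
    generalize (∑ i ∈ Finset.range (N m), i + q * ∑ i ∈ Finset.range m, i : ℕ) = E at *
    rw [← Int.cast_le (R := ℝ)] at h1
    push_cast [Nat.cast_sub (show n ≤ M m + 2 by omega)] at h1
    rw [hEm] at h1
    refine le_of_mul_le_mul_left ?_ (pow_pos hm0' 2)
    have e1 : (m : ℝ) ^ 2 * ((n + 1) * (q * ((M m : ℝ) / m + (2 - n) * (1 / m)))) =
        (n + 1) * (q * (M m + 2 - n) * m) := by
      field_simp
      ring
    have e2 : (m : ℝ) ^ 2 * ((N m : ℝ) / m + (n + 1) * (2 * a * ((N m : ℝ) / m * (1 / m))) +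
      (n + 1) * (((M m : ℝ) / m + n * (1 / m)) * (N m / m)) + N m / m * P +
      n ^ 2 * (1 / m * (1 / m))) = m * N m + (n + 1) * (2 * N m * a) + (n + 1) * ((M m + n) * N m) +
        (m * N m * P + n ^ 2) := by
      field_simp
      ring
    rw [e2, mul_add, e1]
    linarith)
  have h2 : s * ((q : ℝ) - n * (n - 1) * s) ≤ s * P := by
    have : ((n : ℝ) + 1) * r = s - 1 := by linarith
    have h3 : (2 - n : ℝ) * (n + 1) * q + q * (s - 1) ≤ s + (s - 1) * s + s * P := by
      rw [← this]
      linarith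
    nlinarith
  exact le_of_mul_le_mul_left h2 (by linarith)

end

section

open LaurentSeries

/-- The lower bound for the number of rational points of a smooth affine plane curve with a
hyperflex at infinity. -/
theorem IsFlexCurve.sub_mul_sqrt_le_card {k : Type*} [Field k] [Fintype k] {n : ℕ}
    {S : Finset (ℕ × ℕ)} {c : ℕ × ℕ → k} (h : IsFlexCurve n S c)
    (hu : MvPolynomial.aeval ![PlaneCoordRing.x S c, PlaneCoordRing.y S c]
      (MvPolynomial.pderiv 1 (planeCurve S c)) ≠ 0) :
    (Fintype.card k : ℝ) - n * (n - 1) * √(Fintype.card k) ≤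
      Nat.card {p : k × k // MvPolynomial.aeval ![p.1, p.2] (planeCurve S c) = 0} := by
  obtain ⟨π, w, hπ, hw0, hπx, hπy⟩ := h.exists_isPoleMap
  have := hπ.isDomain
  have hq : 1 < Fintype.card k := Fintype.one_lt_card
  let K := FractionRing (PlaneCoordRing S c)
  have hinj := IsFractionRing.injective (PlaneCoordRing S c) K
  let ι := algebraMap (PlaneCoordRing S c) K
  have hιk (a : k) : ι (algebraMap k _ a) = algebraMap k K a :=
    (IsScalarTower.algebraMap_apply k (PlaneCoordRing S c) K a).symm
  let ψ : K →+* k⸨X⸩ := IsFractionRing.lift (g := (π : PlaneCoordRing S c →+* k⸨X⸩)) hπ.injective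
  have hψ (a) : ψ (ι a) = π a := IsFractionRing.lift_algebraMap _ a
  have hu' : MvPolynomial.aeval ![ι (PlaneCoordRing.x S c), ι (PlaneCoordRing.y S c)]
      (MvPolynomial.pderiv 1 (planeCurve S c)) ≠ 0 := by
    rw [← MvPolynomial.map_aeval_pair ι hιk]
    exact (map_ne_zero_iff _ hinj).2 hu
  obtain ⟨d⟩ : Nonempty (SecantData S c (ι (PlaneCoordRing.x S c)) (ι (PlaneCoordRing.y S c))) := by
    refine SecantData.nonempty ?_ hu' ?_
    · rw [← MvPolynomial.map_aeval_pair ι hιk, PlaneCoordRing.aeval_eq_zero, map_zero]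
    · rw [← map_pow]
      exact hinj.ne (hπ.x_pow_ne h.pos hq)
  refine sub_mul_sqrt_le_of_forall_le (a := 5 * n ^ 2 + 2 * n) hq fun m M N hM hN hmN => ?_
  obtain ⟨g, hg⟩ := d.exists_det_ne_zero h hu' (M := M) (m := m) (nf := 5 * n ^ 2 + 2 * n) (N := N)
    (by nlinarith) hN
  let e : ((Fin (n + 1) × Fin (M + 1)) ⊕ Fin (5 * n ^ 2 + 2 * n)) ⊕ Fin m ≃ Fin N :=
    Fintype.equivFinOfCardEq (by simpa using hN)
  have h1 := d.order_det_le h.pos hπ hψ rfl rfl hu' hmN (hg e)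
  have h2 := d.le_order_det h hM (ψ := ψ) (fun a => by
    rw [← hιk, hψ, AlgHom.commutes, HahnSeries.ofPowerSeries_C,
      LaurentSeries.algebraMap_eq_C]) hw0 (by rw [hψ, hπx]) (by rw [hψ, hπy]) (hg e)
  have h3 := h2.trans (add_le_add_right h1 _)
  push_cast at h3 ⊢
  exact h3

end

theorem IsFlexCurve.aeval_pderiv_ne_zero {k : Type*} [Field k] {n : ℕ} {S : Finset (ℕ × ℕ)}
    {c : ℕ × ℕ → k} (h : IsFlexCurve n S c) (hS : (0, 1) ∈ S) (hc : c (0, 1) ≠ 0) :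
    MvPolynomial.aeval ![PlaneCoordRing.x S c, PlaneCoordRing.y S c]
      (MvPolynomial.pderiv 1 (planeCurve S c)) ≠ 0 := by
  obtain ⟨π, w, hπ, -⟩ := h.exists_isPoleMap
  set x := PlaneCoordRing.x S c
  set y := PlaneCoordRing.y S c
  intro h0
  rw [← secantY_self, secantY, ← Finset.add_sum_erase S _ hS] at h0
  have hmem : ∑ m ∈ S.erase (0, 1), algebraMap k (PlaneCoordRing S c) (c m) * x ^ m.1 *
      ∑ p ∈ Finset.range m.2, y ^ p * y ^ (m.2 - 1 - p) ∈
      Submodule.span k ((fun m : Fin (n + 1) × ℕ => x ^ (m.1 : ℕ) * y ^ m.2) '' {(0, 0)}ᶜ) := by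
    refine Submodule.sum_mem _ fun m hm => ?_
    rw [Finset.mul_sum]
    refine Submodule.sum_mem _ fun p hp => ?_
    rw [Finset.mem_range] at hp
    rw [← pow_add, mul_assoc, ← Algebra.smul_def]
    refine Submodule.smul_mem _ _ (Submodule.subset_span ?_)
    rw [Finset.mem_erase] at hm
    have hle := h.le m hm.2 (by rintro rfl; simp at hp)
    refine ⟨(⟨m.1, by omega⟩, p + (m.2 - 1 - p)), fun h' => hm.1 ?_, rfl⟩
    simp only [Set.mem_singleton_iff, Prod.mk.injEq, Fin.ext_iff, Fin.val_zero] at h'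
    ext <;> simp <;> omega
  rw [add_comm, add_eq_zero_iff_eq_neg] at h0
  rw [h0, Submodule.neg_mem_iff] at hmem
  refine hπ.linearIndependent.notMem_span_image (s := {(0, 0)}ᶜ) (x := (0, 0)) (by simp) ?_
  have := Submodule.smul_mem _ (c (0, 1))⁻¹ hmem
  simpa [← Algebra.smul_def, Algebra.algebraMap_eq_smul_one, smul_smul, hc] using this

/-- A curve as in `IsFlexCurve` has at most `n + 1` points on a horizontal line. -/
theorem IsFlexCurve.ncard_horizontal_le {k : Type*} [Field k] {n : ℕ}
    {S : Finset (ℕ × ℕ)} {c : ℕ × ℕ → k} (h : IsFlexCurve n S c) (v : k) :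
    {p : k × k | p.2 = v ∧ ∑ m ∈ S, c m * p.1 ^ m.1 * p.2 ^ m.2 = 0}.ncard ≤ n + 1 := by
  classical
  set P : Polynomial k := ∑ m ∈ S, Polynomial.C (c m * v ^ m.2) * Polynomial.X ^ m.1 with hP
  have hdeg : P.natDegree ≤ n + 1 := Polynomial.natDegree_sum_le_of_forall_le _ _ fun m hm =>
    (Polynomial.natDegree_C_mul_X_pow_le _ _).trans ((Nat.le_add_right _ _).trans (h.le_succ hm))
  have hP0 : P ≠ 0 := by
    intro h0
    have := congrArg (Polynomial.coeff · (n + 1)) h0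
    simp only [hP, Polynomial.finsetSum_coeff, Polynomial.coeff_C_mul_X_pow,
      Polynomial.coeff_zero] at this
    rw [Finset.sum_eq_single_of_mem _ h.left_mem] at this
    · simp [h.left_ne] at this
    · intro m hm hne
      have := h.le m hm hne
      rw [if_neg (by omega)]
  have hsub : {p : k × k | p.2 = v ∧ ∑ m ∈ S, c m * p.1 ^ m.1 * p.2 ^ m.2 = 0} ⊆
      (P.roots.toFinset.image (·, v) : Finset (k × k)) := by
    rintro ⟨s, t⟩ ⟨ht, hs⟩
    simp only at ht hs
    subst ht
    have : P.eval s = 0 := by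
      rw [hP, Polynomial.eval_finsetSum, ← hs]
      exact Finset.sum_congr rfl fun m _ => by simp; ring
    simp [hP0, this]
  refine (Set.ncard_le_ncard hsub (Finset.finite_toSet _)).trans ?_
  rw [Set.ncard_coe_finset]
  exact Finset.card_image_le.trans ((Multiset.toFinset_card_le _).trans
    ((Polynomial.card_roots' _).trans hdeg))

section Collision

variable {F : Type*} [Field F]

/-- The pairs `(a, j + 1)`, as an embedding of the pairs `(a, j)`. -/
def pairSucc : (_ : ℕ) × ℕ ↪ ℕ × ℕ where
  toFun p := (p.1, p.2 + 1)
  inj' p p' h := by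
    simp only [Prod.mk.injEq, Nat.add_right_cancel_iff] at h
    exact Sigma.ext h.1 (heq_of_eq h.2)

theorem pairSucc_apply (p : (_ : ℕ) × ℕ) : pairSucc p = (p.1, p.2 + 1) := rfl

/-- The exponents `(a, j)` with `a + j ≤ n` and `1 ≤ j`, and `(n + 1, 0)`. -/
def collisionSupport (n : ℕ) : Finset (ℕ × ℕ) :=
  insert (n + 1, 0) (((Finset.range n).sigma fun a => Finset.range (n - a)).map pairSucc)

/-- The coefficients of the curve of collisions of `h`, in the coordinates `1 / x` and `y / x`. -/
def collisionCoeff (n : ℕ) (b : F) (h : Polynomial F) (m : ℕ × ℕ) : F :=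
  if m = (n + 1, 0) then b else h.coeff (n - m.1)

theorem mem_collisionSupport {n : ℕ} {m : ℕ × ℕ} :
    m ∈ collisionSupport n ↔ m = (n + 1, 0) ∨ (1 ≤ m.2 ∧ m.1 + m.2 ≤ n) := by
  obtain ⟨a, j⟩ := m
  rw [collisionSupport, Finset.mem_insert, Finset.mem_map]
  refine or_congr_right ⟨?_, fun h => ⟨⟨a, j - 1⟩, ?_, ?_⟩⟩
  · rintro ⟨⟨a', j'⟩, h, h'⟩
    simp only [Finset.mem_sigma, Finset.mem_range, pairSucc_apply, Prod.mk.injEq] at h h' ⊢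
    omega
  · simp only [Finset.mem_sigma, Finset.mem_range] at h ⊢
    omega
  · simp only [pairSucc_apply, Prod.mk.injEq, true_and] at h ⊢
    omega

theorem isFlexCurve_collision {n : ℕ} (hn : 1 ≤ n) {b : F} (hb : b ≠ 0) {h : Polynomial F}
    (hh : h.coeff n ≠ 0) : IsFlexCurve n (collisionSupport n) (collisionCoeff n b h) where
  pos := hn
  le m hm hne := ((mem_collisionSupport.1 hm).resolve_left hne).2
  left_mem := mem_collisionSupport.2 (.inl rfl)
  left_ne := by simpa [collisionCoeff] using hb
  right_mem := mem_collisionSupport.2 (.inr ⟨hn, by simp⟩)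
  right_ne := by simpa [collisionCoeff] using hh

theorem sum_collision (n : ℕ) (b : F) (h : Polynomial F) (s v : F) :
    ∑ m ∈ collisionSupport n, collisionCoeff n b h m * s ^ m.1 * v ^ m.2 =
      b * s ^ (n + 1) + ∑ a ∈ Finset.range n, h.coeff (n - a) * s ^ a *
        ∑ j ∈ Finset.range (n - a), v ^ (j + 1) := by
  rw [collisionSupport, Finset.sum_insert (by simp [pairSucc_apply]), Finset.sum_map, Finset.sum_sigma]
  simp only [collisionCoeff, if_true, pow_zero, mul_one, pairSucc_apply,
    Prod.mk.injEq, Nat.succ_ne_zero, and_false, if_false, Finset.mul_sum]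

theorem pow_mul_eval_inv_sub (n : ℕ) {h : Polynomial F} (hh : h.natDegree = n) {s : F}
    (hs : s ≠ 0) (v : F) :
    s ^ n * (h.eval s⁻¹ - h.eval (v * s⁻¹)) =
      ∑ a ∈ Finset.range n, h.coeff (n - a) * s ^ a * (1 - v ^ (n - a)) := by
  rw [Polynomial.eval_eq_sum_range, Polynomial.eval_eq_sum_range, hh, ← Finset.sum_sub_distrib,
    ← Finset.sum_range_reflect, Finset.sum_range_succ, mul_add, Finset.mul_sum]
  simp only [Nat.add_sub_cancel, Nat.sub_self, pow_zero, sub_self, mul_zero, add_zero]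
  refine Finset.sum_congr rfl fun a ha => ?_
  have : s ^ n = s ^ a * s ^ (n - a) := by
    rw [← pow_add, Nat.add_sub_cancel' (Finset.mem_range.1 ha).le]
  have h1 : s ^ (n - a) * s⁻¹ ^ (n - a) = 1 := by rw [← mul_pow, mul_inv_cancel₀ hs, one_pow]
  rw [this, mul_pow]
  linear_combination h.coeff (n - a) * s ^ a * (1 - v ^ (n - a)) * h1

theorem collision_of_sum_eq_zero {n : ℕ} {b : F} {h : Polynomial F} (hh : h.natDegree = n) {s v : F}
    (hs : s ≠ 0)
    (h0 : ∑ m ∈ collisionSupport n, collisionCoeff n b h m * s ^ m.1 * v ^ m.2 = 0) :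
    s⁻¹ * (v * s⁻¹) * (h.eval s⁻¹ - h.eval (v * s⁻¹)) + b * (s⁻¹ - v * s⁻¹) = 0 := by
  have h1 := pow_mul_eval_inv_sub n hh hs v
  have h2 : ∑ a ∈ Finset.range n, h.coeff (n - a) * s ^ a * (1 - v ^ (n - a)) * v = (1 - v) *
      ∑ a ∈ Finset.range n, h.coeff (n - a) * s ^ a * ∑ j ∈ Finset.range (n - a), v ^ (j + 1) := by
    rw [Finset.mul_sum]
    refine Finset.sum_congr rfl fun a _ => ?_
    rw [← mul_neg_geom_sum]
    simp only [pow_succ, ← Finset.sum_mul]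
    ring
  rw [sum_collision] at h0
  rw [← Finset.sum_mul, ← h1] at h2
  have h3 : s * s⁻¹ = 1 := mul_inv_cancel₀ hs
  refine (mul_eq_zero.1 (?_ : s ^ (n + 2) * _ = 0)).resolve_left (pow_ne_zero _ hs)
  generalize h.eval s⁻¹ - h.eval (v * s⁻¹) = e at h2 ⊢
  linear_combination h2 + (1 - v) * h0 + (s ^ n * v * e * (s * s⁻¹ + 1) +
    s ^ (n + 1) * b * (1 - v)) * h3

theorem sum_collision_zero_right (n : ℕ) (b : F) (h : Polynomial F) (s : F) :
    ∑ m ∈ collisionSupport n, collisionCoeff n b h m * s ^ m.1 * 0 ^ m.2 = b * s ^ (n + 1) := by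
  simp [sum_collision]

theorem pow_eq_one_of_collision {n : ℕ} (hn : 1 ≤ n) {b : F} {h : Polynomial F}
    (hh : h.coeff n ≠ 0) {v : F} (hv : v ≠ 0)
    (h0 : ∑ m ∈ collisionSupport n, collisionCoeff n b h m * 0 ^ m.1 * v ^ m.2 = 0) :
    v ^ n = 1 := by
  rw [sum_collision, Finset.sum_eq_single_of_mem 0 (Finset.mem_range.2 hn)
    (fun a _ ha => by simp [ha])] at h0
  simp only [pow_succ, ← Finset.sum_mul] at h0
  have h1 : ∑ j ∈ Finset.range n, v ^ j = 0 := by simpa [hh, hv] using h0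
  rw [← sub_eq_zero, ← geom_sum_mul, h1, zero_mul]

end Collision

/-- The number of `n`-th roots of unity different from `1`, together with `0`. -/
theorem FiniteField.ncard_zero_or_pow_eq_one_le {F : Type*} [Field F] [Fintype F] {n : ℕ}
    (hn : 1 ≤ n) :
    {v : F | v = 0 ∨ v ≠ 1 ∧ v ^ n = 1}.ncard ≤ n.gcd (Fintype.card F - 1) := by
  classical
  set ν := n.gcd (Fintype.card F - 1)
  have hν : 0 < ν := Nat.gcd_pos_of_pos_left _ hn
  set R := (Polynomial.nthRoots ν (1 : F)).toFinset
  have h1 : (1 : F) ∈ R := by simp [R, Polynomial.mem_nthRoots hν]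
  have hsub : {v : F | v = 0 ∨ v ≠ 1 ∧ v ^ n = 1} ⊆ (insert 0 (R.erase 1) : Finset F) := by
    rintro v (rfl | ⟨hv1, hv⟩)
    · simp
    · have hv0 : v ≠ 0 := by rintro rfl; simp [show n ≠ 0 by omega] at hv
      have : v ^ ν = 1 := pow_gcd_eq_one.2 ⟨hv, FiniteField.pow_card_sub_one_eq_one v hv0⟩
      simp [R, Polynomial.mem_nthRoots hν, hv1, this]
  refine (Set.ncard_le_ncard hsub (Finset.finite_toSet _)).trans ?_
  rw [Set.ncard_coe_finset]
  refine (Finset.card_insert_le _ _).trans ?_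
  rw [Finset.card_erase_add_one h1]
  exact (Multiset.toFinset_card_le _).trans (Polynomial.card_nthRoots _ _)

theorem collision_count_lower_bound
    {F : Type*} [Field F] [Fintype F] (q k : ℕ)
    (hq : Fintype.card F = q)
    (btilde : F) (hb : btilde ≠ 0)
    (h : Polynomial F) (hk1 : 1 ≤ k) (hk2 : k < q - 1) (hdeg : h.natDegree = k) :
    (({p : F × F | p.1 ≠ 0 ∧ p.2 ≠ 0 ∧ p.1 ≠ p.2 ∧
        p.1 * p.2 * (h.eval p.1 - h.eval p.2) + btilde * (p.1 - p.2) = 0}.ncard : ℝ)) ≥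
      (q : ℝ) + 1 - (k : ℝ) * ((k : ℝ) - 1) * Real.sqrt q
        - ((Nat.gcd k (q - 1) : ℝ) + (k : ℝ) + 2) := by
  set Z := {p : F × F | p.1 ≠ 0 ∧ p.2 ≠ 0 ∧ p.1 ≠ p.2 ∧
    p.1 * p.2 * (h.eval p.1 - h.eval p.2) + btilde * (p.1 - p.2) = 0}
  have hh : h.coeff k ≠ 0 := by
    rw [← hdeg]
    exact Polynomial.leadingCoeff_ne_zero.2 (by rintro rfl; simp at hdeg; omega)
  have hflex := isFlexCurve_collision hk1 hb hh
  have hbound := hflex.sub_mul_sqrt_le_card (hflex.aeval_pderiv_ne_zero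
    (mem_collisionSupport.2 (.inr ⟨le_rfl, by simpa using hk1⟩)) (by simpa [collisionCoeff] using hh))
  set A := {p : F × F | ∑ m ∈ collisionSupport k,
    collisionCoeff k btilde h m * p.1 ^ m.1 * p.2 ^ m.2 = 0} with hA
  have hcard : Nat.card {p : F × F // MvPolynomial.aeval ![p.1, p.2]
      (planeCurve (collisionSupport k) (collisionCoeff k btilde h)) = 0} = A.ncard := by
    rw [← Nat.card_coe_set_eq]
    simp only [aeval_planeCurve, hA]
    rfl
  have hsub : A ⊆ (Prod.mk 0 '' {v : F | v = 0 ∨ v ≠ 1 ∧ v ^ k = 1} ∪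
      {p : F × F | p.2 = 1 ∧ ∑ m ∈ collisionSupport k,
        collisionCoeff k btilde h m * p.1 ^ m.1 * p.2 ^ m.2 = 0}) ∪
      (fun p : F × F => (p.1⁻¹, p.2 * p.1⁻¹)) '' Z := by
    rintro ⟨s, v⟩ hsv
    by_cases hv1 : v = 1
    · exact .inl (.inr ⟨hv1, hsv⟩)
    by_cases hs : s = 0
    · subst hs
      refine .inl (.inl ⟨v, ?_, rfl⟩)
      by_cases hv : v = 0
      · exact .inl hv
      · exact .inr ⟨hv1, pow_eq_one_of_collision hk1 hh hv hsv⟩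
    refine .inr ⟨(s⁻¹, v * s⁻¹), ⟨inv_ne_zero hs, mul_ne_zero ?_ (inv_ne_zero hs), ?_,
      collision_of_sum_eq_zero hdeg hs hsv⟩, by simp [hs]⟩
    · rintro rfl
      rw [hA, Set.mem_ofPred_eq, sum_collision_zero_right] at hsv
      exact mul_ne_zero hb (pow_ne_zero _ hs) hsv
    · intro heq
      exact hv1 (by simpa [hs] using heq.symm)
  have h1 := (Set.ncard_image_le (f := Prod.mk (0 : F)) (Set.toFinite _)).trans
    (FiniteField.ncard_zero_or_pow_eq_one_le (F := F) hk1)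
  have h2 := hflex.ncard_horizontal_le 1
  have h3 := Set.ncard_image_le (f := fun p : F × F => (p.1⁻¹, p.2 * p.1⁻¹)) (Set.toFinite Z)
  have h4 := (Set.ncard_le_ncard hsub (Set.toFinite _)).trans ((Set.ncard_union_le _ _).trans
    (Nat.add_le_add ((Set.ncard_union_le _ _).trans (Nat.add_le_add h1 h2)) h3))
  rw [hcard, hq] at hbound
  rw [hq] at h4
  have h5 : (A.ncard : ℝ) ≤ k.gcd (q - 1) + (k + 1) + Z.ncard := by exact_mod_cast h4
  linarith
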